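/- (Quantitative S-arithmetic Khintchine–Groshev theorem) Let d = m + n ≥ 2, let ψ = (ψ_p)_{p∈S} be a collection of approximating functions, let N ∈ ℕ_S and fix (v_m, v_n) ∈ ℤ_S^m × ℤ_S^n. For A = (A_p)_{p∈S} ∈ Mat_{m,n}(ℚ_S) and T = (T_p)_{p∈S}, let N_{ψ,A}(T) be the number of pairs (p⃗, q⃗) ∈ ℤ_S^m × ℤ_S^n with (p⃗, q⃗) ≡ (v_m, v_n) mod N such that for each p ∈ S, ‖A_p q⃗ + p⃗‖_p^m ≤ ψ_p(‖q⃗‖_p^n) and ‖q⃗‖_p^n ≤ T_p; and let V_ψ(T) = 2^m ∫_{{y ∈ ℚ_S^n : ‖y‖_p^n ≤ T_p ∀p∈S}} ∏_{p∈S} ψ_p(‖y‖_p^n) dy. Assume V_ψ(T) → ∞ as T → ∞ (i.e., as T_p → ∞ for every p ∈ S). Then for almost every A ∈ Mat_{m,n}(ℚ_S), lim_{T→∞} N_{ψ,A}(T) / (V_ψ(T)/N^d) = 1. -/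

import Mathlib

open MeasureTheory Matrix

noncomputable section

/-- `z` belongs to the ring of `S`-integers `ℤ_S = ℤ[1/P]`,
where `P` is the product of the finite primes in `S`. -/
def IsZS (P : ℕ) (z : ℚ) : Prop := ∃ (a : ℤ) (k : ℕ), z = (a : ℚ) / (P : ℚ) ^ k

/-- A collection of approximating functions `ψ = (ψ_p)_{p ∈ S}`:
each `ψ_p : ℝ_{>0} → ℝ_{>0}` is non-increasing and `≡ 1` on `(0,1]`
(we extend by `1` on `t ≤ 1`); moreover for each finite place `p`,
`ψ_p` is constant on `{p^{kn}, …, p^{kn+n-1}}` for every `k ∈ ℤ` and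
takes values in `p^{mℤ}` on `p^ℤ`. -/
structure ApproxFamily (m n s : ℕ) (p : Fin s → ℕ) : Type where
  psiR : ℝ → ℝ
  psiP : Fin s → ℝ → ℝ
  posR : ∀ t, 0 < psiR t
  antiR : ∀ ⦃t₁ t₂ : ℝ⦄, 0 < t₁ → t₁ ≤ t₂ → psiR t₂ ≤ psiR t₁
  oneR : ∀ ⦃t : ℝ⦄, t ≤ 1 → psiR t = 1
  posP : ∀ i t, 0 < psiP i t
  antiP : ∀ i ⦃t₁ t₂ : ℝ⦄, 0 < t₁ → t₁ ≤ t₂ → psiP i t₂ ≤ psiP i t₁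
  oneP : ∀ i ⦃t : ℝ⦄, t ≤ 1 → psiP i t = 1
  constP : ∀ i (k : ℤ) (j : ℕ), j < n →
    psiP i ((p i : ℝ) ^ (k * n + j : ℤ)) = psiP i ((p i : ℝ) ^ (k * n : ℤ))
  valsP : ∀ i (k : ℤ), ∃ l : ℤ, psiP i ((p i : ℝ) ^ k) = (p i : ℝ) ^ (m * l : ℤ)

/-- The real components of the diagonal embedding of a rational vector. -/
def ratR {k : ℕ} (q : Fin k → ℚ) : Fin k → ℝ := fun j => (q j : ℝ)

/-- The `p i`-adic components of the diagonal embedding of a rational vector. -/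
def ratP {s : ℕ} (p : Fin s → ℕ) [∀ i, Fact (p i).Prime] {k : ℕ} (i : Fin s)
    (q : Fin k → ℚ) : Fin k → ℚ_[p i] := fun j => (q j : ℚ_[p i])

/-- The region `E_f(T) ⊆ ℚ_S^m × ℚ_S^n` cut out by `‖x‖_p^m ≤ f_p(‖y‖_p^n)` and
`‖y‖_p^n ≤ T_p` for all `p ∈ S` (product coordinates). -/
def Eprod (m n : ℕ) {s : ℕ} (p : Fin s → ℕ) [∀ i, Fact (p i).Prime]
    (fR : ℝ → ℝ) (fP : Fin s → ℝ → ℝ) (TR : ℝ) (TP : Fin s → ℝ) :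
    Set (((Fin m → ℝ) × ∀ i, Fin m → ℚ_[p i]) × ((Fin n → ℝ) × ∀ i, Fin n → ℚ_[p i])) :=
  {xy | ‖xy.1.1‖ ^ m ≤ fR (‖xy.2.1‖ ^ n) ∧ ‖xy.2.1‖ ^ n ≤ TR ∧
      ∀ i, ‖xy.1.2 i‖ ^ m ≤ fP i (‖xy.2.2 i‖ ^ n) ∧ ‖xy.2.2 i‖ ^ n ≤ TP i}

/-- The region `E_f(T) ⊆ ℚ_S^{m+n}`, where the first `m` coordinates play the role of
`x` and the last `n` coordinates the role of `y`. -/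
def Efull (m n : ℕ) {s : ℕ} (p : Fin s → ℕ) [∀ i, Fact (p i).Prime]
    (fR : ℝ → ℝ) (fP : Fin s → ℝ → ℝ) (TR : ℝ) (TP : Fin s → ℝ) :
    Set ((Fin (m + n) → ℝ) × ∀ i, Fin (m + n) → ℚ_[p i]) :=
  {v | ‖fun a : Fin m => v.1 (Fin.castAdd n a)‖ ^ m
        ≤ fR (‖fun b : Fin n => v.1 (Fin.natAdd m b)‖ ^ n) ∧
      ‖fun b : Fin n => v.1 (Fin.natAdd m b)‖ ^ n ≤ TR ∧
      ∀ i, ‖fun a : Fin m => v.2 i (Fin.castAdd n a)‖ ^ m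
            ≤ fP i (‖fun b : Fin n => v.2 i (Fin.natAdd m b)‖ ^ n) ∧
          ‖fun b : Fin n => v.2 i (Fin.natAdd m b)‖ ^ n ≤ TP i}

/-- The operator norm of a real matrix acting on sup-normed spaces. -/
def opNorm {k l : ℕ} (M : Matrix (Fin k) (Fin l) ℝ) : ℝ :=
  ‖LinearMap.toContinuousLinearMap M.mulVecLin‖

/-- An element of the group `𝐇 = ∏_{p ∈ S} H_p` of block lower-triangular matrices,
given by its blocks at each place. -/
structure HElem (m n : ℕ) (s : ℕ) (p : Fin s → ℕ) [∀ i, Fact (p i).Prime] : Type where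
  aR : Matrix (Fin m) (Fin m) ℝ
  bR : Matrix (Fin n) (Fin m) ℝ
  cR : Matrix (Fin n) (Fin n) ℝ
  aP : ∀ i, Matrix (Fin m) (Fin m) ℚ_[p i]
  bP : ∀ i, Matrix (Fin n) (Fin m) ℚ_[p i]
  cP : ∀ i, Matrix (Fin n) (Fin n) ℚ_[p i]

/-- The action of an element of `𝐇` on `ℚ_S^m × ℚ_S^n`:
`h·(x, y) = (α x, β x + γ y)` at each place. -/
def HElem.act {m n s : ℕ} {p : Fin s → ℕ} [∀ i, Fact (p i).Prime] (h : HElem m n s p)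
    (xy : ((Fin m → ℝ) × ∀ i, Fin m → ℚ_[p i]) × ((Fin n → ℝ) × ∀ i, Fin n → ℚ_[p i])) :
    ((Fin m → ℝ) × ∀ i, Fin m → ℚ_[p i]) × ((Fin n → ℝ) × ∀ i, Fin n → ℚ_[p i]) :=
  ((h.aR.mulVec xy.1.1, fun i => (h.aP i).mulVec (xy.1.2 i)),
   (h.bR.mulVec xy.1.1 + h.cR.mulVec xy.2.1,
    fun i => (h.bP i).mulVec (xy.1.2 i) + (h.cP i).mulVec (xy.2.2 i)))

/-- Membership in `H̃_{∞,ε}`: operator norm bounds on the blocks. -/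
def inHtilde (m n : ℕ) (ε : ℝ) (α : Matrix (Fin m) (Fin m) ℝ) (β : Matrix (Fin n) (Fin m) ℝ)
    (γ : Matrix (Fin n) (Fin n) ℝ) : Prop :=
  opNorm α ^ m ≤ 1 + ε ∧ opNorm γ ^ n ≤ 1 + ε / 2 ∧ opNorm β ≤ ε / (4 * n)

/-- `h ∈ (H̃_{∞,ε} ∩ H̃_{∞,ε}⁻¹) × ∏_{p ∈ S_f} H_p(ℤ_p)`. -/
def HElem.isAdmissible {m n s : ℕ} {p : Fin s → ℕ} [∀ i, Fact (p i).Prime]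
    (h : HElem m n s p) (ε : ℝ) : Prop :=
  IsUnit h.aR.det ∧ IsUnit h.cR.det ∧
  inHtilde m n ε h.aR h.bR h.cR ∧
  inHtilde m n ε h.aR⁻¹ (-(h.cR⁻¹ * h.bR * h.aR⁻¹)) h.cR⁻¹ ∧
  ∀ i, ((∀ a b, ‖h.aP i a b‖ ≤ 1) ∧ ‖(h.aP i).det‖ = 1) ∧
      ((∀ a b, ‖h.cP i a b‖ ≤ 1) ∧ ‖(h.cP i).det‖ = 1) ∧
      (∀ a b, ‖h.bP i a b‖ ≤ 1)

end

noncomputable section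

/-- The counting function `N_{ψ,A}(T)`: the number of pairs
`(p⃗, q⃗) ∈ ℤ_S^m × ℤ_S^n` with `(p⃗, q⃗) ≡ (v_m, v_n) mod N` such that for every
place `p ∈ S`, `‖A_p q⃗ + p⃗‖_p^m ≤ ψ_p(‖q⃗‖_p^n)` and `‖q⃗‖_p^n ≤ T_p`. -/
def KGcount (m n : ℕ) {s : ℕ} (p : Fin s → ℕ) [∀ i, Fact (p i).Prime]
    (ψ : ApproxFamily m n s p) (N : ℕ) (vm : Fin m → ℚ) (vn : Fin n → ℚ)
    (AR : Fin m → Fin n → ℝ) (AP : ∀ i, Fin m → Fin n → ℚ_[p i])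
    (TR : ℝ) (TP : Fin s → ℝ) : ℕ :=
  Set.ncard {pq : (Fin m → ℚ) × (Fin n → ℚ) |
    (∀ a, IsZS (∏ i, p i) (pq.1 a)) ∧ (∀ b, IsZS (∏ i, p i) (pq.2 b)) ∧
    (∀ a, IsZS (∏ i, p i) ((pq.1 a - vm a) / N)) ∧
    (∀ b, IsZS (∏ i, p i) ((pq.2 b - vn b) / N)) ∧
    ‖fun a => (∑ b, AR a b * (pq.2 b : ℝ)) + (pq.1 a : ℝ)‖ ^ m
      ≤ ψ.psiR (‖ratR pq.2‖ ^ n) ∧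
    ‖ratR pq.2‖ ^ n ≤ TR ∧
    ∀ i, ‖fun a => (∑ b, AP i a b * ((pq.2 b : ℚ) : ℚ_[p i])) + ((pq.1 a : ℚ) : ℚ_[p i])‖ ^ m
        ≤ ψ.psiP i (‖ratP p i pq.2‖ ^ n) ∧
      ‖ratP p i pq.2‖ ^ n ≤ TP i}

/-- The volume `V_ψ(T) = 2^m ∫_{{y ∈ ℚ_S^n : ‖y‖_p^n ≤ T_p ∀ p}} ∏_p ψ_p(‖y‖_p^n) dy`. -/
def KGvol (m n : ℕ) {s : ℕ} (p : Fin s → ℕ) [∀ i, Fact (p i).Prime]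
    [∀ i, MeasurableSpace ℚ_[p i]]
    (ψ : ApproxFamily m n s p) (μ : ∀ i, Measure (Fin n → ℚ_[p i]))
    (TR : ℝ) (TP : Fin s → ℝ) : ℝ :=
  2 ^ m * (∫⁻ y in {y : (Fin n → ℝ) × (∀ i, Fin n → ℚ_[p i]) |
      ‖y.1‖ ^ n ≤ TR ∧ ∀ i, ‖y.2 i‖ ^ n ≤ TP i},
    ENNReal.ofReal (ψ.psiR (‖y.1‖ ^ n) * ∏ i, ψ.psiP i (‖y.2 i‖ ^ n))
    ∂((volume : Measure (Fin n → ℝ)).prod (Measure.pi μ))).toReal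

section

open Set
open scoped ENNReal NNReal

/-- Layer cake formula for products of finitely many functions. -/
theorem lintegral_prod_ofReal_eq {I α : Type*} [Fintype I] [MeasurableSpace α] (κ : Measure α)
    [SFinite κ] (G : I → α → ℝ) (hG : ∀ v, Measurable (G v)) :
    ∫⁻ x, ∏ v, ENNReal.ofReal (G v x) ∂κ
      = ∫⁻ u : I → ℝ, κ {x | ∀ v, 0 < u v ∧ u v < G v x} := by
  have hS : MeasurableSet {z : α × (I → ℝ) | ∀ v, 0 < z.2 v ∧ z.2 v < G v z.1} := by
    rw [ofPred_forall]
    refine MeasurableSet.iInter fun v => ?_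
    have h2 : Measurable fun z : α × (I → ℝ) => z.2 v := (measurable_pi_apply v).comp measurable_snd
    exact (measurableSet_lt measurable_const h2).inter
      (measurableSet_lt h2 ((hG v).comp measurable_fst))
  have h1 : ∀ x, ∏ v, ENNReal.ofReal (G v x)
      = ∫⁻ u : I → ℝ, indicator {z : α × (I → ℝ) | ∀ v, 0 < z.2 v ∧ z.2 v < G v z.1} 1 (x, u) := by
    intro x
    have : (fun u : I → ℝ => indicator {z : α × (I → ℝ) | ∀ v, 0 < z.2 v ∧ z.2 v < G v z.1}
        (1 : α × (I → ℝ) → ℝ≥0∞) (x, u)) = indicator (univ.pi fun v => Ioo 0 (G v x)) 1 := by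
      ext u
      simp [indicator, mem_pi]
    rw [this, lintegral_indicator_one (MeasurableSet.univ_pi fun _ => measurableSet_Ioo),
      volume_pi, Measure.pi_pi]
    simp
  simp_rw [h1]
  rw [lintegral_lintegral_swap (f := fun x u => indicator
    {z : α × (I → ℝ) | ∀ v, 0 < z.2 v ∧ z.2 v < G v z.1} 1 (x, u))
    ((measurable_one.indicator hS).aemeasurable)]
  refine lintegral_congr fun u => ?_
  exact lintegral_indicator_one (measurable_prodMk_right (y := u) hS)

/-- Layer cake formula for sums of products of finitely many functions. -/
theorem tsum_prod_ofReal_eq {I α : Type*} [Fintype I] [Countable α] (G : I → α → ℝ) :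
    ∑' x, ∏ v, ENNReal.ofReal (G v x)
      = ∫⁻ u : I → ℝ, ∑' x, indicator {x | ∀ v, 0 < u v ∧ u v < G v x} 1 x := by
  have h1 : ∀ x, ∏ v, ENNReal.ofReal (G v x)
      = ∫⁻ u : I → ℝ, indicator {x | ∀ v, 0 < u v ∧ u v < G v x} 1 x := by
    intro x
    have : (fun u : I → ℝ => indicator {x | ∀ v, 0 < u v ∧ u v < G v x} (1 : α → ℝ≥0∞) x)
      = indicator (univ.pi fun v => Ioo 0 (G v x)) 1 := by
      ext u
      simp [indicator, mem_pi]
    rw [this, lintegral_indicator_one (MeasurableSet.univ_pi fun _ => measurableSet_Ioo),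
      volume_pi, Measure.pi_pi]
    simp
  simp_rw [h1]
  rw [lintegral_tsum]
  intro x
  have : (fun u : I → ℝ => indicator {x | ∀ v, 0 < u v ∧ u v < G v x} (1 : α → ℝ≥0∞) x)
      = indicator (univ.pi fun v => Ioo 0 (G v x)) 1 := by
    ext u
    simp [indicator, mem_pi]
  rw [this]
  exact (measurable_one.indicator (MeasurableSet.univ_pi fun _ => measurableSet_Ioo)).aemeasurable

theorem lintegral_pi_prod {I : Type*} [Fintype I] {X : I → Type*} [∀ v, MeasurableSpace (X v)]
    (μ : ∀ v, Measure (X v)) [∀ v, SigmaFinite (μ v)] (f : ∀ v, X v → ℝ≥0∞)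
    (hf : ∀ v, Measurable (f v)) :
    ∫⁻ x, ∏ v, f v (x v) ∂(Measure.pi μ) = ∏ v, ∫⁻ x, f v x ∂(μ v) := by
  classical
  by_cases hne : Nonempty (∀ v, X v)
  swap
  · rw [not_nonempty_iff] at hne
    obtain ⟨v, hv⟩ : ∃ v, IsEmpty (X v) := by
      by_contra! h
      exact hne.false (fun v => (h v).some)
    rw [Finset.prod_eq_zero (Finset.mem_univ v) (by simp [Measure.eq_zero_of_isEmpty])]
    simp [Measure.eq_zero_of_isEmpty]
  obtain ⟨x0⟩ := hne
  have hmeas : Measurable fun x : ∀ v, X v => ∏ v, f v (x v) :=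
    Finset.measurable_prod _ fun v _ => (hf v).comp (measurable_pi_apply v)
  have key : ∀ s : Finset I, lmarginal μ s (fun x => ∏ v, f v (x v))
      = fun x => (∏ v ∈ s, ∫⁻ y, f v y ∂(μ v)) * ∏ v ∈ sᶜ, f v (x v) := by
    intro s
    induction s using Finset.induction_on with
    | empty => simp
    | insert a s ha ih =>
      ext x
      rw [lmarginal_insert _ hmeas ha, ih, Finset.prod_insert ha]
      have hc : sᶜ = insert a (insert a s)ᶜ := by
        ext v; by_cases h : v = a <;> simp [h, ha]
      have : ∀ y, ∏ v ∈ sᶜ, f v (Function.update x a y v)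
          = f a y * ∏ v ∈ (insert a s)ᶜ, f v (x v) := by
        intro y
        rw [hc, Finset.prod_insert (by simp)]
        simp only [Function.update_self]
        congr 1
        refine Finset.prod_congr rfl fun v hv => ?_
        rw [Function.update_of_ne]
        rintro rfl
        simp at hv
      simp_rw [this]
      rw [lintegral_const_mul _ ((hf a).mul_const _), lintegral_mul_const _ (hf a)]
      ring
  rw [lintegral_eq_lmarginal_univ x0, key]
  simp

theorem ENNReal.tsum_pi_prod {α : Type*} : ∀ {m : ℕ} (f : Fin m → α → ℝ≥0∞),
    ∑' e : Fin m → α, ∏ a, f a (e a) = ∏ a, ∑' x, f a x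
  | 0, f => by simp [tsum_fintype]
  | m + 1, f => by
    rw [← (Fin.consEquiv fun _ => α).tsum_eq, Fin.prod_univ_succ,
      ← ENNReal.tsum_pi_prod fun a => f a.succ, ENNReal.tsum_prod', ← ENNReal.tsum_mul_right]
    refine tsum_congr fun x => ?_
    rw [← ENNReal.tsum_mul_left]
    refine tsum_congr fun y => ?_
    simp [Fin.prod_univ_succ, Fin.consEquiv]

/-- `F` is a measurable strict fundamental domain for the translations by `ι l`, `l : L`. -/
def IsTile {L G : Type*} [AddCommGroup L] [AddCommGroup G] [MeasurableSpace G] (ι : L →+ G)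
    (F : Set G) : Prop :=
  MeasurableSet F ∧ ∀ x, ∃! l, x + ι l ∈ F

namespace IsTile

variable {L G : Type*} [AddCommGroup L] [AddCommGroup G] [MeasurableSpace G] {ι : L →+ G}
  {F F' : Set G}

theorem tsum_indicator (hF : IsTile ι F) (x : G) :
    ∑' l, indicator F (1 : G → ℝ≥0∞) (x + ι l) = 1 := by
  obtain ⟨l, hl, hu⟩ := hF.2 x
  rw [tsum_eq_single l]
  · simp [indicator, hl]
  · intro l' hl'
    have : x + ι l' ∉ F := fun h => hl' (hu l' h)
    simp [indicator, this]

theorem preimage_add [MeasurableAdd G] (hF : IsTile ι F) (y : G) :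
    IsTile ι ((fun x => x + y) ⁻¹' F) := by
  refine ⟨measurable_add_const y hF.1, fun x => ?_⟩
  have := hF.2 (x + y)
  simpa only [mem_preimage, add_right_comm] using this

theorem pi {n : ℕ} (hF : IsTile ι F) :
    IsTile (AddMonoidHom.compLeft ι (Fin n)) (univ.pi fun _ : Fin n => F) := by
  refine ⟨MeasurableSet.univ_pi fun _ => hF.1, fun x => ?_⟩
  choose l hl hu using fun a => hF.2 (x a)
  refine ⟨l, fun a _ => hl a, fun l' hl' => ?_⟩
  ext a
  exact hu a _ (hl' a (mem_univ a))

theorem prod {L' G' : Type*} [AddCommGroup L'] [AddCommGroup G'] [MeasurableSpace G']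
    {ι' : L' →+ G'} {F' : Set G'} (hF : IsTile ι F) (hF' : IsTile ι' F') :
    IsTile (ι.prodMap ι') (F ×ˢ F') := by
  refine ⟨hF.1.prod hF'.1, fun x => ?_⟩
  obtain ⟨l, hl, hu⟩ := hF.2 x.1
  obtain ⟨l', hl', hu'⟩ := hF'.2 x.2
  refine ⟨(l, l'), ⟨hl, hl'⟩, fun k hk => ?_⟩
  exact Prod.ext (hu _ hk.1) (hu' _ hk.2)

variable [MeasurableAdd₂ G] [Countable L] {μ : Measure G} [μ.IsAddLeftInvariant]

theorem lintegral_eq (hF : IsTile ι F) {g : G → ℝ≥0∞} (hg : Measurable g) :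
    ∫⁻ x, g x ∂μ = ∫⁻ x in F, ∑' l, g (x + ι l) ∂μ := by
  have hm : ∀ l, Measurable fun x => indicator F (1 : G → ℝ≥0∞) (x + ι l) := fun l =>
    (measurable_one.indicator hF.1).comp (measurable_add_const _)
  calc ∫⁻ x, g x ∂μ = ∫⁻ x, ∑' l, indicator F (1 : G → ℝ≥0∞) (x + ι l) * g x ∂μ := by
        simp_rw [ENNReal.tsum_mul_right, hF.tsum_indicator, one_mul]
    _ = ∑' l, ∫⁻ x, indicator F (1 : G → ℝ≥0∞) (x + ι l) * g x ∂μ :=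
        lintegral_tsum fun l => ((hm l).mul hg).aemeasurable
    _ = ∑' l, ∫⁻ x, indicator F (1 : G → ℝ≥0∞) x * g (x + ι (-l)) ∂μ := by
        refine tsum_congr fun l => ?_
        rw [← lintegral_add_right_eq_self (fun x => indicator F (1 : G → ℝ≥0∞) x * g (x + ι (-l)))
          (ι l)]
        simp
    _ = ∑' l, ∫⁻ x, indicator F (1 : G → ℝ≥0∞) x * g (x + ι l) ∂μ :=
        (Equiv.neg L).tsum_eq fun l => ∫⁻ x, indicator F (1 : G → ℝ≥0∞) x * g (x + ι l) ∂μ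
    _ = ∑' l, ∫⁻ x in F, g (x + ι l) ∂μ := by
        refine tsum_congr fun l => ?_
        rw [← lintegral_indicator hF.1]
        refine lintegral_congr fun x => ?_
        by_cases h : x ∈ F <;> simp [h]
    _ = ∫⁻ x in F, ∑' l, g (x + ι l) ∂μ :=
        (lintegral_tsum fun l => (hg.comp (measurable_add_const _)).aemeasurable).symm

theorem setLIntegral_eq_of_periodic (hF : IsTile ι F) (hF' : IsTile ι F') {k : G → ℝ≥0∞}
    (hk : Measurable k) (hper : ∀ x l, k (x + ι l) = k x) :
    ∫⁻ x in F, k x ∂μ = ∫⁻ x in F', k x ∂μ := by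
  rw [← lintegral_indicator hF.1, hF'.lintegral_eq (hk.indicator hF.1)]
  refine lintegral_congr fun x => ?_
  have : ∀ l, indicator F k (x + ι l) = indicator F (1 : G → ℝ≥0∞) (x + ι l) * k x := by
    intro l
    by_cases h : x + ι l ∈ F <;> simp [h, hper]
  simp_rw [this, ENNReal.tsum_mul_right, hF.tsum_indicator, one_mul]

/-- Unfolding: averaging a lattice sum along a surjective homomorphism. -/
theorem unfolding {L' H : Type*} [AddCommGroup L'] [AddCommGroup H] [MeasurableSpace H]
    {ι' : L' →+ H} {F' : Set H} [MeasurableAdd₂ H] [Countable L']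
    {ν : Measure H} [ν.IsAddLeftInvariant] [SFinite μ] [SFinite ν]
    (hF : IsTile ι F) (hF' : IsTile ι' F') (h0 : ν F' ≠ 0) (htop : ν F' ≠ ∞)
    (Φ : G →+ H) (hΦ : Measurable Φ) (hsurj : Function.Surjective Φ)
    (hΦι : ∀ l, ∃ l', Φ (ι l) = ι' l') {g : H → ℝ≥0∞} (hg : Measurable g) :
    ∫⁻ A in F, ∑' l, g (Φ A + ι' l) ∂μ = μ F / ν F' * ∫⁻ x, g x ∂ν := by
  set k : H → ℝ≥0∞ := fun z => ∑' l, g (z + ι' l) with hkdef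
  have hk : Measurable k := Measurable.tsum fun l => hg.comp (measurable_add_const _)
  have hper : ∀ x l, k (x + ι' l) = k x := by
    intro x l
    simp only [hkdef, add_assoc, ← map_add]
    exact (Equiv.addLeft l).tsum_eq fun l' => g (x + ι' l')
  have hJ : ∀ h, ∫⁻ A in F, k (Φ A + h) ∂μ = ∫⁻ A in F, k (Φ A) ∂μ := by
    intro h
    obtain ⟨A0, rfl⟩ := hsurj h
    have hmk : Measurable fun A => k (Φ A) := hk.comp hΦ
    have hperk : ∀ A l, k (Φ (A + ι l)) = k (Φ A) := by
      intro A l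
      obtain ⟨l', hl'⟩ := hΦι l
      rw [map_add, hl', hper]
    rw [hF.setLIntegral_eq_of_periodic (hF.preimage_add (-A0)) hmk hperk]
    have hm' := (hF.preimage_add (-A0)).1
    rw [← lintegral_indicator hF.1, ← lintegral_indicator hm',
      ← lintegral_add_right_eq_self (fun A => indicator _ (fun A => k (Φ A)) A) A0]
    refine lintegral_congr fun A => ?_
    by_cases h : A ∈ F <;> simp [indicator, h]
  have hjoint : Measurable (Function.uncurry fun (h : H) (A : G) => k (Φ A + h)) := by
    exact hk.comp ((hΦ.comp measurable_snd).add measurable_fst)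
  have h1 : ∫⁻ h in F', ∫⁻ A in F, k (Φ A + h) ∂μ ∂ν = ν F' * ∫⁻ A in F, k (Φ A) ∂μ := by
    simp_rw [hJ]
    rw [lintegral_const, Measure.restrict_apply_univ, mul_comm]
  have h2 : ∫⁻ h in F', ∫⁻ A in F, k (Φ A + h) ∂μ ∂ν = μ F * ∫⁻ x, g x ∂ν := by
    rw [lintegral_lintegral_swap hjoint.aemeasurable]
    have : ∀ A, ∫⁻ h in F', k (Φ A + h) ∂ν = ∫⁻ x, g x ∂ν := by
      intro A
      rw [hF'.lintegral_eq hg]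
      rw [hF'.setLIntegral_eq_of_periodic (hF'.preimage_add (-(Φ A))) hk hper]
      have hm' := (hF'.preimage_add (-(Φ A))).1
      rw [← lintegral_indicator hF'.1, ← lintegral_indicator hm',
        ← lintegral_add_right_eq_self (fun x => indicator ((fun x => x + -(Φ A)) ⁻¹' F') k x) (Φ A)]
      refine lintegral_congr fun x => ?_
      by_cases h : x ∈ F' <;> simp [indicator, h, add_comm]
    simp_rw [this]
    rw [lintegral_const, Measure.restrict_apply_univ, mul_comm]
  have h3 := h1.symm.trans h2
  change ∫⁻ A in F, k (Φ A) ∂μ = _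
  rw [ENNReal.mul_comm_div, ← mul_div_assoc, ENNReal.eq_div_iff h0 htop]
  exact h3

theorem lintegral_cond_unfolding {L' H : Type*} [AddCommGroup L'] [AddCommGroup H]
    [MeasurableSpace H]
    {ι' : L' →+ H} {F' : Set H} [MeasurableAdd₂ H] [Countable L']
    {ν : Measure H} [ν.IsAddLeftInvariant] [SFinite μ] [SFinite ν]
    (hF : IsTile ι F) (hμ0 : μ F ≠ 0) (hμtop : μ F ≠ ∞)
    (hF' : IsTile ι' F') (h0 : ν F' ≠ 0) (htop : ν F' ≠ ∞)
    (Φ : G →+ H) (hΦ : Measurable Φ) (hsurj : Function.Surjective Φ)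
    (hΦι : ∀ l, ∃ l', Φ (ι l) = ι' l') {g : H → ℝ≥0∞} (hg : Measurable g) :
    ∫⁻ A, ∑' l, g (Φ A + ι' l) ∂(ProbabilityTheory.cond μ F) = (ν F')⁻¹ * ∫⁻ x, g x ∂ν := by
  rw [ProbabilityTheory.cond, lintegral_smul_measure,
    hF.unfolding hF' h0 htop Φ hΦ hsurj hΦι hg, smul_eq_mul, ← mul_assoc, ← mul_div_assoc,
    ENNReal.inv_mul_cancel hμ0 hμtop, one_div]

end IsTile

end

section

open Set
open scoped ENNReal NNReal

/-- The Haar measure on `ℚ_p` giving measure one to the closed unit ball. -/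
def padicHaar (p : ℕ) [Fact p.Prime] [MeasurableSpace ℚ_[p]] [BorelSpace ℚ_[p]] :
    Measure ℚ_[p] :=
  Measure.addHaarMeasure ⟨⟨Metric.closedBall 0 1, isCompact_closedBall 0 1⟩,
    ⟨0, Metric.ball_subset_interior_closedBall (Metric.mem_ball_self one_pos)⟩⟩

instance (p : ℕ) [Fact p.Prime] [MeasurableSpace ℚ_[p]] [BorelSpace ℚ_[p]] :
    (padicHaar p).IsAddHaarMeasure := by
  unfold padicHaar
  infer_instance

/-- The completion of `ℚ` at a place, where `none` is the archimedean place. -/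
def SField {s : ℕ} (p : Fin s → ℕ) [∀ i, Fact (p i).Prime] : Option (Fin s) → Type
  | none => ℝ
  | some i => ℚ_[p i]

namespace SField

variable {s : ℕ} (p : Fin s → ℕ) [∀ i, Fact (p i).Prime]

instance : ∀ v, NontriviallyNormedField (SField p v)
  | none => inferInstanceAs (NontriviallyNormedField ℝ)
  | some i => inferInstanceAs (NontriviallyNormedField ℚ_[p i])

instance : ∀ v, CharZero (SField p v)
  | none => inferInstanceAs (CharZero ℝ)
  | some i => inferInstanceAs (CharZero ℚ_[p i])

instance : ∀ v, ProperSpace (SField p v)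
  | none => inferInstanceAs (ProperSpace ℝ)
  | some i => inferInstanceAs (ProperSpace ℚ_[p i])

variable [∀ i, MeasurableSpace ℚ_[p i]] [∀ i, BorelSpace ℚ_[p i]]

instance : ∀ v, MeasureSpace (SField p v)
  | none => inferInstanceAs (MeasureSpace ℝ)
  | some i => @MeasureSpace.mk ℚ_[p i] _ (padicHaar (p i))

instance : ∀ v, BorelSpace (SField p v)
  | none => inferInstanceAs (BorelSpace ℝ)
  | some i => inferInstanceAs (BorelSpace ℚ_[p i])

instance : ∀ v, Measure.IsAddHaarMeasure (volume : Measure (SField p v))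
  | none => inferInstanceAs (Measure.IsAddHaarMeasure (volume : Measure ℝ))
  | some i => inferInstanceAs (Measure.IsAddHaarMeasure (padicHaar (p i)))

end SField

instance Pi.sigmaFinite_volume_const {ι X : Type*} [Fintype ι] [MeasureSpace X]
    [SigmaFinite (volume : Measure X)] : SigmaFinite (volume : Measure (ι → X)) :=
  inferInstanceAs (SigmaFinite (Measure.pi fun _ : ι => (volume : Measure X)))

instance Pi.isAddHaarMeasure_volume_const {ι X : Type*} [Fintype ι] [AddGroup X] [MeasureSpace X]
    [TopologicalSpace X] [MeasurableAdd X] [SigmaFinite (volume : Measure X)]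
    [Measure.IsAddHaarMeasure (volume : Measure X)] :
    Measure.IsAddHaarMeasure (volume : Measure (ι → X)) :=
  inferInstanceAs (Measure.IsAddHaarMeasure (Measure.pi fun _ : ι => (volume : Measure X)))


/-- The ring `ℚ_S`, the product of the completions of `ℚ` at the places in `S`. -/
def SAdele {s : ℕ} (p : Fin s → ℕ) [∀ i, Fact (p i).Prime] : Type := ∀ v, SField p v

namespace SAdele

variable {s : ℕ} (p : Fin s → ℕ) [∀ i, Fact (p i).Prime]

instance : CommRing (SAdele p) := inferInstanceAs (CommRing (∀ v, SField p v))

instance : TopologicalSpace (SAdele p) := inferInstanceAs (TopologicalSpace (∀ v, SField p v))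

instance : IsTopologicalRing (SAdele p) := inferInstanceAs (IsTopologicalRing (∀ v, SField p v))

instance : SecondCountableTopology (SAdele p) :=
  inferInstanceAs (SecondCountableTopology (∀ v, SField p v))

instance : LocallyCompactSpace (SAdele p) := inferInstanceAs (LocallyCompactSpace (∀ v, SField p v))

variable [∀ i, MeasurableSpace ℚ_[p i]] [∀ i, BorelSpace ℚ_[p i]]

instance : MeasureSpace (SAdele p) := inferInstanceAs (MeasureSpace (∀ v, SField p v))

instance : BorelSpace (SAdele p) := inferInstanceAs (BorelSpace (∀ v, SField p v))

instance : SigmaFinite (volume : Measure (SAdele p)) :=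
  inferInstanceAs (SigmaFinite (volume : Measure (∀ v, SField p v)))

instance : Measure.IsAddHaarMeasure (volume : Measure (SAdele p)) :=
  inferInstanceAs (Measure.IsAddHaarMeasure (volume : Measure (∀ v, SField p v)))

end SAdele

end

section

open Set
open scoped ENNReal NNReal

section PadicBall

variable (p : ℕ) [Fact p.Prime]

theorem IsUltrametricDist.norm_sub_le_max {E : Type*} [SeminormedAddGroup E] [IsUltrametricDist E]
    (x y : E) : ‖x - y‖ ≤ max ‖x‖ ‖y‖ := by
  rw [sub_eq_add_neg, ← norm_neg y]
  exact IsUltrametricDist.norm_add_le_max _ _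

theorem Padic.exists_natCast_norm_sub_le {x : ℚ_[p]} (hx : ‖x‖ ≤ 1) (k : ℕ) :
    ∃ a : ℕ, ‖x - a‖ ≤ (p : ℝ) ^ (-k : ℤ) := by
  obtain ⟨X, rfl⟩ : ∃ X : ℤ_[p], (X : ℚ_[p]) = x := ⟨⟨x, hx⟩, rfl⟩
  refine ⟨PadicInt.appr X k, ?_⟩
  have := (PadicInt.norm_le_pow_iff_mem_span_pow (p := p) _ k).2 (PadicInt.appr_spec k X)
  rwa [PadicInt.norm_def, PadicInt.coe_sub, PadicInt.coe_natCast] at this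

variable [MeasurableSpace ℚ_[p]] [BorelSpace ℚ_[p]]

theorem padicHaar_closedBall_one : padicHaar p (Metric.closedBall 0 1) = 1 :=
  Measure.addHaarMeasure_self (K₀ := ⟨⟨Metric.closedBall (0 : ℚ_[p]) 1, isCompact_closedBall 0 1⟩,
    ⟨0, Metric.ball_subset_interior_closedBall (Metric.mem_ball_self one_pos)⟩⟩)

theorem padicHaar_closedBall_succ (k : ℤ) :
    padicHaar p (Metric.closedBall 0 ((p : ℝ) ^ (k + 1)))
      = p * padicHaar p (Metric.closedBall 0 ((p : ℝ) ^ k)) := by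
  have hp0 : (p : ℝ) ≠ 0 := by exact_mod_cast (Fact.out : p.Prime).ne_zero
  have hp0' : (p : ℚ_[p]) ≠ 0 := by exact_mod_cast (Fact.out : p.Prime).ne_zero
  have hppos : (0 : ℝ) < p := by exact_mod_cast (Fact.out : p.Prime).pos
  have hnorm : ∀ (k : ℤ) (y : ℚ_[p]), ‖(p : ℚ_[p]) ^ k * y‖ = (p : ℝ) ^ (-k) * ‖y‖ := by
    intro k y
    rw [norm_mul, Padic.norm_p_zpow]
  have hU : Metric.closedBall (0 : ℚ_[p]) ((p : ℝ) ^ (k + 1)) = ⋃ j ∈ Finset.range p,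
      (fun x => x + (p : ℚ_[p]) ^ (-(k + 1)) * (-j)) ⁻¹' Metric.closedBall 0 ((p : ℝ) ^ k) := by
    ext x
    have e1 : ∀ j : ℕ, x + (p : ℚ_[p]) ^ (-(k + 1)) * (-j)
        = (p : ℚ_[p]) ^ (-(k + 1)) * ((p : ℚ_[p]) ^ (k + 1) * x - j) := by
      intro j
      rw [mul_sub, ← mul_assoc, ← zpow_add₀ hp0']
      simp [sub_eq_add_neg]
    simp only [Metric.mem_closedBall, dist_zero_right, mem_iUnion, mem_preimage, Finset.mem_range,
      exists_prop, e1, hnorm, neg_neg]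
    have e2 : ∀ y : ℝ, (p : ℝ) ^ (k + 1) * y ≤ (p : ℝ) ^ k ↔ y ≤ (p : ℝ) ^ (-1 : ℤ) := by
      intro y
      rw [zpow_add_one₀ hp0, mul_assoc, mul_le_iff_le_one_right (zpow_pos hppos k), _root_.zpow_neg_one,
        ← one_div, le_div_iff₀' hppos]
    simp only [e2]
    constructor
    · intro hx
      have hx' : ‖(p : ℚ_[p]) ^ (k + 1) * x‖ ≤ 1 := by
        rw [hnorm]
        calc (p : ℝ) ^ (-(k + 1)) * ‖x‖ ≤ (p : ℝ) ^ (-(k + 1)) * (p : ℝ) ^ (k + 1) := by gcongr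
          _ = 1 := by rw [← zpow_add₀ hp0]; simp
      obtain ⟨X, hX⟩ : ∃ X : ℤ_[p], (X : ℚ_[p]) = (p : ℚ_[p]) ^ (k + 1) * x := ⟨⟨_, hx'⟩, rfl⟩
      obtain ⟨j, hj, hj'⟩ := PadicInt.exists_mem_range (p := p) X
      refine ⟨j, hj, ?_⟩
      rw [← hX]
      have := (PadicInt.norm_le_pow_iff_mem_span_pow (p := p) _ 1).2
        (by simpa [PadicInt.maximalIdeal_eq_span_p] using hj')
      rwa [PadicInt.norm_def, PadicInt.coe_sub, PadicInt.coe_natCast] at this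
    · rintro ⟨j, -, hj⟩
      have h1 : ‖(p : ℚ_[p]) ^ (k + 1) * x‖ ≤ 1 := by
        have : (p : ℚ_[p]) ^ (k + 1) * x = ((p : ℚ_[p]) ^ (k + 1) * x - j) + ((j : ℤ) : ℚ_[p]) := by
          simp
        rw [this]
        refine (IsUltrametricDist.norm_add_le_max _ _).trans (max_le (hj.trans ?_) ?_)
        · rw [_root_.zpow_neg_one]
          exact inv_le_one_of_one_le₀ (by exact_mod_cast (Fact.out : p.Prime).one_lt.le)
        · exact Padic.norm_int_le_one _
      rw [hnorm] at h1
      rw [_root_.zpow_neg, ← div_eq_inv_mul, div_le_one (zpow_pos hppos _)] at h1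
      exact h1
  have hd : (↑(Finset.range p) : Set ℕ).PairwiseDisjoint fun j : ℕ =>
      (fun x => x + (p : ℚ_[p]) ^ (-(k + 1)) * (-j)) ⁻¹' Metric.closedBall 0 ((p : ℝ) ^ k) := by
    intro i hi j hj hij
    refine Set.disjoint_left.2 fun x hx hy => hij ?_
    simp only [Metric.mem_closedBall, dist_zero_right, mem_preimage] at hx hy
    have h1 : ‖(p : ℚ_[p]) ^ (-(k + 1)) * (((i : ℤ) - j : ℤ) : ℚ_[p])‖ ≤ (p : ℝ) ^ k := by
      have : (p : ℚ_[p]) ^ (-(k + 1)) * (((i : ℤ) - j : ℤ) : ℚ_[p])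
        = (x + (p : ℚ_[p]) ^ (-(k + 1)) * (-j)) - (x + (p : ℚ_[p]) ^ (-(k + 1)) * (-i)) := by
        push_cast; ring
      rw [this]
      exact (IsUltrametricDist.norm_sub_le_max _ _).trans (max_le hy hx)
    rw [hnorm, neg_neg, zpow_add_one₀ hp0, mul_assoc,
      mul_le_iff_le_one_right (zpow_pos hppos k), ← le_div_iff₀' hppos, one_div,
      ← _root_.zpow_neg_one] at h1
    have h2 := (Padic.norm_int_le_pow_iff_dvd (p := p) _ 1).1 h1
    rw [pow_one] at h2
    simp only [Finset.coe_range, mem_Iio] at hi hj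
    have h3 := Int.eq_zero_of_abs_lt_dvd h2 (by rw [abs_lt]; omega)
    omega
  rw [hU, measure_biUnion_finset hd
    fun j _ => measurable_add_const _ Metric.isClosed_closedBall.measurableSet]
  simp only [measure_preimage_add_right]
  simp

theorem padicHaar_closedBall (k : ℤ) :
    padicHaar p (Metric.closedBall 0 ((p : ℝ) ^ k)) = ENNReal.ofReal ((p : ℝ) ^ k) := by
  have hp0 : (p : ℝ) ≠ 0 := by exact_mod_cast (Fact.out : p.Prime).ne_zero
  have hpE : (p : ℝ≥0∞) ≠ 0 := by exact_mod_cast (Fact.out : p.Prime).ne_zero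
  induction k with
  | zero => simpa using padicHaar_closedBall_one p
  | succ k ih =>
    rw [padicHaar_closedBall_succ, ih, zpow_add_one₀ hp0, mul_comm,
      ENNReal.ofReal_mul (by positivity), ENNReal.ofReal_natCast]
  | pred k ih =>
    have h := padicHaar_closedBall_succ p (-k - 1)
    rw [sub_add_cancel, ih] at h
    rw [← ENNReal.mul_right_inj hpE (ENNReal.natCast_ne_top p), ← h, ← ENNReal.ofReal_natCast p,
      ← ENNReal.ofReal_mul (by positivity), ← zpow_one_add₀ hp0]
    congr 2; ring

end PadicBall

variable {s : ℕ} (p : Fin s → ℕ) [∀ i, Fact (p i).Prime]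

/-- The ring `ℤ_S` of `S`-integers. -/
def ZS : Subring ℚ where
  carrier := {z | IsZS (∏ i, p i) z}
  zero_mem' := ⟨0, 0, by simp⟩
  one_mem' := ⟨1, 0, by simp⟩
  add_mem' := by
    rintro _ _ ⟨a, k, rfl⟩ ⟨b, l, rfl⟩
    have hP : ((∏ i, p i : ℕ) : ℚ) ≠ 0 := by
      exact_mod_cast Finset.prod_ne_zero_iff.2 fun i _ => (Fact.out : (p i).Prime).ne_zero
    refine ⟨a * (∏ i, p i : ℕ) ^ l + b * (∏ i, p i : ℕ) ^ k, k + l, ?_⟩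
    push_cast at hP ⊢
    field_simp
    rw [pow_add]
    ring
  mul_mem' := by
    rintro _ _ ⟨a, k, rfl⟩ ⟨b, l, rfl⟩
    exact ⟨a * b, k + l, by push_cast; rw [pow_add, div_mul_div_comm]⟩
  neg_mem' := by
    rintro _ ⟨a, k, rfl⟩
    exact ⟨-a, k, by push_cast; ring⟩

namespace ZS

theorem inv_prime_mem (i : Fin s) : ((p i : ℚ))⁻¹ ∈ ZS p := by
  refine ⟨∏ j ∈ Finset.univ.erase i, p j, 1, ?_⟩
  have h : ((∏ i, p i : ℕ) : ℚ) = p i * (∏ j ∈ Finset.univ.erase i, p j : ℕ) := by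
    rw [← Nat.cast_mul, Finset.mul_prod_erase _ _ (Finset.mem_univ i)]
  have h0 : ((∏ j ∈ Finset.univ.erase i, p j : ℕ) : ℚ) ≠ 0 := by
    exact_mod_cast Finset.prod_ne_zero_iff.2 fun i _ => (Fact.out : (p i).Prime).ne_zero
  rw [h, pow_one]
  push_cast at h0 ⊢
  rw [mul_comm, ← div_div, div_self h0, one_div]

theorem prime_zpow_mem (i : Fin s) (k : ℤ) : ((p i : ℚ)) ^ k ∈ ZS p := by
  obtain ⟨k, rfl | rfl⟩ := k.eq_nat_or_neg
  · rw [zpow_natCast]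
    exact pow_mem (natCast_mem _ _) _
  · rw [_root_.zpow_neg, zpow_natCast, ← inv_pow]
    exact pow_mem (inv_prime_mem p i) _

variable {p}

theorem exists_int_of_norm_le_one {z : ℚ} (hz : z ∈ ZS p)
    (h : ∀ i, ‖(z : ℚ_[p i])‖ ≤ 1) : ∃ a : ℤ, z = a := by
  refine ⟨z.num, (Rat.den_eq_one_iff z).1 ?_ |>.symm⟩
  by_contra hd
  obtain ⟨l, hl, hld⟩ := Nat.exists_prime_and_dvd hd
  obtain ⟨a, k, hak⟩ := hz
  have hdvd : z.den ∣ (∏ i, p i) ^ k := by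
    have := Rat.den_dvd a (((∏ i, p i) ^ k : ℕ) : ℤ)
    rw [Rat.divInt_eq_div] at this
    push_cast at this hak
    rw [← hak] at this
    exact_mod_cast this
  have hlP := hl.dvd_of_dvd_pow (hld.trans hdvd)
  obtain ⟨i, -, hi⟩ := (Nat.Prime.prime hl).exists_mem_finset_dvd hlP
  obtain rfl := (Nat.prime_dvd_prime_iff_eq hl Fact.out).1 hi
  have h1 : ‖((z.den : ℤ) : ℚ_[p i])‖ < 1 := Padic.norm_intCast_lt_one_iff.2 (by exact_mod_cast hld)
  have h2 : ‖((z.num : ℤ) : ℚ_[p i])‖ = 1 := by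
    rw [Padic.norm_intCast_eq_one_iff, Int.isCoprime_iff_gcd_eq_one]
    exact Nat.Coprime.coprime_dvd_right hld z.reduced
  have h3 : (z : ℚ_[p i]) * ((z.den : ℤ) : ℚ_[p i]) = ((z.num : ℤ) : ℚ_[p i]) := by
    have := Rat.mul_den_eq_num z
    exact_mod_cast congrArg (fun q : ℚ => (q : ℚ_[p i])) this
  have h4 := congrArg norm h3
  rw [norm_mul, h2] at h4
  nlinarith [h i, norm_nonneg (z : ℚ_[p i]), norm_nonneg ((z.den : ℤ) : ℚ_[p i])]

theorem norm_prime_zpow_of_ne (hp : Function.Injective p) {i j : Fin s} (hij : i ≠ j) (k : ℤ) :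
    ‖(((p i : ℚ) ^ k : ℚ) : ℚ_[p j])‖ = 1 := by
  have : ‖((p i : ℕ) : ℚ_[p j])‖ = 1 := by
    rw [Padic.norm_natCast_eq_one_iff]
    exact (Nat.coprime_primes Fact.out Fact.out).2 fun h => hij (hp h).symm
  push_cast
  rw [norm_zpow, this, _root_.one_zpow]

/-- Strong approximation. -/
theorem exists_norm_sub_le_one (hp : Function.Injective p) (x : ∀ i, ℚ_[p i]) :
    ∃ u ∈ ZS p, ∀ i, ‖x i - (u : ℚ_[p i])‖ ≤ 1 := by
  have key : ∀ i, ∃ u ∈ ZS p, ‖x i - (u : ℚ_[p i])‖ ≤ 1 ∧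
      ∀ j, j ≠ i → ‖(u : ℚ_[p j])‖ ≤ 1 := by
    intro i
    have hpos : (0 : ℝ) < p i := by exact_mod_cast (Fact.out : (p i).Prime).pos
    have h1 : (1 : ℝ) < p i := by exact_mod_cast (Fact.out : (p i).Prime).one_lt
    obtain ⟨k, hk⟩ := pow_unbounded_of_one_lt ‖x i‖ h1
    have hpn : ‖((p i : ℚ_[p i])) ^ k‖ = ((p i : ℝ) ^ k)⁻¹ := by
      rw [norm_pow, Padic.norm_p, inv_pow]
    have hx : ‖(p i : ℚ_[p i]) ^ k * x i‖ ≤ 1 := by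
      rw [norm_mul, hpn, inv_mul_le_one₀ (by positivity)]
      exact hk.le
    obtain ⟨a, ha⟩ := Padic.exists_natCast_norm_sub_le (p i) hx k
    have hp0 : (p i : ℚ_[p i]) ≠ 0 := by exact_mod_cast (Fact.out : (p i).Prime).ne_zero
    refine ⟨a * (p i : ℚ) ^ (-k : ℤ), mul_mem (natCast_mem _ _) (prime_zpow_mem p i _), ?_, ?_⟩
    · have : x i - (((a * (p i : ℚ) ^ (-k : ℤ) : ℚ)) : ℚ_[p i])
          = ((p i : ℚ_[p i]) ^ k)⁻¹ * ((p i : ℚ_[p i]) ^ k * x i - a) := by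
        push_cast
        rw [_root_.zpow_neg, zpow_natCast]
        field_simp
      rw [this, norm_mul, norm_inv, hpn, inv_inv]
      calc (p i : ℝ) ^ k * _ ≤ (p i : ℝ) ^ k * (p i : ℝ) ^ (-k : ℤ) := by gcongr
        _ = 1 := by rw [_root_.zpow_neg, zpow_natCast]; field_simp
    · intro j hj
      rw [Rat.cast_mul, norm_mul, norm_prime_zpow_of_ne hp hj.symm, mul_one]
      exact_mod_cast Padic.norm_int_le_one (p := p j) (a : ℤ)
  choose u hu h1 h2 using key
  refine ⟨∑ i, u i, sum_mem fun i _ => hu i, fun i => ?_⟩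
  have : x i - ((∑ j, u j : ℚ) : ℚ_[p i])
      = (x i - (u i : ℚ_[p i])) - ∑ j ∈ Finset.univ.erase i, (u j : ℚ_[p i]) := by
    push_cast
    rw [← Finset.add_sum_erase _ _ (Finset.mem_univ i)]
    ring
  rw [this]
  refine (IsUltrametricDist.norm_sub_le_max _ _).trans (max_le (h1 i) ?_)
  exact IsUltrametricDist.norm_sum_le_of_forall_le_of_nonneg zero_le_one fun j hj =>
    h2 j i (Finset.ne_of_mem_erase hj).symm

/-- Every class of `ℤ_S` modulo `N` has a representative in `{0, …, N - 1}`. -/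
theorem exists_nat_lt_sub_div_mem {N : ℕ} (hN : 0 < N) (hNS : Nat.Coprime N (∏ i, p i)) {z : ℚ}
    (hz : z ∈ ZS p) : ∃ v < N, (z - v) / N ∈ ZS p := by
  obtain ⟨a, k, rfl⟩ := hz
  have hP : ((∏ i, p i : ℕ) : ℚ) ≠ 0 := by
    exact_mod_cast Finset.prod_ne_zero_iff.2 fun i _ => (Fact.out : (p i).Prime).ne_zero
  have hN' : (N : ℚ) ≠ 0 := by exact_mod_cast hN.ne'
  have hcop : IsCoprime (((∏ i, p i) ^ k : ℕ) : ℤ) (N : ℤ) :=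
    Nat.isCoprime_iff_coprime.2 (Nat.Coprime.pow_left k hNS.symm)
  obtain ⟨x, y, hxy⟩ := hcop
  refine ⟨((a * x) % N).toNat, ?_, ?_⟩
  · have := Int.emod_lt_of_pos (a * x) (b := N) (by exact_mod_cast hN)
    have := Int.emod_nonneg (a * x) (b := N) (by exact_mod_cast hN.ne')
    omega
  · refine ⟨a * y + (a * x / N) * ((∏ i, p i) ^ k : ℕ), k, ?_⟩
    have h1 : ((((a * x) % N).toNat : ℕ) : ℚ) = a * x - N * (a * x / N : ℤ) := by
      have h2 := Int.emod_nonneg (a * x) (b := N) (by exact_mod_cast hN.ne')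
      have h3 := Int.mul_ediv_add_emod (a * x) N
      have h4 : ((((a * x) % N).toNat : ℕ) : ℤ) = a * x - N * (a * x / N) := by
        rw [Int.toNat_of_nonneg h2]; linarith
      exact_mod_cast h4
    rw [h1]
    have hxy' : (x : ℚ) * ((∏ i, p i : ℕ) : ℚ) ^ k + y * N = 1 := by exact_mod_cast hxy
    push_cast at hP hxy' ⊢
    field_simp
    linear_combination (-(a : ℚ)) * hxy'

end ZS

end

section

open Set
open scoped ENNReal NNReal

section Count

theorem tsum_indicator_one_eq_encard {α : Type*} (S : Set α) :
    ∑' a, S.indicator (1 : α → ℝ≥0∞) a = S.encard := by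
  rw [← tsum_subtype, ← ENNReal.tsum_set_one]
  rfl

theorem encard_le_of_forall_finset {α : Type*} {S : Set α} {c : ℝ≥0∞}
    (h : ∀ t : Finset α, ↑t ⊆ S → t.Nonempty → (t.card : ℝ≥0∞) ≤ c) : (S.encard : ℝ≥0∞) ≤ c := by
  classical
  rw [← tsum_indicator_one_eq_encard, ENNReal.tsum_eq_iSup_sum]
  refine iSup_le fun t => ?_
  have h1 : ∑ a ∈ t, S.indicator (1 : α → ℝ≥0∞) a = ((t.filter (· ∈ S)).card : ℝ≥0∞) := by
    rw [Finset.card_filter]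
    push_cast
    refine Finset.sum_congr rfl fun a _ => ?_
    simp [indicator_apply]
  rw [h1]
  rcases (t.filter (· ∈ S)).eq_empty_or_nonempty with h0 | h0
  · simp [h0]
  · exact h _ (fun a ha => by simpa using (Finset.mem_filter.1 ha).2) h0

theorem encard_setOf_add_mul_mem_le {J : Set ℝ} (hJ : J.OrdConnected) {h : ℝ} (hh : 0 < h) (y : ℝ) :
    ({a : ℤ | y + h * a ∈ J}.encard : ℝ≥0∞) ≤ volume J / ENNReal.ofReal h + 1 := by
  refine encard_le_of_forall_finset fun t ht hne => ?_
  have h1 : t ⊆ Finset.Icc (t.min' hne) (t.max' hne) := fun a ha =>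
    Finset.mem_Icc.2 ⟨t.min'_le a ha, t.le_max' a ha⟩
  have h2 := Finset.card_le_card h1
  have h3 : t.min' hne ≤ t.max' hne := t.min'_le _ (t.max'_mem hne)
  rw [Int.card_Icc] at h2
  have h4 : ENNReal.ofReal (h * (t.max' hne - t.min' hne)) ≤ volume J := by
    have : volume (Icc (y + h * t.min' hne) (y + h * t.max' hne)) ≤ volume J :=
      measure_mono (hJ.out (ht (t.min'_mem hne)) (ht (t.max'_mem hne)))
    rw [Real.volume_Icc] at this
    convert this using 2
    ring
  have h5 : ((t.max' hne - t.min' hne : ℝ)) ≥ 0 := by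
    rw [ge_iff_le, sub_nonneg]; exact_mod_cast h3
  calc (t.card : ℝ≥0∞) ≤ ENNReal.ofReal ((t.max' hne - t.min' hne : ℝ) + 1) := by
        rw [← ENNReal.ofReal_natCast]
        refine ENNReal.ofReal_le_ofReal ?_
        have : (t.card : ℤ) ≤ t.max' hne - t.min' hne + 1 := by omega
        exact_mod_cast this
    _ = ENNReal.ofReal (t.max' hne - t.min' hne : ℝ) + 1 := by
        rw [ENNReal.ofReal_add h5 zero_le_one, ENNReal.ofReal_one]
    _ ≤ _ := by
        gcongr
        rw [ENNReal.le_div_iff_mul_le (by simp [hh]) (by simp), mul_comm,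
          ← ENNReal.ofReal_mul hh.le]
        exact h4

theorem encard_setOf_ne_zero_mul_mem_le {J : Set ℝ} (hJ : ∀ x y : ℝ, ‖x‖ ≤ ‖y‖ → y ∈ J → x ∈ J)
    {h : ℝ} (hh : 0 < h) :
    ({a : ℤ | a ≠ 0 ∧ h * a ∈ J}.encard : ℝ≥0∞) ≤ volume J / ENNReal.ofReal h := by
  refine encard_le_of_forall_finset fun t ht hne => ?_
  obtain ⟨M, hM, hmax⟩ := t.exists_max_image (fun a => |a|) hne
  have h1 : t ⊆ (Finset.Icc (-|M|) |M|).erase 0 := fun a ha =>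
    Finset.mem_erase.2 ⟨(ht ha).1, Finset.mem_Icc.2 (abs_le.1 (hmax a ha))⟩
  have h2 := Finset.card_le_card h1
  rw [Finset.card_erase_of_mem (by simp), Int.card_Icc] at h2
  have h4 : ENNReal.ofReal (h * (2 * |M|)) ≤ volume J := by
    have : volume (Icc (-(h * |M|)) (h * |M| : ℝ)) ≤ volume J := by
      refine measure_mono fun x hx => hJ x _ ?_ (ht hM).2
      rw [Real.norm_eq_abs, Real.norm_eq_abs, abs_mul, abs_of_pos hh]
      have := abs_le.2 hx
      rwa [Int.cast_abs] at this
    rw [Real.volume_Icc] at this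
    convert this using 2
    ring
  rw [ENNReal.le_div_iff_mul_le (by simp [hh]) (by simp), ← ENNReal.ofReal_natCast,
    ← ENNReal.ofReal_mul (by positivity), mul_comm]
  refine (ENNReal.ofReal_le_ofReal ?_).trans h4
  have : (t.card : ℤ) ≤ 2 * |M| := by have := abs_nonneg M; omega
  gcongr
  exact_mod_cast this

theorem le_encard_setOf_add_mul_mem {J : Set ℝ} (hJ : J.OrdConnected)
    (hb : Bornology.IsBounded J) {h : ℝ} (hh : 0 < h) (y : ℝ) :
    volume J / ENNReal.ofReal h ≤ ({a : ℤ | y + h * a ∈ J}.encard : ℝ≥0∞) + 1 := by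
  rcases J.eq_empty_or_nonempty with rfl | hne
  · simp
  have hbb := hb.bddBelow
  have hba := hb.bddAbove
  have h1 : volume J ≤ ENNReal.ofReal (sSup J - sInf J) := by
    rw [← Real.volume_Icc]
    exact measure_mono fun x hx => ⟨csInf_le hbb hx, le_csSup hba hx⟩
  have h2 : Ioo (sInf J) (sSup J) ⊆ J := by
    intro x hx
    obtain ⟨a, ha, hax⟩ := exists_lt_of_csInf_lt hne hx.1
    obtain ⟨b, hb, hbx⟩ := exists_lt_of_lt_csSup hne hx.2
    exact hJ.out ha hb ⟨hax.le, hbx.le⟩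
  set c := (sInf J - y) / h with hc
  set d := (sSup J - y) / h with hd
  have h3 : (↑(Finset.Ioo ⌊c⌋ ⌈d⌉) : Set ℤ) ⊆ {a : ℤ | y + h * a ∈ J} := by
    intro a ha
    rw [Finset.coe_Ioo, mem_Ioo, Int.floor_lt, Int.lt_ceil, hc, hd, div_lt_iff₀' hh,
      lt_div_iff₀' hh] at ha
    exact h2 ⟨by linarith [ha.1], by linarith [ha.2]⟩
  have h4 := Set.encard_le_encard h3
  rw [Set.encard_coe_eq_coe_finsetCard, Int.card_Ioo] at h4
  have h5 : ENNReal.ofReal (d - c) ≤ ((⌈d⌉ - ⌊c⌋ - 1).toNat : ℝ≥0∞) + 1 := by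
    rw [← ENNReal.ofReal_natCast, ← ENNReal.ofReal_one,
      ← ENNReal.ofReal_add (by positivity) zero_le_one]
    refine ENNReal.ofReal_le_ofReal ?_
    have h6 : ((⌈d⌉ - ⌊c⌋ - 1 : ℤ) : ℝ) ≤ ((⌈d⌉ - ⌊c⌋ - 1).toNat : ℝ) := by
      exact_mod_cast Int.self_le_toNat _
    push_cast at h6
    linarith [Int.le_ceil d, Int.floor_le c]
  calc volume J / ENNReal.ofReal h ≤ ENNReal.ofReal (sSup J - sInf J) / ENNReal.ofReal h := by
        gcongr
    _ = ENNReal.ofReal (d - c) := by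
        rw [← ENNReal.ofReal_div_of_pos hh]
        congr 1
        rw [hc, hd]; ring
    _ ≤ _ := h5
    _ ≤ _ := by
        gcongr
        exact_mod_cast h4

end Count

end

section

open Set
open scoped ENNReal NNReal

variable {s : ℕ} {p : Fin s → ℕ} [∀ i, Fact (p i).Prime]

/-- A set which contains every element of norm at most that of one of its elements. -/
def NormLower {E : Type*} [Norm E] (B : Set E) : Prop := ∀ x y, ‖x‖ ≤ ‖y‖ → y ∈ B → x ∈ B

theorem NormLower.zero_mem {E : Type*} [SeminormedAddGroup E] {B : Set E} (hB : NormLower B) {x : E}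
    (hx : x ∈ B) : (0 : E) ∈ B := hB 0 x (by simp) hx

theorem NormLower.ordConnected {J : Set ℝ} (hJ : NormLower J) : J.OrdConnected := by
  refine ⟨fun x hx y hy z hz => ?_⟩
  rcases le_total 0 z with h | h
  · exact hJ z y (by rw [Real.norm_of_nonneg h, Real.norm_of_nonneg (h.trans hz.2)]; exact hz.2) hy
  · refine hJ z x ?_ hx
    rw [Real.norm_of_nonpos h, Real.norm_of_nonpos (hz.1.trans h)]
    linarith [hz.1]

theorem NormLower.measurableSet {E : Type*} [NormedAddCommGroup E] [ProperSpace E]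
    [MeasurableSpace E] [BorelSpace E] {B : Set E} (hB : NormLower B) : MeasurableSet B := by
  have h : B = (norm : E → ℝ) ⁻¹' {t | ∃ x ∈ B, t ≤ ‖x‖} := by
    ext x
    exact ⟨fun hx => ⟨x, hx, le_rfl⟩, fun ⟨y, hy, hxy⟩ => hB x y hxy hy⟩
  rw [h]
  refine measurable_norm (OrdConnected.measurableSet ⟨?_⟩)
  rintro x - y ⟨w, hw, hyw⟩ z hz
  exact ⟨w, hw, hz.2.trans hyw⟩

theorem Padic.normLower_cases (l : ℕ) [Fact l.Prime] {B : Set ℚ_[l]} (hB : NormLower B) :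
    B ⊆ {0} ∨ B = univ ∨ ∃ k : ℤ, B = Metric.closedBall 0 ((l : ℝ) ^ k) := by
  by_cases h0 : B ⊆ {0}
  · exact Or.inl h0
  by_cases h1 : B = univ
  · exact Or.inr (Or.inl h1)
  refine Or.inr (Or.inr ?_)
  have hl : (1 : ℝ) < l := by exact_mod_cast (Fact.out : l.Prime).one_lt
  obtain ⟨x, hxB, hx0⟩ := not_subset.1 h0
  obtain ⟨y, hyB⟩ := (ne_univ_iff_exists_notMem B).1 h1
  have hy0 : y ≠ 0 := by rintro rfl; exact hyB (hB.zero_mem hxB)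
  obtain ⟨k, ⟨z, hzB, hz⟩, hk⟩ := Int.exists_greatest_of_bdd
    (P := fun k => ∃ z ∈ B, ‖z‖ = (l : ℝ) ^ k) ⟨-y.valuation, fun k hk => by
      obtain ⟨z, hzB, hz⟩ := hk
      by_contra! hlt
      refine hyB (hB y z ?_ hzB)
      rw [hz, Padic.norm_eq_zpow_neg_valuation hy0]
      exact zpow_le_zpow_right₀ hl.le hlt.le⟩
    ⟨-x.valuation, x, hxB, Padic.norm_eq_zpow_neg_valuation hx0⟩
  refine ⟨k, ?_⟩
  ext w
  rw [Metric.mem_closedBall, dist_zero_right]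
  constructor
  · intro hw
    by_cases hw0 : w = 0
    · simp only [hw0, norm_zero]; positivity
    · have := hk _ ⟨w, hw, Padic.norm_eq_zpow_neg_valuation hw0⟩
      rw [Padic.norm_eq_zpow_neg_valuation hw0]
      exact zpow_le_zpow_right₀ hl.le this
  · intro hw
    exact hB w z (hw.trans_eq hz.symm) hzB

theorem ENNReal.div_mul_eq_div_div {a b c : ℝ≥0∞} (hb : b ≠ ∞ := by simp) (hc : c ≠ ∞ := by simp) :
    a / (b * c) = a / b / c := by
  rw [div_eq_mul_inv, ENNReal.mul_inv (Or.inr hc) (Or.inl hb), ← mul_assoc, ← div_eq_mul_inv,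
    ← div_eq_mul_inv]

variable (p) in
/-- The diagonal embedding of `ℚ` into `ℚ_S`. -/
def emb : ℚ →+* SAdele p := RingHom.pi fun v => Rat.castHom (SField p v)

@[simp] theorem emb_apply (x : ℚ) (v) : emb p x v = (x : SField p v) := rfl

instance (i : Fin s) : IsUltrametricDist (SField p (some i)) :=
  inferInstanceAs (IsUltrametricDist ℚ_[p i])

theorem SField.norm_ratCast_some (i : Fin s) (x : ℚ) :
    ‖(x : SField p (some i))‖ = ‖(x : ℚ_[p i])‖ := rfl

theorem norm_natCast_eq_one_of_coprime {N : ℕ} (hNS : Nat.Coprime N (∏ i, p i)) (i : Fin s) :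
    ‖(N : SField p (some i))‖ = 1 := by
  change ‖(N : ℚ_[p i])‖ = 1
  rw [Padic.norm_natCast_eq_one_iff]
  exact (Nat.Coprime.coprime_dvd_right (Finset.dvd_prod_of_mem p (Finset.mem_univ i)) hNS).symm

namespace ZS

/-- A positive unit of `ℤ_S` with prescribed norms at the finite places. -/
theorem exists_unit (hp : Function.Injective p) (k : Fin s → ℤ) :
    ∃ U : ℚ, 0 < U ∧ U ∈ ZS p ∧ U⁻¹ ∈ ZS p ∧ (∀ i, ‖(U : ℚ_[p i])‖ = (p i : ℝ) ^ k i) ∧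
      (U : ℝ)⁻¹ = ∏ i, (p i : ℝ) ^ k i := by
  have hpos : ∀ i, (0 : ℚ) < p i := fun i => by exact_mod_cast (Fact.out : (p i).Prime).pos
  refine ⟨∏ i, (p i : ℚ) ^ (-k i), Finset.prod_pos fun i _ => zpow_pos (hpos i) _,
    prod_mem fun i _ => prime_zpow_mem p i _, ?_, fun i => ?_, ?_⟩
  · rw [← Finset.prod_inv_distrib]
    refine prod_mem fun i _ => ?_
    rw [← _root_.zpow_neg]
    exact prime_zpow_mem p i _
  · rw [Rat.cast_prod, norm_prod, ← Finset.mul_prod_erase _ _ (Finset.mem_univ i),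
      Finset.prod_eq_one, mul_one]
    · push_cast
      rw [Padic.norm_p_zpow, neg_neg]
    · intro j hj
      exact norm_prime_zpow_of_ne hp (Finset.ne_of_mem_erase hj) _
  · push_cast
    rw [← Finset.prod_inv_distrib]
    simp

end ZS

variable [∀ i, MeasurableSpace ℚ_[p i]] [∀ i, BorelSpace ℚ_[p i]]

/-- The volume of a box in `ℚ_S`. -/
def boxVol (B : ∀ v, Set (SField p v)) : ℝ≥0∞ := ∏ v, volume (B v)

theorem volume_ne_zero_of_normLower {v : Option (Fin s)} {B : Set (SField p v)} (hB : NormLower B)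
    (h0 : ¬ B ⊆ {0}) : volume B ≠ 0 := by
  obtain ⟨x, hxB, hx0⟩ := not_subset.1 h0
  refine ((Metric.measure_closedBall_pos volume 0 (norm_pos_iff.2 hx0)).trans_le
    (measure_mono fun y hy => ?_)).ne'
  exact hB y x (by simpa using hy) hxB

theorem volume_univ_SField (v : Option (Fin s)) : volume (univ : Set (SField p v)) = ∞ := by
  have : NoncompactSpace (SField p v) := NormedSpace.noncompactSpace (SField p v) (SField p v)
  exact measure_univ_of_isAddLeftInvariant volume

theorem volume_subset_zero {v : Option (Fin s)} {B : Set (SField p v)} (h0 : B ⊆ {0}) :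
    volume B = 0 := measure_mono_null h0 (measure_singleton 0)

/-- A norm-lower box is contained in a hyperplane, has a full factor at a finite place,
or is described at the finite places by a unit of `ℤ_S`. -/
theorem normLower_box_cases (hp : Function.Injective p) {B : ∀ v, Set (SField p v)}
    (hB : ∀ v, NormLower (B v)) :
    (∃ v, B v ⊆ {0}) ∨ (boxVol B = ∞ ∧ ∃ i, B (some i) = univ) ∨
      ∃ U : ℚ, 0 < U ∧ U ∈ ZS p ∧ U⁻¹ ∈ ZS p ∧
        (∀ i, ∀ x : SField p (some i), x ∈ B (some i) ↔ ‖x‖ ≤ ‖(U : SField p (some i))‖) ∧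
        boxVol B = volume (α := ℝ) (B none) / ENNReal.ofReal U := by
  by_cases h0 : ∃ v, B v ⊆ {0}
  · exact Or.inl h0
  refine Or.inr ?_
  push Not at h0
  by_cases h1 : ∃ i, B (some i) = univ
  · left
    refine ⟨?_, h1⟩
    obtain ⟨i, hi⟩ := h1
    rw [boxVol, ← Finset.mul_prod_erase _ _ (Finset.mem_univ (some i)), hi, volume_univ_SField,
      ENNReal.top_mul]
    exact Finset.prod_ne_zero_iff.2 fun v _ => volume_ne_zero_of_normLower (hB v) (h0 v)
  right
  push Not at h1
  have h2 : ∀ i, ∃ k : ℤ, B (some i) = Metric.closedBall (0 : ℚ_[p i]) ((p i : ℝ) ^ k) := fun i =>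
    ((Padic.normLower_cases (p i) (hB (some i))).resolve_left (h0 _)).resolve_left (h1 i)
  choose k hk using h2
  obtain ⟨U, hU0, hU, hU', hUn, hUi⟩ := ZS.exists_unit hp k
  refine ⟨U, hU0, hU, hU', fun i x => ?_, ?_⟩
  · rw [hk i, SField.norm_ratCast_some, hUn i]
    exact mem_closedBall_zero_iff (E := ℚ_[p i])
  · have hU0' : (0 : ℝ) < U := by exact_mod_cast hU0
    rw [boxVol, Fintype.prod_option, div_eq_mul_inv, ← ENNReal.ofReal_inv_of_pos hU0', hUi,
      ENNReal.ofReal_prod_of_nonneg fun i _ => by positivity]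
    congr 1
    refine Finset.prod_congr rfl fun i _ => ?_
    rw [hk i]
    exact padicHaar_closedBall (p i) (k i)

/-- The number of points of a coset of `Nℤ_S` in a box is at most the expected number plus one. -/
theorem encard_coset_box_le (hp : Function.Injective p) {N : ℕ} (hN : 0 < N)
    (hNS : Nat.Coprime N (∏ i, p i)) {B : ∀ v, Set (SField p v)} (hB : ∀ v, NormLower (B v))
    (x : SAdele p) :
    ({e : ZS p | ∀ v, (x + emb p (N * e)) v ∈ B v}.encard : ℝ≥0∞) ≤ boxVol B / N + 1 := by
  have hNq : (N : ℚ) ≠ 0 := by exact_mod_cast hN.ne'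
  rcases normLower_box_cases hp hB with ⟨v, hv⟩ | ⟨h, -⟩ | ⟨U, hU0, hU, hU', hBU, hvol⟩
  · refine le_trans ?_ le_add_self
    have : {e : ZS p | ∀ v, (x + emb p (N * e)) v ∈ B v}.encard ≤ 1 := by
      rw [Set.encard_le_one_iff]
      intro a b ha hb
      have h1 : x v + ((N * a : ℚ) : SField p v) = 0 := hv (ha v)
      have h2 : x v + ((N * b : ℚ) : SField p v) = 0 := hv (hb v)
      have h3 : ((N * a : ℚ) : SField p v) = ((N * b : ℚ) : SField p v) :=
        add_left_cancel (h1.trans h2.symm)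
      rw [Rat.cast_inj] at h3
      exact Subtype.ext (mul_left_cancel₀ hNq h3)
    exact_mod_cast this
  · rw [h, ENNReal.top_div_of_ne_top (by simp)]
    simp
  · rcases Set.eq_empty_or_nonempty {e : ZS p | ∀ v, (x + emb p (N * e)) v ∈ B v} with h0 | ⟨e₀, he₀⟩
    · rw [h0]; simp
    have hNU : (0 : ℝ) < N * U := by
      have : (0 : ℝ) < U := by exact_mod_cast hU0
      positivity
    obtain ⟨y, hy⟩ : ∃ y : ℝ, y = (x + emb p (N * e₀)) none := ⟨_, rfl⟩
    have key := encard_setOf_add_mul_mem_le (J := B none) (NormLower.ordConnected (hB none)) hNU y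
    have h1 : {e : ZS p | ∀ v, (x + emb p (N * e)) v ∈ B v}.encard ≤
        {a : ℤ | y + N * U * a ∈ (B none : Set ℝ)}.encard := by
      have h2 : ∀ e : ZS p, (∀ v, (x + emb p (N * e)) v ∈ B v) → ∃ a : ℤ, ((e : ℚ) - e₀) / U = a := by
        intro e he
        refine ZS.exists_int_of_norm_le_one (p := p) ?_ fun i => ?_
        · rw [div_eq_mul_inv]
          exact mul_mem (sub_mem e.2 e₀.2) hU'
        · have h3 := (hBU i _).1 (he (some i))
          have h4 := (hBU i _).1 (he₀ (some i))
          have h5 : ‖(N : SField p (some i)) * (((e : ℚ) : SField p (some i)) - (e₀ : ℚ))‖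
              ≤ ‖(U : SField p (some i))‖ := by
            have : (N : SField p (some i)) * (((e : ℚ) : SField p (some i)) - (e₀ : ℚ))
                = (x + emb p (N * e)) (some i) - (x + emb p (N * e₀)) (some i) := by
              change _ = (x (some i) + ((N * e : ℚ) : SField p (some i)))
                - (x (some i) + ((N * e₀ : ℚ) : SField p (some i)))
              push_cast
              ring
            rw [this]
            exact (IsUltrametricDist.norm_sub_le_max _ _).trans (max_le h3 h4)
          rw [norm_mul, norm_natCast_eq_one_of_coprime hNS, one_mul] at h5
          change ‖(((e - e₀) / U : ℚ) : SField p (some i))‖ ≤ 1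
          rw [Rat.cast_div, Rat.cast_sub, norm_div]
          exact div_le_one_of_le₀ h5 (norm_nonneg _)
      choose! f hf using h2
      have hfe : ∀ e : ZS p, (∀ v, (x + emb p (N * e)) v ∈ B v) → (e : ℚ) = e₀ + U * f e := by
        intro e he
        rw [← hf e he]
        field_simp
        ring
      refine Set.encard_le_encard_of_injOn (f := f) (fun e he => ?_) fun e he e' he' hee => ?_
      · have h3 : (x none + ((N * e : ℚ) : SField p none)) ∈ B none := he none
        have h4 : y + N * U * f e = x none + ((N * e : ℚ) : SField p none) := by
          rw [hy, hfe e he]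
          change (x none + ((N * e₀ : ℚ) : SField p none))
            + (N : SField p none) * (U : SField p none) * (f e : SField p none) = _
          push_cast
          ring
        change y + N * U * f e ∈ (B none : Set ℝ)
        rw [h4]
        exact h3
      · exact Subtype.ext (by rw [hfe e he, hfe e' he', hee])
    calc ({e : ZS p | ∀ v, (x + emb p (N * e)) v ∈ B v}.encard : ℝ≥0∞) ≤ _ := by exact_mod_cast h1
      _ ≤ _ := key
      _ = _ := by
        rw [hvol, mul_comm, ENNReal.ofReal_mul (by exact_mod_cast hU0.le), ENNReal.ofReal_natCast,
          ENNReal.div_mul_eq_div_div]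

/-- The number of points of a coset of `Nℤ_S` in a bounded box is at least the expected number
minus one. -/
theorem boxVol_div_le_encard_coset_box (hp : Function.Injective p) {N : ℕ} (hN : 0 < N)
    (hNS : Nat.Coprime N (∏ i, p i)) {B : ∀ v, Set (SField p v)} (hB : ∀ v, NormLower (B v))
    (hb : ∀ v, Bornology.IsBounded (B v)) (x : SAdele p) :
    boxVol B / N ≤ ({e : ZS p | ∀ v, (x + emb p (N * e)) v ∈ B v}.encard : ℝ≥0∞) + 1 := by
  have hNq : (N : ℚ) ≠ 0 := by exact_mod_cast hN.ne'
  have hfin : ∀ v, volume (B v) ≠ ∞ := fun v => (hb v).measure_lt_top.ne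
  rcases normLower_box_cases hp hB with ⟨v, hv⟩ | ⟨h, -⟩ | ⟨U, hU0, hU, hU', hBU, hvol⟩
  · rw [boxVol, Finset.prod_eq_zero (Finset.mem_univ v) (volume_subset_zero hv)]
    simp
  · exact absurd h (ENNReal.prod_ne_top fun v _ => hfin v)
  · have hNU : (0 : ℝ) < N * U := by
      have : (0 : ℝ) < U := by exact_mod_cast hU0
      positivity
    have hNU' : (N * U : ℚ) ≠ 0 := mul_ne_zero hNq hU0.ne'
    obtain ⟨u, hu, hux⟩ := ZS.exists_norm_sub_le_one (p := p) hp
      fun i => (x (some i) / ((N * U : ℚ) : SField p (some i)) : SField p (some i))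
    obtain ⟨y, hy⟩ : ∃ y : ℝ, y = (x + emb p (N * (-U * u))) none := ⟨_, rfl⟩
    have key := le_encard_setOf_add_mul_mem (J := B none) (NormLower.ordConnected (hB none))
      (hb none) hNU y
    have hmem : ∀ a : ℤ, U * (a - u) ∈ ZS p := fun a => mul_mem hU (sub_mem (intCast_mem _ a) hu)
    have h1 : {a : ℤ | y + N * U * a ∈ (B none : Set ℝ)}.encard ≤
        {e : ZS p | ∀ v, (x + emb p (N * e)) v ∈ B v}.encard := by
      refine Set.encard_le_encard_of_injOn (f := fun a => ⟨_, hmem a⟩) (fun a ha => ?_)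
        fun a _ b _ hab => ?_
      · rintro (_ | i)
        · have h4 : (x + emb p (N * (U * (a - u)))) none = (y + N * U * a : ℝ) := by
            rw [hy]
            change x none + ((N * (U * (a - u)) : ℚ) : SField p none)
              = (x none + ((N * (-U * u) : ℚ) : SField p none))
                + (N : SField p none) * (U : SField p none) * (a : SField p none)
            push_cast
            ring
          change (x + emb p (N * (U * (a - u)))) none ∈ B none
          rw [h4]
          exact ha
        · refine (hBU i _).2 ?_
          have h5 : ‖x (some i) / ((N * U : ℚ) : SField p (some i)) - (u : SField p (some i))‖ ≤ 1 :=
            hux i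
          have h6 : ‖x (some i) / ((N * U : ℚ) : SField p (some i)) - (u : SField p (some i))
              + (a : SField p (some i))‖ ≤ 1 :=
            (IsUltrametricDist.norm_add_le_max _ _).trans
              (max_le h5 (Padic.norm_int_le_one (p := p i) a))
          have h7 : (x + emb p (N * (U * (a - u)))) (some i)
              = (N : SField p (some i)) * (U : SField p (some i)) *
                (x (some i) / ((N * U : ℚ) : SField p (some i)) - (u : SField p (some i))
              + (a : SField p (some i))) := by
            change x (some i) + ((N * (U * (a - u)) : ℚ) : SField p (some i)) = _
            have : ((N * U : ℚ) : SField p (some i)) ≠ 0 := by exact_mod_cast hNU'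
            have h8 := mul_div_cancel₀ (x (some i)) this
            push_cast at h8 ⊢
            linear_combination -h8
          change ‖(x + emb p (N * (U * (a - u)))) (some i)‖ ≤ _
          rw [h7, norm_mul, norm_mul, norm_natCast_eq_one_of_coprime hNS, one_mul]
          exact mul_le_of_le_one_right (norm_nonneg _) h6
      · have : U * ((a : ℚ) - u) = U * (b - u) := congrArg Subtype.val hab
        have := mul_left_cancel₀ hU0.ne' this
        exact_mod_cast sub_left_injective this
    calc boxVol B / N = volume (α := ℝ) (B none) / ENNReal.ofReal (N * U) := by
          rw [hvol, mul_comm, ENNReal.ofReal_mul (by exact_mod_cast hU0.le), ENNReal.ofReal_natCast,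
            ENNReal.div_mul_eq_div_div]
      _ ≤ _ := key
      _ ≤ _ := by
          gcongr
          exact h1

/-- The number of nonzero points of `gℤ_S` in a box is at most the expected number. -/
theorem encard_ne_zero_box_le (hp : Function.Injective p) {g : ℕ} (hg : 0 < g)
    (hgS : Nat.Coprime g (∏ i, p i)) {B : ∀ v, Set (SField p v)} (hB : ∀ v, NormLower (B v)) :
    ({c : ZS p | (c : ℚ) ≠ 0 ∧ ∀ v, ((g * c : ℚ) : SField p v) ∈ B v}.encard : ℝ≥0∞)
      ≤ boxVol B / g := by
  rcases normLower_box_cases hp hB with ⟨v, hv⟩ | ⟨h, -⟩ | ⟨U, hU0, hU, hU', hBU, hvol⟩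
  · have : {c : ZS p | (c : ℚ) ≠ 0 ∧ ∀ v, ((g * c : ℚ) : SField p v) ∈ B v} = ∅ := by
      refine Set.eq_empty_of_forall_notMem fun c hc => hc.1 ?_
      have h1 : ((g * c : ℚ) : SField p v) = 0 := hv (hc.2 v)
      have h2 : (g * c : ℚ) = 0 := by exact_mod_cast h1
      exact (mul_eq_zero.1 h2).resolve_left (by exact_mod_cast hg.ne')
    rw [this]
    simp
  · rw [h, ENNReal.top_div_of_ne_top (by simp)]
    simp
  · have hgU : (0 : ℝ) < g * U := by
      have : (0 : ℝ) < U := by exact_mod_cast hU0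
      positivity
    have key := encard_setOf_ne_zero_mul_mem_le (J := B none) (hB none) hgU
    have h2 : ∀ c : ZS p, (∀ v, ((g * c : ℚ) : SField p v) ∈ B v) → ∃ a : ℤ, (c : ℚ) / U = a := by
      intro c hc
      refine ZS.exists_int_of_norm_le_one (p := p) ?_ fun i => ?_
      · rw [div_eq_mul_inv]
        exact mul_mem c.2 hU'
      · have h5 := (hBU i _).1 (hc (some i))
        rw [Rat.cast_mul, norm_mul, Rat.cast_natCast, norm_natCast_eq_one_of_coprime hgS,
          one_mul] at h5
        change ‖((c / U : ℚ) : SField p (some i))‖ ≤ 1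
        rw [Rat.cast_div, norm_div]
        exact div_le_one_of_le₀ h5 (norm_nonneg _)
    choose! f hf using h2
    have hfe : ∀ c : ZS p, (∀ v, ((g * c : ℚ) : SField p v) ∈ B v) → (c : ℚ) = U * f c := by
      intro e he
      rw [← hf e he]
      field_simp
    have h1 : {c : ZS p | (c : ℚ) ≠ 0 ∧ ∀ v, ((g * c : ℚ) : SField p v) ∈ B v}.encard ≤
        {a : ℤ | a ≠ 0 ∧ g * U * (a : ℝ) ∈ (B none : Set ℝ)}.encard := by
      refine Set.encard_le_encard_of_injOn (f := f) (fun e he => ⟨?_, ?_⟩)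
        fun e he e' he' hee => Subtype.ext (by rw [hfe e he.2, hfe e' he'.2, hee])
      · intro h0
        refine he.1 ?_
        rw [hfe e he.2, h0]
        simp
      · have h3 : ((g * e : ℚ) : SField p none) ∈ B none := he.2 none
        rw [hfe e he.2] at h3
        have h4 : (g * U * (f e : ℝ) : ℝ) = ((g * (U * f e) : ℚ) : SField p none) := by
          change (g : SField p none) * (U : SField p none) * (f e : SField p none) = _
          push_cast
          ring
        rw [h4]
        exact h3
    calc _ ≤ _ := by exact_mod_cast h1
      _ ≤ _ := key
      _ = _ := by
        rw [hvol, mul_comm, ENNReal.ofReal_mul (by exact_mod_cast hU0.le), ENNReal.ofReal_natCast,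
          ENNReal.div_mul_eq_div_div]

end

section

open Set
open scoped ENNReal NNReal

variable {s : ℕ} {p : Fin s → ℕ} [∀ i, Fact (p i).Prime]

/-- A function which is non-increasing in the norm of its argument. -/
def NormAntitone {E β : Type*} [Norm E] [LE β] (f : E → β) : Prop := ∀ x y, ‖x‖ ≤ ‖y‖ → f y ≤ f x

theorem NormAntitone.measurable {E : Type*} [NormedAddCommGroup E] [ProperSpace E]
    [MeasurableSpace E] [BorelSpace E] {f : E → ℝ≥0∞} (hf : NormAntitone f) : Measurable f :=
  measurable_of_Ioi fun _ => NormLower.measurableSet fun x y hxy hy => lt_of_lt_of_le hy (hf x y hxy)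

theorem NormLower.mem_pi_iff {E : Type*} [SeminormedAddCommGroup E] {n : ℕ} (hn : 0 < n)
    {S : Set (Fin n → E)} (hS : NormLower S) (y : Fin n → E) :
    y ∈ S ↔ ∀ b, (fun _ => y b : Fin n → E) ∈ S := by
  have : Nonempty (Fin n) := ⟨⟨0, hn⟩⟩
  constructor
  · intro hy b
    refine hS _ y ?_ hy
    rw [pi_norm_const]
    exact norm_le_pi_norm y b
  · intro h
    obtain ⟨b, hb⟩ := Finite.exists_max (fun b => ‖y b‖)
    refine hS y _ ?_ (h b)
    rw [pi_norm_const]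
    exact (pi_norm_le_iff_of_nonneg (norm_nonneg _)).2 hb

theorem NormLower.const {E : Type*} [SeminormedAddCommGroup E] {n : ℕ} (hn : 0 < n)
    {S : Set (Fin n → E)} (hS : NormLower S) : NormLower {x : E | (fun _ => x : Fin n → E) ∈ S} := by
  have : Nonempty (Fin n) := ⟨⟨0, hn⟩⟩
  intro x y hxy hy
  exact hS _ _ (by rwa [pi_norm_const, pi_norm_const]) hy

variable [∀ i, MeasurableSpace ℚ_[p i]] [∀ i, BorelSpace ℚ_[p i]] {n : ℕ}

section LayerCake

variable (G : ∀ v, (Fin n → SField p v) → ℝ≥0∞)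

/-- The box whose `n`-th power is the superlevel set of a product of norm-antitone functions. -/
def levelBox (u : Option (Fin s) → ℝ) (v : Option (Fin s)) : Set (SField p v) :=
  {x | 0 < u v ∧ u v < (G v fun _ => x).toReal}

variable {G}

theorem normLower_level (hG : ∀ v, NormAntitone (G v)) (hfin : ∀ v y, G v y ≠ ∞)
    (u : Option (Fin s) → ℝ) (v : Option (Fin s)) :
    NormLower {y | 0 < u v ∧ u v < (G v y).toReal} := fun x y hxy hy =>
  ⟨hy.1, hy.2.trans_le (ENNReal.toReal_mono (hfin v x) (hG v x y hxy))⟩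

theorem normLower_levelBox (hn : 0 < n) (hG : ∀ v, NormAntitone (G v)) (hfin : ∀ v y, G v y ≠ ∞)
    (u : Option (Fin s) → ℝ) (v : Option (Fin s)) : NormLower (levelBox G u v) :=
  (normLower_level hG hfin u v).const hn

theorem mem_levelBox_iff (hn : 0 < n) (hG : ∀ v, NormAntitone (G v)) (hfin : ∀ v y, G v y ≠ ∞)
    (u : Option (Fin s) → ℝ) (v : Option (Fin s)) (y : Fin n → SField p v) :
    (0 < u v ∧ u v < (G v y).toReal) ↔ ∀ b, y b ∈ levelBox G u v :=
  (normLower_level hG hfin u v).mem_pi_iff hn y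

theorem volume_level (hn : 0 < n) (hG : ∀ v, NormAntitone (G v)) (hfin : ∀ v y, G v y ≠ ∞)
    (u : Option (Fin s) → ℝ) :
    (volume : Measure (∀ v, Fin n → SField p v)) {y | ∀ v, 0 < u v ∧ u v < (G v (y v)).toReal}
      = boxVol (levelBox G u) ^ n := by
  have : {y : ∀ v, Fin n → SField p v | ∀ v, 0 < u v ∧ u v < (G v (y v)).toReal}
      = univ.pi fun v => univ.pi fun _ : Fin n => levelBox G u v := by
    ext y
    simp only [mem_ofPred_eq, mem_levelBox_iff hn hG hfin, mem_pi, mem_univ, true_imp_iff]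
  rw [this, volume_pi_pi, boxVol, ← Finset.prod_pow]
  refine Finset.prod_congr rfl fun v _ => ?_
  rw [volume_pi_pi]
  simp

theorem prod_lintegral_eq_level (hn : 0 < n) (hG : ∀ v, NormAntitone (G v))
    (hfin : ∀ v y, G v y ≠ ∞) :
    ∏ v, ∫⁻ y, G v y = ∫⁻ u, boxVol (levelBox G u) ^ n := by
  have hm : ∀ v, Measurable (G v) := fun v => (hG v).measurable
  simp only [← volume_level hn hG hfin]
  rw [← lintegral_prod_ofReal_eq volume (fun v (y : ∀ v, Fin n → SField p v) => (G v (y v)).toReal)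
    fun v => (hm v).ennreal_toReal.comp (measurable_pi_apply v)]
  simp only [ENNReal.ofReal_toReal (hfin _ _)]
  rw [volume_pi, lintegral_pi_prod _ _ hm]

theorem tsum_prod_eq_level (hn : 0 < n) (hG : ∀ v, NormAntitone (G v))
    (hfin : ∀ v y, G v y ≠ ∞) {α : Type*} [Countable α] (π : α → Fin n → ∀ v, SField p v) :
    ∑' a, ∏ v, G v (fun b => π a b v)
      = ∫⁻ u, ({a | ∀ b v, π a b v ∈ levelBox G u v}.encard : ℝ≥0∞) := by
  have := tsum_prod_ofReal_eq fun v (a : α) => (G v fun b => π a b v).toReal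
  simp only [ENNReal.ofReal_toReal (hfin _ _)] at this
  rw [this]
  refine lintegral_congr fun u => ?_
  rw [tsum_indicator_one_eq_encard]
  congr 2
  ext a
  simp only [mem_ofPred_eq, mem_levelBox_iff hn hG hfin]
  exact forall_comm

theorem prod_zero_eq_level (hfin : ∀ v y, G v y ≠ ∞) :
    ∏ v, G v 0 = ∫⁻ u, {u : Option (Fin s) → ℝ | ∀ v, 0 < u v ∧ u v < (G v 0).toReal}.indicator 1 u := by
  have := tsum_prod_ofReal_eq fun v (_ : Unit) => (G v 0).toReal
  simp only [ENNReal.ofReal_toReal (hfin _ _), tsum_fintype, Finset.univ_unique,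
    Finset.sum_singleton] at this
  rw [this]
  refine lintegral_congr fun u => ?_
  simp [indicator_apply]

theorem measurableSet_level_zero :
    MeasurableSet {u : Option (Fin s) → ℝ | ∀ v, 0 < u v ∧ u v < (G v 0).toReal} := by
  rw [Set.ofPred_forall]
  refine MeasurableSet.iInter fun v => ?_
  exact (measurableSet_Ioo (a := 0) (b := (G v 0).toReal)).preimage (measurable_pi_apply v)

/-- Upper bounds for lattice point counts in boxes give upper bounds for sums of products of
norm-antitone functions. -/
theorem tsum_prod_le_of_box (hn : 0 < n) (hG : ∀ v, NormAntitone (G v))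
    (hfin : ∀ v y, G v y ≠ ∞) {α : Type*} [Countable α] (π : α → Fin n → ∀ v, SField p v)
    {C D : ℝ≥0∞} (hC : C ≠ ∞) (hD : D ≠ ∞) (H : ∀ B : ∀ v, Set (SField p v), (∀ v, NormLower (B v)) →
      ({a | ∀ b v, π a b v ∈ B v}.encard : ℝ≥0∞) ≤ C * boxVol B ^ n + D) :
    ∑' a, ∏ v, G v (fun b => π a b v) ≤ C * (∏ v, ∫⁻ y, G v y) + D * ∏ v, G v 0 := by
  rw [tsum_prod_eq_level hn hG hfin, prod_lintegral_eq_level hn hG hfin,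
    prod_zero_eq_level hfin, ← lintegral_const_mul' _ _ hC, ← lintegral_const_mul' _ _ hD,
    ← lintegral_add_right]
  swap
  · exact (measurable_one.indicator measurableSet_level_zero).const_mul D
  refine lintegral_mono fun u => ?_
  by_cases h0 : u ∈ {u : Option (Fin s) → ℝ | ∀ v, 0 < u v ∧ u v < (G v 0).toReal}
  · dsimp only
    rw [indicator_of_mem h0, Pi.one_apply, mul_one]
    exact H _ (normLower_levelBox hn hG hfin u)
  · have : {a | ∀ b v, π a b v ∈ levelBox G u v} = ∅ := by
      refine eq_empty_of_forall_notMem fun a ha => h0 fun v => ?_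
      rw [mem_levelBox_iff hn hG hfin]
      exact fun b => (normLower_levelBox hn hG hfin u v).zero_mem (ha b v)
    dsimp only
    rw [this]
    simp

/-- Lower bounds for lattice point counts in bounded boxes give lower bounds for sums of products
of norm-antitone functions. -/
theorem prod_lintegral_le_of_box (hn : 0 < n) (hG : ∀ v, NormAntitone (G v))
    (hfin : ∀ v y, G v y ≠ ∞) (hsupp : ∀ v, ∃ R : ℝ, ∀ y, R < ‖y‖ → G v y = 0)
    {α : Type*} [Countable α] (π : α → Fin n → ∀ v, SField p v)
    {C D : ℝ≥0∞} (hC : C ≠ ∞) (hD : D ≠ ∞) (H : ∀ B : ∀ v, Set (SField p v), (∀ v, NormLower (B v)) →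
      (∀ v, Bornology.IsBounded (B v)) →
      boxVol B ^ n ≤ C * ({a | ∀ b v, π a b v ∈ B v}.encard : ℝ≥0∞) + D) :
    ∏ v, ∫⁻ y, G v y ≤ C * (∑' a, ∏ v, G v (fun b => π a b v)) + D * ∏ v, G v 0 := by
  rw [tsum_prod_eq_level hn hG hfin, prod_lintegral_eq_level hn hG hfin,
    prod_zero_eq_level hfin, ← lintegral_const_mul' _ _ hC, ← lintegral_const_mul' _ _ hD,
    ← lintegral_add_right]
  swap
  · exact (measurable_one.indicator measurableSet_level_zero).const_mul D
  refine lintegral_mono fun u => ?_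
  have : Nonempty (Fin n) := ⟨⟨0, hn⟩⟩
  by_cases h0 : u ∈ {u : Option (Fin s) → ℝ | ∀ v, 0 < u v ∧ u v < (G v 0).toReal}
  · dsimp only
    rw [indicator_of_mem h0, Pi.one_apply, mul_one]
    refine H _ (normLower_levelBox hn hG hfin u) fun v => ?_
    obtain ⟨R, hR⟩ := hsupp v
    refine (Metric.isBounded_closedBall (x := (0 : SField p v)) (r := R)).subset fun x hx => ?_
    rw [mem_closedBall_zero_iff]
    by_contra! hlt
    have h2 := hx.1.trans hx.2
    rw [hR _ (by rwa [pi_norm_const])] at h2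
    simp at h2
  · have : boxVol (levelBox G u) ^ n = 0 := by
      rw [mem_ofPred_eq, not_forall] at h0
      obtain ⟨v, hv⟩ := h0
      rw [boxVol, Finset.prod_eq_zero (Finset.mem_univ v), zero_pow hn.ne']
      have : levelBox G u v = ∅ := eq_empty_of_forall_notMem fun x hx => hv <| by
        rw [mem_levelBox_iff hn hG hfin]
        exact fun b => (normLower_levelBox hn hG hfin u v).zero_mem hx
      rw [this, measure_empty]
    dsimp only
    rw [this]
    simp

end LayerCake

end

section

open Set
open scoped ENNReal NNReal

variable {s : ℕ} {p : Fin s → ℕ} [∀ i, Fact (p i).Prime]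

theorem ENNReal.add_pow_le_of_pos (x y : ℝ≥0∞) (n : ℕ) {δ : ℝ} (hδ : 0 < δ) :
    (x + y) ^ n ≤ ENNReal.ofReal (1 + δ) ^ n * x ^ n + ENNReal.ofReal (1 + δ⁻¹) ^ n * y ^ n := by
  rw [ENNReal.ofReal_add zero_le_one hδ.le, ENNReal.ofReal_add zero_le_one (inv_pos.2 hδ).le,
    ENNReal.ofReal_one, ENNReal.ofReal_inv_of_pos hδ, ← mul_pow, ← mul_pow]
  have h0 : ENNReal.ofReal δ ≠ 0 := by simpa using hδ
  rcases le_total y (ENNReal.ofReal δ * x) with h | h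
  · refine le_trans (pow_le_pow_left' ?_ n) le_self_add
    rw [add_mul, one_mul]
    gcongr
  · refine le_trans (pow_le_pow_left' ?_ n) le_add_self
    rw [add_mul, one_mul, add_comm]
    gcongr
    rw [← ENNReal.div_eq_inv_mul, ENNReal.le_div_iff_mul_le (Or.inl h0)
      (Or.inl ENNReal.ofReal_ne_top), mul_comm]
    exact h

theorem ENNReal.pow_le_prod_of_le_add_one {n : ℕ} (x : ℝ≥0∞) (y : Fin n → ℝ≥0∞)
    (h : ∀ b, x ≤ y b + 1) {δ : ℝ} (hδ : 0 < δ) :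
    x ^ n ≤ ENNReal.ofReal (1 + δ) ^ n * ∏ b, y b + ENNReal.ofReal (1 + δ⁻¹) ^ n := by
  rw [ENNReal.ofReal_add zero_le_one hδ.le, ENNReal.ofReal_add zero_le_one (inv_pos.2 hδ).le,
    ENNReal.ofReal_one, ENNReal.ofReal_inv_of_pos hδ]
  have h0 : ENNReal.ofReal δ ≠ 0 := by simpa using hδ
  rcases le_total x (1 + (ENNReal.ofReal δ)⁻¹) with hx | hx
  · exact le_trans (pow_le_pow_left' hx n) le_add_self
  · refine le_trans ?_ le_self_add
    have : x ^ n = ∏ _b : Fin n, x := by simp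
    have h2 : (1 + ENNReal.ofReal δ) ^ n = ∏ _b : Fin n, (1 + ENNReal.ofReal δ) := by simp
    rw [this, h2, ← Finset.prod_mul_distrib]
    refine Finset.prod_le_prod' fun b _ => (h b).trans ?_
    rw [add_mul, one_mul]
    gcongr
    have h3 : (ENNReal.ofReal δ)⁻¹ ≤ y b :=
      (ENNReal.add_le_add_iff_right ENNReal.one_ne_top).1 (((add_comm _ _).trans_le hx).trans (h b))
    calc (1 : ℝ≥0∞) = ENNReal.ofReal δ * (ENNReal.ofReal δ)⁻¹ :=
          (ENNReal.mul_inv_cancel h0 ENNReal.ofReal_ne_top).symm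
      _ ≤ _ := by gcongr

theorem encard_pi_eq_prod {α : Type*} {n : ℕ} (S : Fin n → Set α) :
    ({f : Fin n → α | ∀ b, f b ∈ S b}.encard : ℝ≥0∞) = ∏ b, ((S b).encard : ℝ≥0∞) := by
  classical
  rw [← tsum_indicator_one_eq_encard]
  simp_rw [← tsum_indicator_one_eq_encard]
  rw [← ENNReal.tsum_pi_prod]
  refine tsum_congr fun f => ?_
  by_cases h : ∀ b, f b ∈ S b
  · rw [indicator_of_mem (show f ∈ {f : Fin n → α | ∀ b, f b ∈ S b} from h)]
    simp [h]
  · rw [indicator_of_notMem (show f ∉ {f : Fin n → α | ∀ b, f b ∈ S b} from h)]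
    push Not at h
    obtain ⟨b, hb⟩ := h
    rw [Finset.prod_eq_zero (Finset.mem_univ b)]
    simp [hb]

variable [∀ i, MeasurableSpace ℚ_[p i]] [∀ i, BorelSpace ℚ_[p i]] {n : ℕ}

theorem encard_box_pi_eq (N : ℕ) (w : Fin n → ℚ) (B : ∀ v, Set (SField p v)) :
    ({f : Fin n → ZS p | ∀ b v, emb p (w b + N * f b) v ∈ B v}.encard : ℝ≥0∞)
      = ∏ b, ({e : ZS p | ∀ v, (emb p (w b) + emb p (N * e)) v ∈ B v}.encard : ℝ≥0∞) := by
  rw [← encard_pi_eq_prod]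
  congr! 7
  rw [map_add]
  rfl

/-- Upper bound for the sum of a product of norm-antitone functions over a coset of `N ℤ_S^n`. -/
theorem tsum_prod_coset_le (hp : Function.Injective p) {N : ℕ} (hN : 0 < N)
    (hNS : Nat.Coprime N (∏ i, p i)) (hn : 0 < n) {G : ∀ v, (Fin n → SField p v) → ℝ≥0∞}
    (hG : ∀ v, NormAntitone (G v)) (hfin : ∀ v y, G v y ≠ ∞) (w : Fin n → ℚ) {δ : ℝ} (hδ : 0 < δ) :
    ∑' f : Fin n → ZS p, ∏ v, G v (fun b => emb p (w b + N * f b) v)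
      ≤ (ENNReal.ofReal (1 + δ) / N) ^ n * (∏ v, ∫⁻ y, G v y)
        + ENNReal.ofReal (1 + δ⁻¹) ^ n * ∏ v, G v 0 := by
  have hN0 : (N : ℝ≥0∞) ≠ 0 := by exact_mod_cast hN.ne'
  refine tsum_prod_le_of_box hn hG hfin (fun (f : Fin n → ZS p) b v => emb p (w b + N * f b) v)
    (ENNReal.pow_ne_top (ENNReal.div_ne_top ENNReal.ofReal_ne_top hN0))
    (ENNReal.pow_ne_top ENNReal.ofReal_ne_top) fun B hB => ?_
  rw [encard_box_pi_eq]
  calc _ ≤ ∏ _b : Fin n, (boxVol B / N + 1) :=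
        Finset.prod_le_prod' fun b _ => encard_coset_box_le hp hN hNS hB _
    _ = (boxVol B / N + 1) ^ n := by simp
    _ ≤ _ := ENNReal.add_pow_le_of_pos _ _ _ hδ
    _ = _ := by
        rw [one_pow, mul_one, ← mul_pow, ← mul_pow, ENNReal.div_eq_inv_mul, ENNReal.div_eq_inv_mul,
          mul_left_comm, mul_assoc]

/-- Lower bound for the sum of a product of norm-antitone functions over a coset of `N ℤ_S^n`. -/
theorem prod_lintegral_le_tsum_coset (hp : Function.Injective p) {N : ℕ} (hN : 0 < N)
    (hNS : Nat.Coprime N (∏ i, p i)) (hn : 0 < n) {G : ∀ v, (Fin n → SField p v) → ℝ≥0∞}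
    (hG : ∀ v, NormAntitone (G v)) (hfin : ∀ v y, G v y ≠ ∞)
    (hsupp : ∀ v, ∃ R : ℝ, ∀ y, R < ‖y‖ → G v y = 0) (w : Fin n → ℚ) {δ : ℝ} (hδ : 0 < δ) :
    ∏ v, ∫⁻ y, G v y
      ≤ (ENNReal.ofReal (1 + δ) * N) ^ n *
          (∑' f : Fin n → ZS p, ∏ v, G v (fun b => emb p (w b + N * f b) v))
        + (ENNReal.ofReal (1 + δ⁻¹) * N) ^ n * ∏ v, G v 0 := by
  have hN0 : (N : ℝ≥0∞) ≠ 0 := by exact_mod_cast hN.ne'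
  have hNt : (N : ℝ≥0∞) ≠ ∞ := ENNReal.natCast_ne_top N
  refine prod_lintegral_le_of_box hn hG hfin hsupp
    (fun (f : Fin n → ZS p) b v => emb p (w b + N * f b) v)
    (ENNReal.pow_ne_top (ENNReal.mul_ne_top ENNReal.ofReal_ne_top hNt))
    (ENNReal.pow_ne_top (ENNReal.mul_ne_top ENNReal.ofReal_ne_top hNt)) fun B hB hb => ?_
  rw [encard_box_pi_eq]
  calc boxVol B ^ n = N ^ n * (boxVol B / N) ^ n := by
        rw [← mul_pow, ENNReal.mul_div_cancel hN0 hNt]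
    _ ≤ N ^ n * (ENNReal.ofReal (1 + δ) ^ n *
          (∏ b, ({e : ZS p | ∀ v, (emb p (w b) + emb p (N * e)) v ∈ B v}.encard : ℝ≥0∞))
          + ENNReal.ofReal (1 + δ⁻¹) ^ n) :=
        mul_le_mul_right (ENNReal.pow_le_prod_of_le_add_one _ _
          (fun b => boxVol_div_le_encard_coset_box hp hN hNS hB hb (emb p (w b))) hδ) _
    _ = _ := by
        rw [mul_pow, mul_pow]
        ring

/-- Sums over non-zero points of `ℤ_S^n` are bounded by the integral. -/
theorem tsum_prod_ne_zero_le (hp : Function.Injective p) (hn : 0 < n)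
    {G : ∀ v, (Fin n → SField p v) → ℝ≥0∞}
    (hG : ∀ v, NormAntitone (G v)) (hfin : ∀ v y, G v y ≠ ∞) :
    ∑' f : {f : Fin n → ZS p // f ≠ 0}, ∏ v, G v (fun b => emb p (f.1 b) v)
      ≤ 2 ^ n * (∏ v, ∫⁻ y, G v y) := by
  have key := tsum_prod_le_of_box hn hG hfin
    (fun (f : {f : Fin n → ZS p // f ≠ 0}) b v => emb p (f.1 b) v) (C := 2 ^ n) (D := 0)
    (by finiteness) (by finiteness) fun B hB => ?_
  · simpa using key
  rw [add_zero]
  rcases eq_empty_or_nonempty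
    {a : {f : Fin n → ZS p // f ≠ 0} | ∀ b v, emb p (a.1 b) v ∈ B v} with h | ⟨f, hf⟩
  · rw [h]; simp
  have h1 : 1 ≤ boxVol B := by
    obtain ⟨b, hb⟩ := Function.ne_iff.1 f.2
    have h2 := encard_ne_zero_box_le hp one_pos (Nat.coprime_one_left _) hB
    have h3 : f.1 b ∈ {c : ZS p | (c : ℚ) ≠ 0 ∧ ∀ v, (((1 : ℕ) * c : ℚ) : SField p v) ∈ B v} := by
      refine ⟨by simpa using hb, fun v => ?_⟩
      have := hf b v
      simpa using this
    have h4 := Set.one_le_encard_iff_nonempty.2 ⟨_, h3⟩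
    rw [show boxVol B / ((1 : ℕ) : ℝ≥0∞) = boxVol B by simp] at h2
    refine le_trans ?_ h2
    exact_mod_cast h4
  calc ({a : {f : Fin n → ZS p // f ≠ 0} | ∀ b v, emb p (a.1 b) v ∈ B v}.encard : ℝ≥0∞)
      ≤ ({f : Fin n → ZS p | ∀ b v, emb p ((0 : Fin n → ℚ) b + (1 : ℕ) * f b) v ∈ B v}.encard
          : ℝ≥0∞) := by
        have := Set.encard_le_encard_of_injOn
          (s := {a : {f : Fin n → ZS p // f ≠ 0} | ∀ b v, emb p (a.1 b) v ∈ B v})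
          (t := {f : Fin n → ZS p | ∀ b v, emb p ((0 : Fin n → ℚ) b + (1 : ℕ) * f b) v ∈ B v})
          (f := Subtype.val) (fun a ha b v => by simpa using ha b v) Subtype.val_injective.injOn
        exact_mod_cast this
    _ ≤ ∏ _b : Fin n, (boxVol B / (1 : ℕ) + 1) := by
        rw [encard_box_pi_eq]
        exact Finset.prod_le_prod' fun b _ =>
          encard_coset_box_le hp one_pos (Nat.coprime_one_left _) hB _
    _ ≤ _ := by
        rw [Finset.prod_const, Finset.card_univ, Fintype.card_fin, ← mul_pow, Nat.cast_one, div_one,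
          two_mul]
        gcongr

/-- One-dimensional version of `tsum_prod_le_of_box`. -/
theorem tsum_prod_le_of_box_one {ω : ∀ v, SField p v → ℝ≥0∞}
    (hω : ∀ v, NormAntitone (ω v)) (hfin : ∀ v y, ω v y ≠ ∞) {α : Type*} [Countable α]
    (π : α → ∀ v, SField p v)
    {C D : ℝ≥0∞} (hC : C ≠ ∞) (hD : D ≠ ∞) (H : ∀ B : ∀ v, Set (SField p v), (∀ v, NormLower (B v)) →
      ({a | ∀ v, π a v ∈ B v}.encard : ℝ≥0∞) ≤ C * boxVol B + D) :
    ∑' a, ∏ v, ω v (π a v) ≤ C * (∏ v, ∫⁻ y, ω v y) + D * ∏ v, ω v 0 := by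
  have key := tsum_prod_le_of_box (n := 1) one_pos (G := fun v y => ω v (y 0)) (fun v x y h =>
    hω v _ _ (by simpa [Pi.norm_def] using h)) (fun v y => hfin v _) (fun a _ v => π a v) hC hD
    fun B hB => by simpa using H B hB
  refine key.trans (le_of_eq ?_)
  congr! 4 with v
  exact (volume_preserving_funUnique (Fin 1) (SField p v)).lintegral_comp (hω v).measurable

/-- Sums over cosets of `N ℤ_S`. -/
theorem tsum_prod_coset_one_le (hp : Function.Injective p) {N : ℕ} (hN : 0 < N)
    (hNS : Nat.Coprime N (∏ i, p i)) {ω : ∀ v, SField p v → ℝ≥0∞}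
    (hω : ∀ v, NormAntitone (ω v)) (hfin : ∀ v y, ω v y ≠ ∞) (w : ℚ) :
    ∑' e : ZS p, ∏ v, ω v (emb p (w + N * e) v)
      ≤ (∏ v, ∫⁻ y, ω v y) / N + ∏ v, ω v 0 := by
  have hN0 : (N : ℝ≥0∞) ≠ 0 := by exact_mod_cast hN.ne'
  have := tsum_prod_le_of_box_one hω hfin (fun (e : ZS p) v => emb p (w + N * e) v)
    (C := (N : ℝ≥0∞)⁻¹) (D := 1) (by simpa using hN.ne') (by simp) fun B hB => by
      rw [← ENNReal.div_eq_inv_mul]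
      have := encard_coset_box_le hp hN hNS hB (emb p w)
      simp only [← map_add] at this
      exact this
  rwa [one_mul, ← ENNReal.div_eq_inv_mul] at this

theorem encard_classes_box_le (hp : Function.Injective p) {N : ℕ} (hN : 0 < N)
    (hNS : Nat.Coprime N (∏ i, p i)) {B : ∀ v, Set (SField p v)} (hB : ∀ v, NormLower (B v))
    (j : ℤ) :
    ({a : Fin N × ZS p | (j * (a.1 : ℕ) + N * a.2 : ℚ) ≠ 0 ∧
      ∀ v, ((j * (a.1 : ℕ) + N * a.2 : ℚ) : SField p v) ∈ B v}.encard : ℝ≥0∞) ≤ boxVol B := by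
  set g : ℕ := Int.gcd j N with hg
  have hg0 : 0 < g := Int.gcd_pos_of_ne_zero_right _ (by exact_mod_cast hN.ne')
  obtain ⟨j', hj'⟩ : (g : ℤ) ∣ j := Int.gcd_dvd_left ..
  obtain ⟨N', hN'⟩ : g ∣ N := by exact_mod_cast (Int.gcd_dvd_right j N)
  have hN'0 : 0 < N' := Nat.pos_of_ne_zero (by rintro rfl; simp at hN'; omega)
  have hcop : IsCoprime j' (N' : ℤ) := by
    rw [Int.isCoprime_iff_gcd_eq_one]
    have h1 : Int.gcd (g * j') (g * N') = g := by
      rw [← hj', hg]; congr 1; exact_mod_cast hN'.symm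
    rw [Int.gcd_mul_left] at h1
    exact Nat.eq_of_mul_eq_mul_left hg0 (by simpa using h1)
  obtain ⟨α, β, hαβ⟩ := hcop
  have hαβ' : (α * j' + β * N' : ℚ) = 1 := by exact_mod_cast hαβ
  have hjq : (j : ℚ) = g * j' := by exact_mod_cast hj'
  have hNq : (N : ℚ) = g * N' := by exact_mod_cast hN'
  have hgq : (g : ℚ) ≠ 0 := by exact_mod_cast hg0.ne'
  have hN'q : (N' : ℚ) ≠ 0 := by exact_mod_cast hN'0.ne'
  have hgS : Nat.Coprime g (∏ i, p i) := Nat.Coprime.coprime_dvd_left ⟨N', hN'⟩ hNS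
  have hN'S : Nat.Coprime N' (∏ i, p i) := Nat.Coprime.coprime_dvd_left ⟨g, hN'.trans (mul_comm _ _)⟩ hNS
  set C : Set (ZS p) := {c : ZS p | (c : ℚ) ≠ 0 ∧ ∀ v, ((g * c : ℚ) : SField p v) ∈ B v} with hC
  have hZint : ∀ z : ℤ, (z : ℚ) ∈ ZS p := fun z => intCast_mem _ z
  set F : Fin N × ZS p → ZS p × Fin g := fun a =>
    (⟨j' * ((a.1 : ℕ) : ℚ) + N' * a.2, (ZS p).add_mem ((ZS p).mul_mem (hZint _) (natCast_mem _ _))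
      ((ZS p).mul_mem (natCast_mem _ _) a.2.2)⟩,
      ⟨a.1 / N', Nat.div_lt_of_lt_mul (by rw [mul_comm, ← hN']; exact a.1.2)⟩) with hF
  have hval : ∀ a, (j * (a.1 : ℕ) + N * a.2 : ℚ) = g * ((F a).1 : ℚ) := fun a => by
    simp only [hF, hjq, hNq]; ring
  have h1 := Set.encard_le_encard_of_injOn (f := F) (s := {a : Fin N × ZS p |
      (j * (a.1 : ℕ) + N * a.2 : ℚ) ≠ 0 ∧
      ∀ v, ((j * (a.1 : ℕ) + N * a.2 : ℚ) : SField p v) ∈ B v}) (t := C ×ˢ (univ : Set (Fin g)))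
    (fun a ha => by
      refine ⟨⟨fun h => ha.1 ?_, fun v => ?_⟩, mem_univ _⟩
      · rw [hval, h, mul_zero]
      · rw [← hval]; exact ha.2 v) (fun a _ b _ hab => by
      have e1 : (j' * ((a.1 : ℕ) : ℚ) + N' * a.2) = j' * ((b.1 : ℕ) : ℚ) + N' * b.2 :=
        congrArg (fun x : ZS p × Fin g => ((x.1 : ZS p) : ℚ)) hab
      have e2 : (a.1 : ℕ) / N' = b.1 / N' := congrArg (fun x : ZS p × Fin g => (x.2 : ℕ)) hab
      have e3 : (((a.1 : ℕ) : ℤ) - ((b.1 : ℕ) : ℤ) : ℚ)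
          = N' * (β * (a.1 - b.1 : ℚ) + α * ((b.2 : ℚ) - a.2)) := by
        have : ((a.1 : ℕ) - (b.1 : ℕ) : ℚ) = (α * j' + β * N') * ((a.1 : ℕ) - (b.1 : ℕ) : ℚ) := by
          rw [hαβ', one_mul]
        push_cast
        linear_combination this + α * e1
      have e4 : ((((a.1 : ℕ) : ℤ) - ((b.1 : ℕ) : ℤ) : ℤ) : ℚ) / N' ∈ ZS p := by
        push_cast
        push_cast at e3
        rw [e3, mul_div_cancel_left₀ _ hN'q]
        exact (ZS p).add_mem ((ZS p).mul_mem (hZint _)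
          ((ZS p).sub_mem (natCast_mem _ _) (natCast_mem _ _)))
          ((ZS p).mul_mem (hZint _) ((ZS p).sub_mem b.2.2 a.2.2))
      obtain ⟨z, hz⟩ := ZS.exists_int_of_norm_le_one e4 fun i => by
        have hn1 := norm_natCast_eq_one_of_coprime (p := p) hN'S i
        have hn2 : ‖((N' : ℕ) : ℚ_[p i])‖ = 1 := hn1
        rw [Rat.cast_div, Rat.cast_natCast, norm_div, hn2, div_one, Rat.cast_intCast]
        exact Padic.norm_int_le_one _
      have e5 : (((a.1 : ℕ) : ℤ) - ((b.1 : ℕ) : ℤ)) = N' * z := by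
        rw [div_eq_iff hN'q] at hz
        have : ((((a.1 : ℕ) : ℤ) - ((b.1 : ℕ) : ℤ) : ℤ) : ℚ) = ((N' * z : ℤ) : ℚ) := by
          push_cast; push_cast at hz; rw [hz]; ring
        exact_mod_cast this
      have e6 : (a.1 : ℕ) = b.1 := by
        have ha := Nat.div_add_mod (a.1 : ℕ) N'
        have hb := Nat.div_add_mod (b.1 : ℕ) N'
        have : ((a.1 : ℕ)) % N' = (b.1 : ℕ) % N' := by
          have : ((a.1 : ℕ) : ℤ) ≡ ((b.1 : ℕ) : ℤ) [ZMOD N'] :=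
            (Int.modEq_iff_dvd.2 ⟨-z, by linarith⟩)
          exact (Int.natCast_modEq_iff).1 this
        rw [← ha, ← hb, e2, this]
      refine Prod.ext (Fin.ext e6) (Subtype.ext ?_)
      rw [e6] at e1
      exact mul_left_cancel₀ hN'q (by linarith))
  have h2 := encard_ne_zero_box_le hp hg0 hgS hB
  have hg1 : (g : ℝ≥0∞) ≠ 0 := by exact_mod_cast hg0.ne'
  calc _ ≤ ((C ×ˢ (univ : Set (Fin g))).encard : ℝ≥0∞) := by exact_mod_cast h1
    _ = (C.encard : ℝ≥0∞) * g := by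
        rw [Set.encard_prod, Set.encard_univ, ENat.card_eq_coe_fintype_card, Fintype.card_fin]
        simp
    _ ≤ boxVol B / g * g := by gcongr
    _ = _ := ENNReal.div_mul_cancel hg1 (ENNReal.natCast_ne_top g)

/-- Sums over the non-zero values of an affine form on residue classes modulo `N`. -/
theorem tsum_prod_classes_le (hp : Function.Injective p) {N : ℕ} (hN : 0 < N)
    (hNS : Nat.Coprime N (∏ i, p i)) {ω : ∀ v, SField p v → ℝ≥0∞}
    (hω : ∀ v, NormAntitone (ω v)) (hfin : ∀ v y, ω v y ≠ ∞) (j : ℤ) :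
    ∑' a : {a : Fin N × ZS p // (j * (a.1 : ℕ) + N * a.2 : ℚ) ≠ 0},
      ∏ v, ω v (emb p (j * (a.1.1 : ℕ) + N * a.1.2) v)
      ≤ ∏ v, ∫⁻ y, ω v y := by
  have := tsum_prod_le_of_box_one hω hfin
    (fun (a : {a : Fin N × ZS p // (j * (a.1 : ℕ) + N * a.2 : ℚ) ≠ 0}) v =>
      emb p (j * (a.1.1 : ℕ) + N * a.1.2) v)
    (C := 1) (D := 0) (by simp) (by simp) fun B hB => by
      rw [one_mul, add_zero]
      refine le_trans ?_ (encard_classes_box_le hp hN hNS hB j)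
      have := Set.encard_le_encard_of_injOn
        (s := {a : {a : Fin N × ZS p // (j * (a.1 : ℕ) + N * a.2 : ℚ) ≠ 0} |
          ∀ v, emb p (j * (a.1.1 : ℕ) + N * a.1.2) v ∈ B v})
        (t := {a : Fin N × ZS p | (j * (a.1 : ℕ) + N * a.2 : ℚ) ≠ 0 ∧
          ∀ v, ((j * (a.1 : ℕ) + N * a.2 : ℚ) : SField p v) ∈ B v})
        (f := Subtype.val) (fun a ha => ⟨a.2, fun v => ha v⟩) Subtype.val_injective.injOn
      exact_mod_cast this
  simpa using this

end

section

open Set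
open scoped ENNReal NNReal

section Overlap

variable {K : Type*} [NontriviallyNormedField K] [ProperSpace K] [MeasureSpace K] [BorelSpace K]
  [Measure.IsAddHaarMeasure (volume : Measure K)]

theorem exists_lintegral_comp_mul_left {a : K} (ha : a ≠ 0) :
    ∃ κ : ℝ≥0∞, ∀ f : K → ℝ≥0∞, Measurable f → ∫⁻ x, f (a * x) = κ * ∫⁻ x, f x := by
  have hmeas : Measurable fun x : K => a * x := measurable_const_mul a
  have h1 : Measure.IsAddHaarMeasure (Measure.map (fun x : K => a * x) volume) :=
    AddEquiv.isAddHaarMeasure_map volume (DistribMulAction.toAddEquiv₀ K a ha)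
      (continuous_const_mul a) (continuous_const_mul a⁻¹)
  obtain ⟨κ, hκ⟩ : ∃ κ : ℝ≥0, Measure.map (fun x : K => a * x) volume = κ • volume :=
    ⟨_, Measure.isAddLeftInvariant_eq_smul _ _⟩
  refine ⟨κ, fun f hf => ?_⟩
  rw [← lintegral_map hf hmeas, hκ, lintegral_smul_measure]
  rfl

/-- The measure of the set of `z` at which two affine maps take values in given sets. -/
def overlap (k l α β : K) (B B' : Set K) (c : K) : ℝ≥0∞ :=
  volume {z : K | k * z + β * c ∈ B ∧ l * z - α * c ∈ B'}

theorem overlap_eq {k l α β : K} (hk : k ≠ 0) (hαβ : α * k + β * l = 1) (B B' : Set K) (c : K) :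
    overlap k l α β B B' c = volume {y : K | k * y ∈ B ∧ l * y - c / k ∈ B'} := by
  rw [overlap, ← measure_preimage_add_right volume (β * c / k)
    {y : K | k * y ∈ B ∧ l * y - c / k ∈ B'}]
  congr 1
  ext z
  simp only [mem_preimage, mem_ofPred_eq]
  rw [show k * (z + β * c / k) = k * z + β * c by field_simp,
    show l * (z + β * c / k) - c / k = l * z - α * c by
      field_simp
      linear_combination c * hαβ]

theorem overlap_zero (k l α β : K) (B B' : Set K) :
    overlap k l α β B B' 0 = volume {z : K | k * z ∈ B ∧ l * z ∈ B'} := by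
  simp [overlap]

theorem lintegral_overlap {k l α β : K} (hk : k ≠ 0) (hαβ : α * k + β * l = 1) {B B' : Set K}
    (hB : MeasurableSet B) (hB' : MeasurableSet B') :
    ∫⁻ c, overlap k l α β B B' c = volume B * volume B' := by
  obtain ⟨κ, hκ⟩ := exists_lintegral_comp_mul_left hk
  have hf : Measurable (B.indicator (1 : K → ℝ≥0∞)) := measurable_one.indicator hB
  have hf' : Measurable (B'.indicator (1 : K → ℝ≥0∞)) := measurable_one.indicator hB'
  have h1 : ∀ c, overlap k l α β B B' c
      = κ * ∫⁻ y, B.indicator 1 y * B'.indicator 1 (l / k * y - k⁻¹ * c) := by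
    intro c
    have hm : MeasurableSet {y : K | k * y ∈ B ∧ l * y - c / k ∈ B'} :=
      (hB.preimage (measurable_const_mul k)).inter
        (hB'.preimage ((measurable_const_mul l).sub_const _))
    rw [overlap_eq hk hαβ, ← hκ (fun y => B.indicator 1 y * B'.indicator 1 (l / k * y - k⁻¹ * c))
      (hf.mul (hf'.comp ((measurable_const_mul _).sub_const _))), ← lintegral_indicator_one hm]
    refine lintegral_congr fun y => ?_
    have : l / k * (k * y) - k⁻¹ * c = l * y - c / k := by field_simp
    rw [this]
    by_cases h1 : k * y ∈ B <;> by_cases h2 : l * y - c / k ∈ B' <;>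
      simp [indicator, h1, h2]
  have hm2 : Measurable (Function.uncurry fun (c y : K) =>
      B.indicator (1 : K → ℝ≥0∞) y * B'.indicator 1 (l / k * y - k⁻¹ * c)) := by
    refine (hf.comp measurable_snd).mul (hf'.comp ?_)
    exact (measurable_snd.const_mul _).sub (measurable_fst.const_mul _)
  simp_rw [h1]
  have hm4 : Measurable fun c => ∫⁻ y, B.indicator (1 : K → ℝ≥0∞) y *
      B'.indicator 1 (l / k * y - k⁻¹ * c) := hm2.lintegral_prod_right'
  rw [lintegral_const_mul _ hm4, lintegral_lintegral_swap hm2.aemeasurable]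
  have h2 : ∀ y, κ * ∫⁻ c, B.indicator (1 : K → ℝ≥0∞) y * B'.indicator 1 (l / k * y - k⁻¹ * c)
      = B.indicator (1 : K → ℝ≥0∞) y * volume B' := by
    intro y
    rw [lintegral_const_mul _ (by fun_prop), mul_left_comm]
    congr 1
    have := hκ (fun c => B'.indicator 1 (l / k * y - k⁻¹ * c))
      (hf'.comp (measurable_const.sub (measurable_id.const_mul _)))
    rw [← this]
    simp only [inv_mul_cancel_left₀ hk]
    rw [lintegral_sub_left_eq_self (fun c => B'.indicator (1 : K → ℝ≥0∞) c),
      lintegral_indicator_one hB']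
  have hm3 : Measurable fun y => ∫⁻ c, B.indicator (1 : K → ℝ≥0∞) y *
      B'.indicator 1 (l / k * y - k⁻¹ * c) := hm2.lintegral_prod_left'
  rw [← lintegral_const_mul _ hm3]
  simp_rw [h2]
  rw [lintegral_mul_const _ hf, lintegral_indicator_one hB]

theorem volume_inter_translate_comm (I I' : Set K) (d : K) :
    volume {y : K | y ∈ I ∧ y - d ∈ I'} = volume {y : K | y ∈ I' ∧ y - -d ∈ I} := by
  rw [← measure_preimage_add_right volume d {y : K | y ∈ I ∧ y - d ∈ I'}]
  congr 1
  ext y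
  simp [and_comm]

theorem volume_inter_translate_neg {I I' : Set K} (hI : NormLower I) (hI' : NormLower I') (d : K) :
    volume {y : K | y ∈ I ∧ y - d ∈ I'} = volume {y : K | y ∈ I ∧ y - -d ∈ I'} := by
  rw [← Measure.measure_preimage_neg volume {y : K | y ∈ I ∧ y - d ∈ I'}]
  congr 1
  ext y
  have h1 : ∀ {J : Set K}, NormLower J → ∀ x, -x ∈ J ↔ x ∈ J := fun hJ x =>
    ⟨hJ _ _ (norm_neg x).ge, hJ _ _ (norm_neg x).le⟩
  simp only [mem_preimage, mem_ofPred_eq, h1 hI]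
  rw [← h1 hI', show -(-y - d) = y - -d by ring]

theorem NormLower.total {I I' : Set K} (hI : NormLower I) (hI' : NormLower I') :
    I ⊆ I' ∨ I' ⊆ I := by
  by_contra! h
  obtain ⟨x, hx, hx'⟩ := not_subset.1 h.1
  obtain ⟨y, hy, hy'⟩ := not_subset.1 h.2
  rcases le_total ‖x‖ ‖y‖ with h | h
  · exact hx' (hI' x y h hy)
  · exact hy' (hI y x h hx)

theorem NormLower.preimage_mul {I : Set K} (hI : NormLower I) (a : K) :
    NormLower {y | a * y ∈ I} := fun x y hxy hy => hI _ _ (by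
  rw [norm_mul, norm_mul]; gcongr) hy

end Overlap

variable {s : ℕ} {p : Fin s → ℕ} [∀ i, Fact (p i).Prime]

theorem exists_sign_translate : ∀ {v : Option (Fin s)} {d d' : SField p v}, ‖d‖ ≤ ‖d'‖ →
    ∃ e : SField p v, (e = d ∨ e = -d) ∧ ∀ I : Set (SField p v), NormLower I →
      ∀ y ∈ I, y - d' ∈ I → y - e ∈ I
  | some i, d, d', h => by
    refine ⟨d, Or.inl rfl, fun I hI y hy hyd => ?_⟩
    have key : ∀ a b : SField p (some i), a ∈ I → b ∈ I → ∀ x, ‖x‖ ≤ max ‖a‖ ‖b‖ → x ∈ I := by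
      intro a b ha hb x hx
      rcases le_max_iff.1 hx with h | h
      · exact hI _ _ h ha
      · exact hI _ _ h hb
    have h1 : d' ∈ I := key y (y - d') hy hyd d' (by
      have := IsUltrametricDist.norm_sub_le_max y (y - d')
      rwa [sub_sub_cancel] at this)
    exact key y d hy (hI _ _ h h1) _ (IsUltrametricDist.norm_sub_le_max _ _)
  | none, d, d', h => by
    change ℝ at d d'
    have h : |d| ≤ |d'| := h
    refine ⟨if 0 ≤ d * d' then d else -d, ?_, fun I hI y hy hyd => ?_⟩
    · by_cases h0 : 0 ≤ d * d'
      · exact Or.inl (if_pos h0)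
      · exact Or.inr (if_neg h0)
    change Set ℝ at I
    change ℝ at y
    have hI' : NormLower (E := ℝ) I := hI
    have hO := hI'.ordConnected
    set e : ℝ := if 0 ≤ d * d' then d else -d with he
    have h2 : |e| ≤ |d'| := by
      rw [he]; split_ifs <;> simpa using h
    have h3 : 0 ≤ e * d' := by
      rw [he]; split_ifs with h4
      · exact h4
      · nlinarith
    change (y - e : ℝ) ∈ I
    have hyd : (y - d' : ℝ) ∈ I := hyd
    rcases le_total 0 d' with h0 | h0
    · have he0 : 0 ≤ e := by
        rcases h0.eq_or_lt with h0 | h0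
        · rw [← h0] at h2; simp at h2; rw [h2]
        · exact nonneg_of_mul_nonneg_left h3 h0
      rw [abs_of_nonneg he0, abs_of_nonneg h0] at h2
      exact hO.out hyd hy ⟨by linarith, by linarith⟩
    · have he0 : e ≤ 0 := by
        rcases h0.eq_or_lt with h0 | h0
        · rw [h0] at h2; simp at h2; rw [h2]
        · by_contra! hlt; nlinarith
      rw [abs_of_nonpos he0, abs_of_nonpos h0] at h2
      exact hO.out hy hyd ⟨by linarith, by linarith⟩

variable [∀ i, MeasurableSpace ℚ_[p i]] [∀ i, BorelSpace ℚ_[p i]]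

theorem volume_inter_translate_le {v : Option (Fin s)} {I I' : Set (SField p v)}
    (hI : NormLower I) (hI' : NormLower I') {d d' : SField p v} (h : ‖d‖ ≤ ‖d'‖) :
    volume {y | y ∈ I ∧ y - d' ∈ I'} ≤ volume {y | y ∈ I ∧ y - d ∈ I'} := by
  have key : ∀ {I I' : Set (SField p v)}, NormLower I → NormLower I' → I ⊆ I' →
      ∀ {d d' : SField p v}, ‖d‖ ≤ ‖d'‖ →
      volume {y | y ∈ I ∧ y - d' ∈ I'} ≤ volume {y | y ∈ I ∧ y - d ∈ I'} := by
    intro I I' hI hI' hsub d d' h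
    obtain ⟨e, he, hh⟩ := exists_sign_translate h
    have h1 : volume {y | y ∈ I ∧ y - d' ∈ I'} ≤ volume {y | y ∈ I ∧ y - e ∈ I'} :=
      measure_mono fun y hy => ⟨hy.1, hh I' hI' y (hsub hy.1) hy.2⟩
    rcases he with rfl | rfl
    · exact h1
    · rwa [volume_inter_translate_neg hI hI' d]
  rcases hI.total hI' with hs | hs
  · exact key hI hI' hs h
  · rw [volume_inter_translate_comm I I' d, volume_inter_translate_comm I I' d']
    exact key hI' hI hs (by simpa using h)

theorem normAntitone_overlap {v : Option (Fin s)} {k l α β : SField p v} (hk : k ≠ 0) (hl : l ≠ 0)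
    (hαβ : α * k + β * l = 1) {B B' : Set (SField p v)} (hB : NormLower B) (hB' : NormLower B') :
    NormAntitone (overlap k l α β B B') := by
  intro c c' h
  have h1 : ∀ c, overlap k l α β B B' c
      = volume {y | y ∈ {y | k * y ∈ B} ∧ y - c / (k * l) ∈ {y | l * y ∈ B'}} := by
    intro c
    rw [overlap_eq hk hαβ]
    congr 1
    ext y
    simp only [mem_ofPred_eq]
    rw [show l * (y - c / (k * l)) = l * y - c / k by field_simp]
  rw [h1, h1]
  refine volume_inter_translate_le (hB.preimage_mul k) (hB'.preimage_mul l) ?_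
  rw [norm_div, norm_div]
  gcongr

end

section

open Set
open scoped ENNReal NNReal

variable {s : ℕ} {p : Fin s → ℕ} [∀ i, Fact (p i).Prime]

instance : Countable (ZS p) := inferInstanceAs (Countable {x : ℚ // x ∈ ZS p})

variable (p) in
/-- The embedding of the lattice `N ℤ_S` in `ℚ_S`. -/
def latt (N : ℕ) : ZS p →+ SAdele p where
  toFun e := emb p (N * e)
  map_zero' := by simp
  map_add' x y := by rw [← map_add]; congr 1; push_cast; ring

theorem latt_apply (N : ℕ) (e : ZS p) : latt p N e = emb p (N * e) := rfl

variable (p) in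
/-- A fundamental domain for `N ℤ_S` in `ℚ_S`. -/
def tileOne (N : ℕ) : Set (∀ v, SField p v) :=
  univ.pi fun
    | none => (Ico 0 (N : ℝ) : Set ℝ)
    | some i => Metric.closedBall (0 : ℚ_[p i]) 1

theorem mem_tileOne {N : ℕ} {x : ∀ v, SField p v} : x ∈ tileOne p N ↔
    (x none : ℝ) ∈ Ico 0 (N : ℝ) ∧ ∀ i, ‖x (some i)‖ ≤ 1 := by
  constructor
  · intro h
    exact ⟨h none (mem_univ _), fun i =>
      (mem_closedBall_zero_iff (E := ℚ_[p i])).1 (h (some i) (mem_univ _))⟩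
  · rintro ⟨h1, h2⟩ (_ | i) -
    · exact h1
    · exact (mem_closedBall_zero_iff (E := ℚ_[p i])).2 (h2 i)

variable [∀ i, MeasurableSpace ℚ_[p i]] [∀ i, BorelSpace ℚ_[p i]] {n : ℕ}

theorem measurableSet_tileOne (N : ℕ) : MeasurableSet (tileOne p N) := by
  refine MeasurableSet.univ_pi ?_
  rintro (_ | i)
  · exact measurableSet_Ico (a := (0 : ℝ))
  · exact (Metric.isClosed_closedBall (x := (0 : SField p (some i))) (ε := 1)).measurableSet

theorem volume_tileOne (N : ℕ) : volume (tileOne p N) = N := by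
  rw [tileOne, volume_pi_pi, Fintype.prod_option]
  have h1 : (volume (Ico 0 (N : ℝ)) : ℝ≥0∞) = N := by simp
  have h2 : ∀ i, padicHaar (p i) (Metric.closedBall 0 1) = 1 := fun i =>
    padicHaar_closedBall_one (p i)
  calc _ = volume (Ico 0 (N : ℝ)) * ∏ i, padicHaar (p i) (Metric.closedBall 0 1) := rfl
    _ = _ := by simp [h1, h2]

theorem isTile_tileOne (hp : Function.Injective p) {N : ℕ} (hN : 0 < N)
    (hNS : Nat.Coprime N (∏ i, p i)) : IsTile (latt p N) (G := SAdele p) (tileOne p N) := by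
  have hNq : (N : ℚ) ≠ 0 := by exact_mod_cast hN.ne'
  have hNr : (0 : ℝ) < N := by exact_mod_cast hN
  have hNi : ∀ i, ‖((N : ℚ) : SField p (some i))‖ = 1 := fun i => by
    rw [Rat.cast_natCast]; exact norm_natCast_eq_one_of_coprime (p := p) hNS i
  have hNi0 : ∀ i, ((N : ℚ) : SField p (some i)) ≠ 0 := fun i h => by
    have := hNi i; rw [h, norm_zero] at this; exact zero_ne_one this
  refine ⟨measurableSet_tileOne N, fun x => ?_⟩
  obtain ⟨x0, hx0⟩ : ∃ y : ℝ, y = x none := ⟨_, rfl⟩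
  have hmem : ∀ e : ZS p, x + latt p N e ∈ (tileOne p N : Set (SAdele p)) ↔
      (x0 + (N * e : ℚ) : ℝ) ∈ Ico 0 (N : ℝ) ∧
        ∀ i, ‖x (some i) + ((N * e : ℚ) : SField p (some i))‖ ≤ 1 := fun e => by
    subst hx0
    exact mem_tileOne
  obtain ⟨u, hu, hux⟩ := ZS.exists_norm_sub_le_one hp
    (fun i => (-(x (some i)) / ((N : ℚ) : SField p (some i)) : SField p (some i)))
  have hux' : ∀ i, ‖x (some i) + ((N * u : ℚ) : SField p (some i))‖ ≤ 1 := fun i => by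
    have h1 : ‖-(x (some i)) / ((N : ℚ) : SField p (some i)) - (u : SField p (some i))‖ ≤ 1 := hux i
    have h2 : x (some i) + ((N * u : ℚ) : SField p (some i)) = -((N : ℚ) : SField p (some i)) *
        (-(x (some i)) / ((N : ℚ) : SField p (some i)) - (u : SField p (some i))) := by
      rw [Rat.cast_mul, mul_sub, mul_div_assoc', neg_mul_neg, mul_div_cancel_left₀ _ (hNi0 i)]
      ring
    rw [h2, norm_mul, norm_neg, hNi, one_mul]
    exact h1
  obtain ⟨z, hz, -⟩ := existsUnique_add_zsmul_mem_Ico hNr (x0 + (N * u : ℚ)) 0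
  have hNint : ∀ (z : ℤ) i, ‖((N * z : ℚ) : SField p (some i))‖ ≤ 1 := fun z i => by
    rw [Rat.cast_mul, norm_mul, hNi, one_mul, Rat.cast_intCast]
    exact Padic.norm_int_le_one z
  refine ⟨⟨u + z, (ZS p).add_mem hu (intCast_mem _ z)⟩, (hmem _).2 ⟨?_, fun i => ?_⟩, ?_⟩
  · rw [zero_add, zsmul_eq_mul] at hz
    have h3 : x0 + ((N * (u + z) : ℚ) : ℝ) = x0 + ((N * u : ℚ) : ℝ) + z * N := by
      push_cast; ring
    change (x0 + ((N * (u + z) : ℚ) : ℝ)) ∈ _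
    rw [h3]; exact hz
  · have h3 : x (some i) + ((N * (u + z) : ℚ) : SField p (some i))
        = (x (some i) + ((N * u : ℚ) : SField p (some i))) + ((N * z : ℚ) : SField p (some i)) := by
      push_cast; ring
    change ‖x (some i) + ((N * (u + z) : ℚ) : SField p (some i))‖ ≤ 1
    rw [h3]
    exact (IsUltrametricDist.norm_add_le_max _ _).trans (max_le (hux' i) (hNint z i))
  · intro e he
    obtain ⟨he1, he2⟩ := (hmem e).1 he
    set w : ℚ := (e : ℚ) - (u + z) with hw
    have hwS : w ∈ ZS p := (ZS p).sub_mem e.2 ((ZS p).add_mem hu (intCast_mem _ z))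
    obtain ⟨a, ha⟩ := ZS.exists_int_of_norm_le_one hwS fun i => by
      change ‖(w : SField p (some i))‖ ≤ 1
      have h4 : ((N : ℚ) : SField p (some i)) * (w : SField p (some i)) =
        (x (some i) + ((N * e : ℚ) : SField p (some i))) -
        ((x (some i) + ((N * u : ℚ) : SField p (some i))) + ((N * z : ℚ) : SField p (some i))) := by
        rw [hw]; push_cast; ring
      have h10 : ‖(w : SField p (some i))‖
          = ‖((N : ℚ) : SField p (some i)) * (w : SField p (some i))‖ := by
        rw [norm_mul, hNi, one_mul]
      rw [h10, h4]
      exact (IsUltrametricDist.norm_sub_le_max _ _).trans (max_le (he2 i)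
        ((IsUltrametricDist.norm_add_le_max _ _).trans (max_le (hux' i) (hNint z i))))
    have h5 : (x0 + (N * e : ℚ) : ℝ) = x0 + ((N * u : ℚ) : ℝ) + z * N + a * N := by
      have : (e : ℚ) = u + z + a := by rw [← ha, hw]; ring
      rw [this]; push_cast; ring
    rw [zero_add, zsmul_eq_mul] at hz
    rw [h5] at he1
    have ha0 : a = 0 := by
      have h6 : (a : ℝ) * N < 1 * N := by linarith [hz.1, he1.2]
      have h7 : (-1 : ℝ) * N < a * N := by linarith [hz.2, he1.1]
      have h8 : a < 1 := by exact_mod_cast lt_of_mul_lt_mul_right h6 hNr.le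
      have h9 : -1 < a := by exact_mod_cast lt_of_mul_lt_mul_right h7 hNr.le
      omega
    refine Subtype.ext ?_
    have : (e : ℚ) = u + z + a := by rw [← ha, hw]; ring
    rw [this, ha0]; simp

end

section

open Set
open scoped ENNReal NNReal

variable {s : ℕ} {p : Fin s → ℕ} [∀ i, Fact (p i).Prime] {n : ℕ}

/-- The linear form with coefficients `q` on rows with entries in `ℚ_S`. -/
def rowForm (q : Fin n → ZS p) : (Fin n → SAdele p) →+ SAdele p where
  toFun r := ∑ b, r b * emb p (q b)
  map_zero' := by simp
  map_add' r r' := by simp [add_mul, Finset.sum_add_distrib]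

theorem rowForm_apply (q : Fin n → ZS p) (r : Fin n → SAdele p) :
    rowForm q r = ∑ b, r b * emb p (q b) := rfl

theorem rowForm_latt (q : Fin n → ZS p) (N : ℕ) (f : Fin n → ZS p) :
    rowForm q (AddMonoidHom.compLeft (latt p N) (Fin n) f) = latt p N (∑ b, f b * q b) := by
  rw [rowForm_apply, map_sum]
  refine Finset.sum_congr rfl fun b _ => ?_
  change emb p (N * f b) * emb p (q b) = emb p (N * (f b * q b : ZS p))
  rw [← map_mul]
  congr 1
  push_cast
  ring

theorem rowForm_single (q : Fin n → ZS p) (b : Fin n) (y : SAdele p) :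
    rowForm q (Pi.single b y) = y * emb p (q b) := by
  rw [rowForm_apply, Finset.sum_eq_single b]
  · simp
  · intro b' _ h
    simp [h]
  · simp

theorem rowForm_mul_left (q : Fin n → ZS p) (k : ZS p) (r : Fin n → SAdele p) :
    rowForm (fun b => k * q b) r = emb p k * rowForm q r := by
  rw [rowForm_apply, rowForm_apply, Finset.mul_sum]
  refine Finset.sum_congr rfl fun b _ => ?_
  push_cast
  rw [map_mul]
  ring

theorem rowForm_surjective {q : Fin n → ZS p} (hq : q ≠ 0) : Function.Surjective (rowForm q) := by
  obtain ⟨b, hb⟩ := Function.ne_iff.1 hq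
  have hb' : (q b : ℚ) ≠ 0 := fun h => hb (Subtype.ext h)
  intro y
  refine ⟨Pi.single b (y * emb p (q b : ℚ)⁻¹), ?_⟩
  rw [rowForm_single, mul_assoc, ← map_mul, inv_mul_cancel₀ hb', map_one, mul_one]

theorem rowForm_prod_surjective {q q' : Fin n → ZS p} {b b' : Fin n}
    (h : q b * q' b' ≠ q b' * q' b) :
    Function.Surjective ((rowForm q).prod (rowForm q')) := by
  set D : ℚ := q b * q' b' - q b' * q' b with hD
  have hD0 : D ≠ 0 := fun h0 => h (Subtype.ext (sub_eq_zero.1 h0))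
  have hDD : emb p D⁻¹ * emb p D = 1 := by
    rw [← map_mul, inv_mul_cancel₀ hD0, map_one]
  have hDe : emb p D = emb p (q b) * emb p (q' b') - emb p (q b') * emb p (q' b) := by
    rw [hD, map_sub, map_mul, map_mul]
  rintro ⟨y, y'⟩
  refine ⟨Pi.single b ((y * emb p (q' b') - y' * emb p (q b')) * emb p D⁻¹)
    + Pi.single b' ((y' * emb p (q b) - y * emb p (q' b)) * emb p D⁻¹), ?_⟩
  rw [AddMonoidHom.prod_apply, map_add, map_add, rowForm_single, rowForm_single, rowForm_single,
    rowForm_single]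
  refine Prod.ext ?_ ?_
  · linear_combination (y : SAdele p) * hDD - y * emb p D⁻¹ * hDe
  · linear_combination (y' : SAdele p) * hDD - y' * emb p D⁻¹ * hDe

variable [∀ i, MeasurableSpace ℚ_[p i]] [∀ i, BorelSpace ℚ_[p i]]

theorem measurable_rowForm (q : Fin n → ZS p) : Measurable (rowForm q) := by
  change Measurable fun r : Fin n → SAdele p => ∑ b, r b * emb p (q b)
  fun_prop

/-- The box in `ℚ_S` with prescribed sides. -/
def boxSet (B : ∀ v, Set (SField p v)) : Set (SAdele p) := {x | ∀ v, x v ∈ B v}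

theorem measurableSet_boxSet {B : ∀ v, Set (SField p v)} (hB : ∀ v, MeasurableSet (B v)) :
    MeasurableSet (boxSet B) := by
  have : boxSet B = (univ.pi B : Set (∀ v, SField p v)) := by
    ext x; exact ⟨fun h v _ => h v, fun h v => h v (mem_univ v)⟩
  rw [this]
  exact MeasurableSet.univ_pi hB

theorem volume_boxSet (B : ∀ v, Set (SField p v)) : volume (boxSet B) = boxVol B := by
  have : boxSet B = (univ.pi B : Set (∀ v, SField p v)) := by
    ext x; exact ⟨fun h v _ => h v, fun h v => h v (mem_univ v)⟩
  rw [this]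
  exact volume_pi_pi B

/-- The number of `e` in `w + N ℤ_S` such that the form with coefficients `q` takes a value in the
box `B` after adding `e`. -/
def rowSum (N : ℕ) (B : ∀ v, Set (SField p v)) (q : Fin n → ZS p) (w : ℚ) (r : Fin n → SAdele p) :
    ℝ≥0∞ :=
  ∑' e : ZS p, (boxSet B).indicator 1 (rowForm q r + emb p (w + N * e))

theorem measurable_rowSum {N : ℕ} {B : ∀ v, Set (SField p v)} (hB : ∀ v, MeasurableSet (B v))
    (q : Fin n → ZS p) (w : ℚ) : Measurable (rowSum N B q w) :=
  Measurable.tsum fun _ => (measurable_one.indicator (measurableSet_boxSet hB)).comp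
    ((measurable_rowForm q).add_const _)

theorem exists_isTile_latt (hp : Function.Injective p) {N : ℕ} (hN : 0 < N)
    (hNS : Nat.Coprime N (∏ i, p i)) :
    ∃ T : Set (SAdele p), IsTile (latt p N) T ∧ volume T = N :=
  ⟨tileOne p N, isTile_tileOne hp hN hNS, volume_tileOne N⟩

theorem indicator_one_mul_eq_of_iff {X : Type*} {S T U : Set X} {x y z : X}
    (h : z ∈ U ↔ x ∈ S ∧ y ∈ T) :
    S.indicator (1 : X → ℝ≥0∞) x * T.indicator 1 y = U.indicator 1 z := by
  by_cases a1 : x ∈ S <;> by_cases a2 : y ∈ T <;> simp [indicator, h, a1, a2]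

section Expectation

variable (hp : Function.Injective p) {N : ℕ} (hN : 0 < N) (hNS : Nat.Coprime N (∏ i, p i))
  {F : Set (Fin n → SAdele p)} (hF : IsTile (AddMonoidHom.compLeft (latt p N) (Fin n)) F)
  (h0 : volume F ≠ 0) (htop : volume F ≠ ∞)
include hp hN hNS hF h0 htop

theorem lintegral_rowForm {q : Fin n → ZS p} (hq : q ≠ 0) {g : SAdele p → ℝ≥0∞}
    (hg : Measurable g) :
    ∫⁻ r, ∑' e : ZS p, g (rowForm q r + emb p (N * e)) ∂(ProbabilityTheory.cond volume F)
      = (N : ℝ≥0∞)⁻¹ * ∫⁻ x, g x := by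
  obtain ⟨T, hT, hv⟩ := exists_isTile_latt hp hN hNS
  rw [← hv]
  exact hF.lintegral_cond_unfolding h0 htop hT
    (by rw [hv]; exact_mod_cast hN.ne') (by rw [hv]; simp) (rowForm q) (measurable_rowForm q)
    (rowForm_surjective hq) (fun f => ⟨_, rowForm_latt q N f⟩) hg

theorem lintegral_rowSum {q : Fin n → ZS p} (hq : q ≠ 0) {B : ∀ v, Set (SField p v)}
    (hB : ∀ v, MeasurableSet (B v)) (w : ℚ) :
    ∫⁻ r, rowSum N B q w r ∂(ProbabilityTheory.cond volume F) = (N : ℝ≥0∞)⁻¹ * boxVol B := by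
  have h1 := lintegral_rowForm hp hN hNS hF h0 htop hq
    (g := fun x => (boxSet B).indicator 1 (x + emb p w))
    ((measurable_one.indicator (measurableSet_boxSet hB)).comp (measurable_add_const _))
  rw [lintegral_add_right_eq_self (fun x => (boxSet B).indicator (1 : SAdele p → ℝ≥0∞) x),
    lintegral_indicator_one (measurableSet_boxSet hB), volume_boxSet] at h1
  rw [← h1]
  refine lintegral_congr fun r => tsum_congr fun e => ?_
  rw [add_assoc, ← map_add, add_comm w]

theorem lintegral_rowSum_mul {q q' : Fin n → ZS p} {b b' : Fin n}
    (h : q b * q' b' ≠ q b' * q' b) {B B' : ∀ v, Set (SField p v)}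
    (hB : ∀ v, MeasurableSet (B v)) (hB' : ∀ v, MeasurableSet (B' v)) (w w' : ℚ) :
    ∫⁻ r, rowSum N B q w r * rowSum N B' q' w' r ∂(ProbabilityTheory.cond volume F)
      = ((N : ℝ≥0∞)⁻¹ * boxVol B) * ((N : ℝ≥0∞)⁻¹ * boxVol B') := by
  obtain ⟨T, hT, hv⟩ := exists_isTile_latt hp hN hNS
  have hv2 : ((volume : Measure (SAdele p)).prod volume) (T ×ˢ T) = (N : ℝ≥0∞) * N := by
    rw [Measure.prod_prod, hv]
  have hN0 : (N : ℝ≥0∞) ≠ 0 := by exact_mod_cast hN.ne'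
  have hg1 : ∀ {B : ∀ v, Set (SField p v)}, (∀ v, MeasurableSet (B v)) → ∀ w : ℚ,
      Measurable fun x : SAdele p => (boxSet B).indicator (1 : SAdele p → ℝ≥0∞) (x + emb p w) :=
    fun hB w => (measurable_one.indicator (measurableSet_boxSet hB)).comp (measurable_add_const _)
  have key := hF.lintegral_cond_unfolding (μ := volume) (ν := (volume : Measure (SAdele p)).prod volume) h0 htop (hT.prod hT)
    (by rw [hv2]; exact mul_ne_zero hN0 hN0)
    (by rw [hv2]; exact ENNReal.mul_ne_top (by simp) (by simp)) ((rowForm q).prod (rowForm q'))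
    ((measurable_rowForm q).prodMk (measurable_rowForm q')) (rowForm_prod_surjective h)
    (fun f => ⟨(_, _), Prod.ext (rowForm_latt q N f) (rowForm_latt q' N f)⟩)
    (g := fun x => (boxSet B).indicator 1 (x.1 + emb p w) * (boxSet B').indicator 1 (x.2 + emb p w'))
    (((hg1 hB w).comp measurable_fst).mul ((hg1 hB' w').comp measurable_snd))
  rw [hv2, lintegral_prod_mul (hg1 hB w).aemeasurable (hg1 hB' w').aemeasurable,
    lintegral_add_right_eq_self (fun x => (boxSet B).indicator (1 : SAdele p → ℝ≥0∞) x),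
    lintegral_add_right_eq_self (fun x => (boxSet B').indicator (1 : SAdele p → ℝ≥0∞) x),
    lintegral_indicator_one (measurableSet_boxSet hB), volume_boxSet,
    lintegral_indicator_one (measurableSet_boxSet hB'), volume_boxSet,
    ENNReal.mul_inv (Or.inl hN0) (Or.inl (by simp))] at key
  rw [mul_mul_mul_comm, ← key]
  refine lintegral_congr fun r => ?_
  rw [ENNReal.tsum_prod', rowSum, ← ENNReal.tsum_mul_right]
  refine tsum_congr fun e => ?_
  rw [rowSum, ← ENNReal.tsum_mul_left]
  refine tsum_congr fun e' => ?_
  have h1 : ∀ (q : Fin n → ZS p) (w : ℚ) (e : ZS p),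
      rowForm q r + latt p N e + emb p w = rowForm q r + emb p (w + N * e) := fun q w e => by
    rw [latt_apply, add_assoc, ← map_add, add_comm w]
  exact congrArg₂ (· * ·) (by rw [← h1]; rfl) (by rw [← h1]; rfl)

theorem lintegral_tsum_dependent {q0 q q' : Fin n → ZS p} (hq0 : q0 ≠ 0) {k l α β : ℤ}
    (hαβ : α * k + β * l = 1) (hq : ∀ b, q b = k * q0 b) (hq' : ∀ b, q' b = l * q0 b)
    {B B' : ∀ v, Set (SField p v)} (hB : ∀ v, MeasurableSet (B v))
    (hB' : ∀ v, MeasurableSet (B' v)) (w w' : ℚ) (wt : ℚ → ℝ≥0∞) :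
    ∫⁻ r, ∑' e : ZS p × ZS p, wt (l * (w + N * e.1) - k * (w' + N * e.2))
        * ((boxSet B).indicator 1 (rowForm q r + emb p (w + N * e.1))
        * (boxSet B').indicator 1 (rowForm q' r + emb p (w' + N * e.2)))
        ∂(ProbabilityTheory.cond volume F)
      = (N : ℝ≥0∞)⁻¹ * ∑' c : ZS p, wt (l * w - k * w' + N * c) *
        ∏ v, overlap (k : SField p v) l α β (B v) (B' v) (emb p (l * w - k * w' + N * c) v) := by
  have hαβ' : (α : ZS p) * k + β * l = 1 := by exact_mod_cast congrArg (Int.cast : ℤ → ZS p) hαβ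
  have hαβq : (α : ℚ) * k + β * l = 1 := by exact_mod_cast congrArg (Int.cast : ℤ → ℚ) hαβ
  let Ψ : ZS p × ZS p ≃ ZS p × ZS p :=
    { toFun := fun x => (β * x.1 + k * x.2, -α * x.1 + l * x.2)
      invFun := fun e => (l * e.1 - k * e.2, α * e.1 + β * e.2)
      left_inv := fun x => Prod.ext (by linear_combination x.1 * hαβ')
        (by linear_combination x.2 * hαβ')
      right_inv := fun x => Prod.ext (by linear_combination x.1 * hαβ')
        (by linear_combination x.2 * hαβ') }
  set S : ℚ → Set (SAdele p) := fun c => boxSet fun v =>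
    {z : SField p v | k * z + β * (c : SField p v) ∈ B v ∧
      l * z - α * (c : SField p v) ∈ B' v} with hSdef
  have hS : ∀ c, MeasurableSet (S c) := fun c => measurableSet_boxSet fun v =>
    (((measurable_const_mul _).add_const _) (hB v)).inter
      (((measurable_const_mul _).sub_const _) (hB' v))
  have hmeas : ∀ c, Measurable fun x : SAdele p =>
      (S c).indicator (1 : SAdele p → ℝ≥0∞) (x + emb p (α * w + β * w')) := fun c =>
    (measurable_one.indicator (hS c)).comp (measurable_add_const _)
  have h1 : ∀ r, (∑' e : ZS p × ZS p, wt (l * (w + N * e.1) - k * (w' + N * e.2))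
        * ((boxSet B).indicator 1 (rowForm q r + emb p (w + N * e.1))
        * (boxSet B').indicator 1 (rowForm q' r + emb p (w' + N * e.2))))
      = ∑' c : ZS p, wt (l * w - k * w' + N * c) * ∑' t : ZS p,
        (S (l * w - k * w' + N * c)).indicator (1 : SAdele p → ℝ≥0∞)
          (rowForm q0 r + emb p (N * t) + emb p (α * w + β * w')) := by
    intro r
    rw [← Ψ.tsum_eq, ENNReal.tsum_prod']
    refine tsum_congr fun c => ?_
    rw [← ENNReal.tsum_mul_left]
    refine tsum_congr fun t => ?_
    set C : ℚ := l * w - k * w' + N * c with hC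
    have e1 : ((Ψ (c, t)).1 : ℚ) = β * c + k * t := by simp [Ψ]
    have e2 : ((Ψ (c, t)).2 : ℚ) = -α * c + l * t := by simp [Ψ]
    rw [e1, e2, show (l : ℚ) * (w + N * (β * c + k * t)) - k * (w' + N * (-α * c + l * t)) = C by
      rw [hC]; linear_combination (N : ℚ) * c * hαβq]
    congr 1
    have hr : rowForm q r = emb p k * rowForm q0 r := by
      rw [show q = fun b => (k : ZS p) * q0 b from funext hq, rowForm_mul_left]
      simp
    have hr' : rowForm q' r = emb p l * rowForm q0 r := by
      rw [show q' = fun b => (l : ZS p) * q0 b from funext hq', rowForm_mul_left]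
      simp
    have f1 : rowForm q r + emb p (w + N * (β * c + k * t)) = emb p k *
        (rowForm q0 r + emb p (N * t) + emb p (α * w + β * w')) + emb p β * emb p C := by
      rw [hr, show w + N * (β * c + k * t) = k * (N * t) + k * (α * w + β * w') + β * C by
        rw [hC]; linear_combination -w * hαβq]
      simp only [map_add, map_mul]
      ring
    have f2 : rowForm q' r + emb p (w' + N * (-α * c + l * t)) = emb p l *
        (rowForm q0 r + emb p (N * t) + emb p (α * w + β * w')) - emb p α * emb p C := by
      rw [hr', show w' + N * (-α * c + l * t) = l * (N * t) + l * (α * w + β * w') - α * C by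
        rw [hC]; linear_combination -w' * hαβq]
      simp only [map_add, map_mul, map_sub]
      ring
    rw [f1, f2]
    set z := rowForm q0 r + emb p (N * t) + emb p (α * w + β * w')
    have hiff : z ∈ S C ↔ (emb p k * z + emb p β * emb p C ∈ boxSet B ∧
        emb p l * z - emb p α * emb p C ∈ boxSet B') := by
      have g1 : ∀ v, (emb p k * z + emb p β * emb p C) v
          = (k : SField p v) * z v + β * (C : SField p v) := fun v => by
        change ((k : ℚ) : SField p v) * z v + ((β : ℚ) : SField p v) * (C : SField p v) = _
        rw [Rat.cast_intCast, Rat.cast_intCast]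
      have g2 : ∀ v, (emb p l * z - emb p α * emb p C) v
          = (l : SField p v) * z v - α * (C : SField p v) := fun v => by
        change ((l : ℚ) : SField p v) * z v - ((α : ℚ) : SField p v) * (C : SField p v) = _
        rw [Rat.cast_intCast, Rat.cast_intCast]
      constructor
      · exact fun h => ⟨fun v => (g1 v).symm ▸ (h v).1, fun v => (g2 v).symm ▸ (h v).2⟩
      · exact fun h v => ⟨g1 v ▸ h.1 v, g2 v ▸ h.2 v⟩
    exact indicator_one_mul_eq_of_iff hiff
  have hm2 : ∀ (c : ℚ), Measurable fun r : Fin n → SAdele p => ∑' t : ZS p,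
        (S c).indicator (1 : SAdele p → ℝ≥0∞)
          (rowForm q0 r + emb p (N * t) + emb p (α * w + β * w')) := fun c =>
    Measurable.tsum fun t => (hmeas c).comp ((measurable_rowForm q0).add_const _)
  simp_rw [h1]
  rw [lintegral_tsum fun c => ((hm2 _).const_mul _).aemeasurable, ← ENNReal.tsum_mul_left]
  refine tsum_congr fun c => ?_
  rw [lintegral_const_mul _ (hm2 _),
    lintegral_rowForm hp hN hNS hF h0 htop hq0 (hmeas _),
    lintegral_add_right_eq_self (fun x => (S _).indicator (1 : SAdele p → ℝ≥0∞) x),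
    lintegral_indicator_one (hS _), hSdef, volume_boxSet, mul_left_comm]
  rfl

end Expectation

end

section

open Set
open scoped ENNReal NNReal

/-- The set of `x` with `‖x‖ ^ m ≤ c`, understood to be empty for `c ≤ 0`. -/
def sideOf {E : Type*} [Norm E] (m : ℕ) (c : ℝ) : Set E := {x | 0 < c ∧ ‖x‖ ^ m ≤ c}

theorem normLower_sideOf {E : Type*} [NormedAddCommGroup E] (m : ℕ) (c : ℝ) :
    NormLower (sideOf m c : Set E) := fun x _ hxy hy =>
  ⟨hy.1, (pow_le_pow_left₀ (norm_nonneg x) hxy m).trans hy.2⟩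

theorem lintegral_comp_mul_norm {n : ℕ} {M : ℝ} (hM : 0 < M) {h : ℝ → ℝ≥0∞} (hh : Measurable h) :
    ∫⁻ y : Fin n → ℝ, h (M * ‖y‖) = ENNReal.ofReal M⁻¹ ^ n * ∫⁻ y : Fin n → ℝ, h ‖y‖ := by
  have h1 : Measurable fun y : Fin n → ℝ => h ‖y‖ := hh.comp measurable_norm
  have h2 := lintegral_map (μ := volume) h1 (measurable_const_smul M)
  rw [Measure.map_addHaar_smul volume hM.ne', lintegral_smul_measure] at h2
  simp only [norm_smul, Real.norm_of_nonneg hM.le] at h2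
  rw [← h2, smul_eq_mul, abs_of_nonneg (by positivity), ← inv_pow,
    ENNReal.ofReal_pow (by positivity)]
  simp

/-- A scaling factor acting at the archimedean place only. -/
def archScale {s : ℕ} (M : ℝ) : Option (Fin s) → ℝ
  | none => M
  | some _ => 1

variable {s : ℕ} {p : Fin s → ℕ} [∀ i, Fact (p i).Prime] {n : ℕ}

/-- The component at a place of the diagonal embedding of a vector. -/
def placeVec (q : Fin n → ZS p) (v : Option (Fin s)) : Fin n → SField p v :=
  fun b => ((q b : ℚ) : SField p v)

theorem norm_placeVec_intMul (k : ℤ) (q0 q : Fin n → ZS p) (hq : ∀ b, q b = k * q0 b)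
    (v : Option (Fin s)) :
    ‖placeVec q v‖ = ‖(k : SField p v)‖ * ‖placeVec q0 v‖ := by
  rw [← norm_smul]
  congr 1
  ext b
  simp [placeVec, hq]

variable [∀ i, MeasurableSpace ℚ_[p i]] [∀ i, BorelSpace ℚ_[p i]]

variable (p) in
/-- The data defining the sets to be counted: the bounds for `‖A q + p‖ ^ m` at each place, as
functions of `‖q‖`. -/
structure Profile (m n : ℕ) where
  g : Option (Fin s) → ℝ → ℝ
  anti : ∀ v, Antitone (g v)
  nonneg : ∀ v t, 0 ≤ g v t
  le_one : ∀ v t, g v t ≤ 1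
  vol : ∀ v (y : Fin n → SField p v), volume (sideOf m (g v ‖y‖) : Set (SField p v)) ^ m
    = v.elim (2 ^ m) (fun _ => 1) * ENNReal.ofReal (g v ‖y‖)

namespace Profile

variable {m : ℕ} (φ : Profile p m n)

/-- The weight function at a place. -/
def G (v : Option (Fin s)) (y : Fin n → SField p v) : ℝ≥0∞ := ENNReal.ofReal (φ.g v ‖y‖)

/-- The integral of the weight at a place. -/
def W (v : Option (Fin s)) : ℝ≥0∞ := ∫⁻ y, φ.G v y

/-- The product of the local integrals. -/
def V : ℝ≥0∞ := ∏ v, φ.W v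

/-- The box attached to an integral vector. -/
def box (q : Fin n → ZS p) (v : Option (Fin s)) : Set (SField p v) :=
  sideOf m (φ.g v ‖placeVec q v‖)

/-- The weight of an integral vector. -/
def wt (q : Fin n → ZS p) : ℝ≥0∞ := ∏ v, φ.G v (placeVec q v)

theorem normAntitone_G (v : Option (Fin s)) : NormAntitone (φ.G v) := fun _ _ h =>
  ENNReal.ofReal_le_ofReal (φ.anti v h)

theorem normLower_box (q : Fin n → ZS p) (v : Option (Fin s)) : NormLower (φ.box q v) :=
  normLower_sideOf _ _

theorem measurableSet_box (q : Fin n → ZS p) (v : Option (Fin s)) : MeasurableSet (φ.box q v) :=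
  (φ.normLower_box q v).measurableSet

theorem prod_elim_const (m : ℕ) :
    ∏ v : Option (Fin s), v.elim (2 ^ m : ℝ≥0∞) (fun _ => 1) = 2 ^ m := by
  rw [Fintype.prod_option]; simp

theorem boxVol_box_pow (q : Fin n → ZS p) : boxVol (φ.box q) ^ m = 2 ^ m * φ.wt q := by
  rw [boxVol, ← Finset.prod_pow]
  unfold box
  rw [Finset.prod_congr rfl fun v _ => φ.vol v (placeVec q v),
    Finset.prod_mul_distrib, prod_elim_const]
  rfl

theorem wt_le_one (q : Fin n → ZS p) : φ.wt q ≤ 1 :=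
  Finset.prod_le_one' fun v _ => ENNReal.ofReal_le_one.2 (φ.le_one v _)

theorem volume_sideOf_ne_top (hm : 0 < m) (v) (y : Fin n → SField p v) :
    volume (sideOf m (φ.g v ‖y‖) : Set (SField p v)) ≠ ∞ := by
  intro h
  have h1 := φ.vol v y
  rw [h, ENNReal.top_pow hm.ne'] at h1
  refine ENNReal.mul_ne_top ?_ ENNReal.ofReal_ne_top h1.symm
  cases v <;> simp

/-- The weight of an integral vector after scaling the archimedean place by `M`. -/
def scaledWt (M : ℕ) (q : Fin n → ZS p) : ℝ≥0∞ :=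
  ∏ v, ENNReal.ofReal (φ.g v (archScale M v * ‖placeVec q v‖))

theorem archScale_nonneg (M : ℕ) : ∀ v : Option (Fin s), 0 ≤ archScale (M : ℝ) v
  | none => Nat.cast_nonneg M
  | some _ => zero_le_one

theorem lintegral_scale {M : ℕ} (hM : 0 < M) : ∀ v : Option (Fin s),
    ∫⁻ y : Fin n → SField p v, ENNReal.ofReal (φ.g v (archScale M v * ‖y‖))
      = ENNReal.ofReal (archScale M v)⁻¹ ^ n * φ.W v
  | some i => by simp [archScale, W, G]
  | none => by
    have hM' : (0 : ℝ) < M := by exact_mod_cast hM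
    have h := lintegral_comp_mul_norm (n := n) hM' (h := fun t => ENNReal.ofReal (φ.g none t))
      (ENNReal.measurable_ofReal.comp (φ.anti none).measurable)
    exact h

theorem tsum_scaledWt_le (hp : Function.Injective p) (hn : 0 < n) {M : ℕ} (hM : 0 < M) :
    ∑' q : {q : Fin n → ZS p // q ≠ 0}, φ.scaledWt M q.1
      ≤ 2 ^ n * ((M : ℝ≥0∞)⁻¹ ^ n * φ.V) := by
  have key := tsum_prod_ne_zero_le hp hn
    (G := fun v y => ENNReal.ofReal (φ.g v (archScale (M : ℝ) v * ‖y‖)))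
    (fun v x y h => ENNReal.ofReal_le_ofReal
      (φ.anti v (mul_le_mul_of_nonneg_left h (archScale_nonneg M v))))
    (fun _ _ => ENNReal.ofReal_ne_top)
  refine key.trans_eq ?_
  rw [Finset.prod_congr rfl fun v _ => φ.lintegral_scale hM v, Finset.prod_mul_distrib,
    Finset.prod_pow, Fintype.prod_option]
  simp only [archScale, inv_one, ENNReal.ofReal_one, Finset.prod_const_one, mul_one]
  rw [ENNReal.ofReal_inv_of_pos (by exact_mod_cast hM), ENNReal.ofReal_natCast]
  rfl

theorem overlap_zero_le {k l α β : ℤ} (hk : k ≠ 0) (hl : l ≠ 0) (hαβ : α * k + β * l = 1)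
    {q0 q q' : Fin n → ZS p} (hq : ∀ b, q b = k * q0 b) (hq' : ∀ b, q' b = l * q0 b) {M : ℕ}
    (hM : M = max k.natAbs l.natAbs) : ∀ v,
    overlap (k : SField p v) l α β (φ.box q v) (φ.box q' v) 0
      ≤ ENNReal.ofReal (archScale M v)⁻¹ *
        volume (sideOf m (φ.g v (archScale M v * ‖placeVec q0 v‖)) : Set (SField p v))
  | none => by
    rw [overlap_zero]
    have key : ∀ j : ℤ, j ≠ 0 → ∀ (q : Fin n → ZS p), (∀ b, q b = j * q0 b) → M = j.natAbs →
        volume {z : SField p none | (j : SField p none) * z ∈ φ.box q none} ≤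
        ENNReal.ofReal (archScale (M : ℝ) (none : Option (Fin s)))⁻¹ *
        volume (sideOf m (φ.g none (archScale (M : ℝ) (none : Option (Fin s)) * ‖placeVec q0 none‖))
          : Set (SField p none)) := by
      intro j hj q hq hMj
      have hMj' : (M : ℝ) = |(j : ℝ)| := by rw [hMj, Nat.cast_natAbs, Int.cast_abs]
      have h1 := Real.volume_preimage_mul_left (a := (j : ℝ)) (by exact_mod_cast hj)
        (φ.box q none)
      have h2 : φ.box q none = (sideOf m (φ.g none (archScale (M : ℝ) (none : Option (Fin s)) * ‖placeVec q0 none‖))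
          : Set (SField p none)) := by
        rw [box, norm_placeVec_intMul j q0 q hq]
        have : ‖(j : SField p none)‖ = archScale (M : ℝ) (none : Option (Fin s)) := hMj'.symm
        rw [this]
      rw [abs_inv, ← hMj'] at h1
      rw [← h2]
      exact h1.le
    rcases le_total k.natAbs l.natAbs with h | h
    · rw [max_eq_right h] at hM
      exact (measure_mono fun z hz => hz.2).trans (key l hl q' hq' hM)
    · rw [max_eq_left h] at hM
      exact (measure_mono fun z hz => hz.1).trans (key k hk q hq hM)
  | some i => by
    rw [overlap_zero]
    simp only [archScale, inv_one, ENNReal.ofReal_one, one_mul]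
    have key : ∀ j : ℤ, ‖(j : SField p (some i))‖ = 1 → ∀ (q : Fin n → ZS p),
        (∀ b, q b = j * q0 b) →
        volume {z : SField p (some i) | (j : SField p (some i)) * z ∈ φ.box q (some i)} ≤
        volume (sideOf m (φ.g (some i) ‖placeVec q0 (some i)‖) : Set (SField p (some i))) := by
      intro j hj q hq
      refine measure_mono fun z hz => ?_
      have h2 : φ.box q (some i) = (sideOf m (φ.g (some i) ‖placeVec q0 (some i)‖)
          : Set (SField p (some i))) := by
        rw [box, norm_placeVec_intMul j q0 q hq, hj, one_mul]
      rw [← h2]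
      exact φ.normLower_box q _ _ _ (by rw [norm_mul, hj, one_mul]) hz
    have hle : ∀ j : ℤ, ‖(j : SField p (some i))‖ ≤ 1 := fun j => Padic.norm_int_le_one j
    by_cases h1 : ‖(k : SField p (some i))‖ = 1
    · exact (measure_mono fun z hz => hz.1).trans (key k h1 q hq)
    · refine (measure_mono fun z hz => hz.2).trans (key l ((hle l).antisymm ?_) q' hq')
      by_contra! h2
      have h3 : ‖(α : SField p (some i)) * k + β * l‖ < 1 := by
        refine (IsUltrametricDist.norm_add_le_max _ _).trans_lt (max_lt ?_ ?_)
        · rw [norm_mul]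
          exact (mul_le_of_le_one_left (norm_nonneg _) (hle α)).trans_lt
            (lt_of_le_of_ne (hle k) h1)
        · rw [norm_mul]
          exact (mul_le_of_le_one_left (norm_nonneg _) (hle β)).trans_lt h2
      have h4 : (α : SField p (some i)) * k + β * l = 1 := by exact_mod_cast congrArg Int.cast hαβ
      rw [h4, norm_one] at h3
      exact lt_irrefl _ h3

theorem exists_norm_eq_archScale (M : ℕ) (q : Fin n → ZS p) : ∀ v,
    ∃ y : Fin n → SField p v, ‖y‖ = archScale M v * ‖placeVec q v‖
  | none => ⟨(M : SField p none) • placeVec q none, by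
      rw [norm_smul]
      congr 1
      exact (RCLike.norm_natCast (K := ℝ) M)⟩
  | some i => ⟨placeVec q (some i), by simp [archScale]⟩

theorem prod_overlap_zero_pow_le {k l α β : ℤ} (hk : k ≠ 0) (hl : l ≠ 0)
    (hαβ : α * k + β * l = 1)
    {q0 q q' : Fin n → ZS p} (hq : ∀ b, q b = k * q0 b) (hq' : ∀ b, q' b = l * q0 b) {M : ℕ}
    (hM : M = max k.natAbs l.natAbs) :
    (∏ v, overlap (k : SField p v) l α β (φ.box q v) (φ.box q' v) 0) ^ m
      ≤ 2 ^ m * ((M : ℝ≥0∞)⁻¹ ^ m * φ.scaledWt M q0) := by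
  have hM0 : 0 < M := by
    rw [hM]; exact lt_max_of_lt_left (Int.natAbs_pos.2 hk)
  have h1 : ∏ v, overlap (k : SField p v) l α β (φ.box q v) (φ.box q' v) 0
      ≤ (M : ℝ≥0∞)⁻¹ *
        ∏ v, volume (sideOf m (φ.g v (archScale M v * ‖placeVec q0 v‖)) : Set (SField p v)) := by
    refine (Finset.prod_le_prod' fun v _ => φ.overlap_zero_le hk hl hαβ hq hq' hM v).trans_eq ?_
    rw [Finset.prod_mul_distrib, Fintype.prod_option]
    simp only [archScale, inv_one, ENNReal.ofReal_one, Finset.prod_const_one, mul_one]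
    rw [ENNReal.ofReal_inv_of_pos (by exact_mod_cast hM0), ENNReal.ofReal_natCast]
  refine (pow_le_pow_left' h1 m).trans_eq ?_
  rw [mul_pow, ← Finset.prod_pow, mul_left_comm]
  congr 1
  have h2 : ∀ v, volume (sideOf m (φ.g v (archScale M v * ‖placeVec q0 v‖)) : Set (SField p v)) ^ m
      = v.elim (2 ^ m) (fun _ => 1) * ENNReal.ofReal (φ.g v (archScale M v * ‖placeVec q0 v‖)) := by
    intro v
    obtain ⟨y, hy⟩ := exists_norm_eq_archScale M q0 v
    rw [← hy, φ.vol v y]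
  rw [Finset.prod_congr rfl fun v _ => h2 v, Finset.prod_mul_distrib, prod_elim_const]
  rfl

end Profile

end

section

open Set
open scoped ENNReal NNReal

/-- Pairs of coprime nonzero integers. -/
abbrev CoprimePair : Type := {x : ℤ × ℤ // x.1 ≠ 0 ∧ x.2 ≠ 0 ∧ IsCoprime x.1 x.2}

/-- The height of a pair of coprime integers. -/
def CoprimePair.height (x : CoprimePair) : ℕ := max x.1.1.natAbs x.1.2.natAbs

theorem CoprimePair.height_pos (x : CoprimePair) : 0 < x.height :=
  lt_max_of_lt_left (Int.natAbs_pos.2 x.2.1)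

theorem CoprimePair.tsum_height_rpow_ne_top :
    ∑' x : CoprimePair, (x.height : ℝ≥0∞) ^ (-(5 / 2) : ℝ) ≠ ∞ := by
  have h1 : Summable fun x : Fin 2 → ℤ => ‖x‖ ^ (-(5 / 2) : ℝ) :=
    EisensteinSeries.summable_one_div_norm_rpow (by norm_num)
  let f : CoprimePair → Fin 2 → ℤ := fun x => ![x.1.1, x.1.2]
  have hf : Function.Injective f := fun x y h => by
    have h0 := congrFun h 0
    have h1 := congrFun h 1
    exact Subtype.ext (Prod.ext h0 h1)
  have h2 := (h1.comp_injective hf).tsum_ofReal_ne_top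
  refine ne_of_eq_of_ne (tsum_congr fun x => ?_) h2
  have h3 : ‖f x‖ = (x.height : ℝ) := by
    rw [EisensteinSeries.norm_eq_max_natAbs]
    rfl
  have h4 : (0 : ℝ) < x.height := by exact_mod_cast x.height_pos
  simp only [Function.comp_apply]
  rw [h3, ← ENNReal.ofReal_rpow_of_pos h4, ENNReal.ofReal_natCast]

variable {s : ℕ} {p : Fin s → ℕ} [∀ i, Fact (p i).Prime] {n : ℕ}

theorem exists_coprimePair_of_dependent {q q' : Fin n → ZS p} (hq : q ≠ 0) (hq' : q' ≠ 0)
    (h : ∀ b b', q b * q' b' = q b' * q' b) :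
    ∃ x : CoprimePair × {q0 : Fin n → ZS p // q0 ≠ 0},
      (∀ b, q b = x.1.1.1 * x.2.1 b) ∧ ∀ b, q' b = x.1.1.2 * x.2.1 b := by
  obtain ⟨b, hb⟩ := Function.ne_iff.1 hq
  have hb' : (q b : ℚ) ≠ 0 := fun h => hb (Subtype.ext h)
  set r : ℚ := q' b / q b with hr
  have hk0 : (r.den : ℤ) ≠ 0 := by exact_mod_cast r.den_nz
  have hkq : (r.den : ℚ) ≠ 0 := by exact_mod_cast r.den_nz
  have hrat : ∀ b', (r.den : ZS p) * q' b' = (r.num : ZS p) * q b' := fun b' => by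
    refine Subtype.ext ?_
    push_cast
    have h1 : (q b : ℚ) * q' b' = q b' * q' b := by exact_mod_cast congrArg Subtype.val (h b b')
    have h2 : (q' b' : ℚ) = r * q b' := by
      rw [hr, div_mul_eq_mul_div, eq_div_iff hb']; linarith
    rw [h2, ← mul_assoc, mul_comm (r.den : ℚ), Rat.mul_den_eq_num]
  have hr0 : r ≠ 0 := by
    intro hr0
    apply hq'
    ext b'
    have := hrat b'
    rw [hr0] at this
    simpa using this
  have hl0 : r.num ≠ 0 := Rat.num_ne_zero.2 hr0
  have hcop : IsCoprime (r.den : ℤ) r.num := by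
    rw [Int.isCoprime_iff_gcd_eq_one]
    have := r.reduced
    rw [Nat.coprime_comm] at this
    exact this
  obtain ⟨α, β, hαβ⟩ := id hcop
  have hαβ' : (α : ZS p) * r.den + β * r.num = 1 := by
    exact_mod_cast congrArg (Int.cast : ℤ → ZS p) hαβ
  have e1 : ∀ b', q b' = (r.den : ZS p) * (α * q b' + β * q' b') := fun b' => by
    linear_combination -(q b') * hαβ' - β * hrat b'
  have e2 : ∀ b', q' b' = (r.num : ZS p) * (α * q b' + β * q' b') := fun b' => by
    linear_combination -(q' b') * hαβ' + α * hrat b'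
  refine ⟨(⟨(r.den, r.num), hk0, hl0, hcop⟩, ⟨fun b' => α * q b' + β * q' b', fun h0 => hq ?_⟩),
    fun b' => ?_, fun b' => e2 b'⟩
  · ext b'
    rw [e1 b', congrFun h0 b']
    simp
  · simpa using e1 b'

variable [∀ i, MeasurableSpace ℚ_[p i]] [∀ i, BorelSpace ℚ_[p i]] {m : ℕ}

/-- `F` is a fundamental domain of positive finite measure for `(N ℤ_S)^n`. -/
def IsGoodTile (N : ℕ) (F : Set (Fin n → SAdele p)) : Prop :=
  IsTile (AddMonoidHom.compLeft (latt p N) (Fin n)) F ∧ volume F ≠ 0 ∧ volume F ≠ ∞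

theorem IsGoodTile.isProbabilityMeasure {N : ℕ} {F : Set (Fin n → SAdele p)}
    (hF : IsGoodTile N F) : IsProbabilityMeasure (ProbabilityTheory.cond volume F) :=
  ProbabilityTheory.cond_isProbabilityMeasure_of_finite hF.2.1 hF.2.2

/-- The product of the normalized measures on the tiles `F a`. -/
def tileMeasure (F : Fin m → Set (Fin n → SAdele p)) : Measure (Fin m → Fin n → SAdele p) :=
  Measure.pi fun a => ProbabilityTheory.cond volume (F a)

namespace Profile

variable (φ : Profile p m n)

/-- The number of solutions with coefficient vector `q`. -/
def hits (N : ℕ) (w : Fin m → ℚ) (q : Fin n → ZS p) (A : Fin m → Fin n → SAdele p) : ℝ≥0∞ :=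
  ∏ a, rowSum N (φ.box q) q (w a) (A a)

theorem measurable_hits (N : ℕ) (w : Fin m → ℚ) (q : Fin n → ZS p) :
    Measurable (φ.hits N w q) :=
  Finset.measurable_prod _ fun a _ =>
    (measurable_rowSum (φ.measurableSet_box q) q (w a)).comp (measurable_pi_apply a)

/-- The expected number of solutions with coefficient vector `q`. -/
def expHits (N : ℕ) (q : Fin n → ZS p) : ℝ≥0∞ := (2 / N) ^ m * φ.wt q

theorem expHits_eq (N : ℕ) (q : Fin n → ZS p) :
    φ.expHits N q = ((N : ℝ≥0∞)⁻¹ * boxVol (φ.box q)) ^ m := by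
  rw [mul_pow, φ.boxVol_box_pow, expHits, ENNReal.div_eq_inv_mul, mul_pow, mul_assoc]

section Moments

variable (hp : Function.Injective p) {N : ℕ} (hN : 0 < N) (hNS : Nat.Coprime N (∏ i, p i))
  {F : Fin m → Set (Fin n → SAdele p)} (hF : ∀ a, IsGoodTile N (F a)) (w : Fin m → ℚ)
include hF

theorem lintegral_hits_mul (q q' : Fin n → ZS p) :
    ∫⁻ A, φ.hits N w q A * φ.hits N w q' A ∂(tileMeasure F) = ∏ a, ∫⁻ r,
      rowSum N (φ.box q) q (w a) r * rowSum N (φ.box q') q' (w a) r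
        ∂(ProbabilityTheory.cond volume (F a)) := by
  have := fun a => (hF a).isProbabilityMeasure
  unfold hits tileMeasure
  simp_rw [← Finset.prod_mul_distrib]
  exact lintegral_pi_prod _ (fun a r =>
    rowSum N (φ.box q) q (w a) r * rowSum N (φ.box q') q' (w a) r) fun a =>
    (measurable_rowSum (φ.measurableSet_box q) q (w a)).mul
      (measurable_rowSum (φ.measurableSet_box q') q' (w a))

include hp hN hNS

theorem lintegral_hits {q : Fin n → ZS p} (hq : q ≠ 0) :
    ∫⁻ A, φ.hits N w q A ∂(tileMeasure F) = φ.expHits N q := by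
  have := fun a => (hF a).isProbabilityMeasure
  unfold hits tileMeasure
  rw [lintegral_pi_prod _ (fun a => rowSum N (φ.box q) q (w a)) fun a =>
    measurable_rowSum (φ.measurableSet_box q) q (w a)]
  rw [Finset.prod_congr rfl fun a _ => lintegral_rowSum hp hN hNS (hF a).1 (hF a).2.1 (hF a).2.2 hq
    (φ.measurableSet_box q) (w a), φ.expHits_eq]
  simp

theorem lintegral_hits_mul_of_independent {q q' : Fin n → ZS p} {b b' : Fin n}
    (h : q b * q' b' ≠ q b' * q' b) :
    ∫⁻ A, φ.hits N w q A * φ.hits N w q' A ∂(tileMeasure F)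
      = φ.expHits N q * φ.expHits N q' := by
  rw [φ.lintegral_hits_mul hF, φ.expHits_eq, φ.expHits_eq, ← mul_pow,
    Finset.prod_congr rfl fun a _ => lintegral_rowSum_mul hp hN hNS (hF a).1 (hF a).2.1 (hF a).2.2 h
    (φ.measurableSet_box q) (φ.measurableSet_box q') (w a) (w a)]
  simp

end Moments

theorem overlap_ne_top (hm : 0 < m) {k l α β : ℤ} (hk : k ≠ 0) (hl : l ≠ 0)
    (hαβ : α * k + β * l = 1) {q0 q q' : Fin n → ZS p} (hq : ∀ b, q b = k * q0 b)
    (hq' : ∀ b, q' b = l * q0 b) (v : Option (Fin s)) (c : SField p v) :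
    overlap (k : SField p v) l α β (φ.box q v) (φ.box q' v) c ≠ ∞ := by
  have hαβ' : (α : SField p v) * k + β * l = 1 := by
    exact_mod_cast congrArg (Int.cast : ℤ → SField p v) hαβ
  have h1 := normAntitone_overlap (v := v) (k := k) (l := l) (α := α) (β := β)
    (by exact_mod_cast hk) (by exact_mod_cast hl) hαβ' (φ.normLower_box q v)
    (φ.normLower_box q' v) 0 c (by simp)
  refine ne_top_of_le_ne_top ?_ (h1.trans (φ.overlap_zero_le hk hl hαβ hq hq' rfl v))
  obtain ⟨y, hy⟩ := exists_norm_eq_archScale (max k.natAbs l.natAbs) q0 v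
  rw [← hy]
  exact ENNReal.mul_ne_top ENNReal.ofReal_ne_top (φ.volume_sideOf_ne_top hm v y)

theorem lintegral_overlap_box {k l α β : ℤ} (hk : k ≠ 0)
    (hαβ : α * k + β * l = 1) (q q' : Fin n → ZS p) :
    ∏ v, ∫⁻ c, overlap (k : SField p v) l α β (φ.box q v) (φ.box q' v) c
      = boxVol (φ.box q) * boxVol (φ.box q') := by
  rw [boxVol, boxVol, ← Finset.prod_mul_distrib]
  refine Finset.prod_congr rfl fun v _ => lintegral_overlap (by exact_mod_cast hk) ?_
    (φ.measurableSet_box q v) (φ.measurableSet_box q' v)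
  exact_mod_cast congrArg (Int.cast : ℤ → SField p v) hαβ

theorem lintegral_rowSum_mul_le (hp : Function.Injective p) {N : ℕ} (hN : 0 < N)
    (hNS : Nat.Coprime N (∏ i, p i)) (hm : 0 < m)
    {F : Set (Fin n → SAdele p)} (hF : IsGoodTile N F) (w : ℚ)
    {k l α β : ℤ} (hk : k ≠ 0) (hl : l ≠ 0) (hαβ : α * k + β * l = 1)
    {q0 q q' : Fin n → ZS p} (hq0 : q0 ≠ 0) (hq : ∀ b, q b = k * q0 b)
    (hq' : ∀ b, q' b = l * q0 b) :
    ∫⁻ r, rowSum N (φ.box q) q w r * rowSum N (φ.box q') q' w r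
        ∂(ProbabilityTheory.cond volume F)
      ≤ ((N : ℝ≥0∞)⁻¹ * boxVol (φ.box q)) * ((N : ℝ≥0∞)⁻¹ * boxVol (φ.box q'))
        + ∏ v, overlap (k : SField p v) l α β (φ.box q v) (φ.box q' v) 0 := by
  have h1 := lintegral_tsum_dependent hp hN hNS hF.1 hF.2.1 hF.2.2 hq0 hαβ hq hq'
    (φ.measurableSet_box q) (φ.measurableSet_box q') w w (fun _ => 1)
  have h2 : ∀ r, (∑' e : ZS p × ZS p, (1 : ℝ≥0∞)
        * ((boxSet (φ.box q)).indicator 1 (rowForm q r + emb p (w + N * e.1))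
        * (boxSet (φ.box q')).indicator 1 (rowForm q' r + emb p (w + N * e.2))))
      = rowSum N (φ.box q) q w r * rowSum N (φ.box q') q' w r := by
    intro r
    rw [ENNReal.tsum_prod', rowSum, ← ENNReal.tsum_mul_right]
    refine tsum_congr fun e => ?_
    rw [rowSum, ← ENNReal.tsum_mul_left]
    exact tsum_congr fun e' => one_mul _
  simp_rw [h2] at h1
  rw [h1]
  simp only [one_mul]
  have h3 := tsum_prod_coset_one_le hp hN hNS
    (ω := fun v => overlap (k : SField p v) l α β (φ.box q v) (φ.box q' v))
    (fun v => normAntitone_overlap (by exact_mod_cast hk) (by exact_mod_cast hl)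
      (by exact_mod_cast congrArg (Int.cast : ℤ → SField p v) hαβ) (φ.normLower_box q v)
      (φ.normLower_box q' v))
    (φ.overlap_ne_top hm hk hl hαβ hq hq') (l * w - k * w)
  rw [φ.lintegral_overlap_box hk hαβ] at h3
  have hN1 : (N : ℝ≥0∞)⁻¹ ≤ 1 := ENNReal.inv_le_one.2 (by exact_mod_cast hN)
  calc _ ≤ (N : ℝ≥0∞)⁻¹ * _ := mul_le_mul_right h3 _
    _ = (N : ℝ≥0∞)⁻¹ * (boxVol (φ.box q) * boxVol (φ.box q') / N)
      + (N : ℝ≥0∞)⁻¹ * ∏ v, overlap (k : SField p v) l α β (φ.box q v) (φ.box q' v) 0 :=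
        mul_add _ _ _
    _ ≤ _ := by
        refine add_le_add (le_of_eq ?_) (mul_le_of_le_one_left' hN1)
        rw [div_eq_mul_inv]
        ring

end Profile

end

section

open Set
open scoped ENNReal NNReal

variable {s : ℕ} {p : Fin s → ℕ} [∀ i, Fact (p i).Prime] {m n : ℕ}
  [∀ i, MeasurableSpace ℚ_[p i]] [∀ i, BorelSpace ℚ_[p i]]

namespace Profile

variable (φ : Profile p m n)

/-- The number of solutions with coefficient vector in `Q`. -/
def count (N : ℕ) (w : Fin m → ℚ) (Q : Set (Fin n → ZS p)) (A : Fin m → Fin n → SAdele p) :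
    ℝ≥0∞ := ∑' q : Q, φ.hits N w q.1 A

/-- The expected number of solutions with coefficient vector in `Q`. -/
def mean (N : ℕ) (Q : Set (Fin n → ZS p)) : ℝ≥0∞ := ∑' q : Q, φ.expHits N q.1

theorem measurable_count (N : ℕ) (w : Fin m → ℚ) (Q : Set (Fin n → ZS p)) :
    Measurable (φ.count N w Q) :=
  Measurable.tsum fun q => φ.measurable_hits N w q.1

/-- The contribution to the second moment of the pairs `(k q₀, l q₀)`. -/
def diagTerm (x : CoprimePair × {q0 : Fin n → ZS p // q0 ≠ 0}) : ℝ≥0∞ :=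
  2 ^ m * ((x.1.height : ℝ≥0∞)⁻¹ ^ m * φ.scaledWt x.1.height x.2.1)

/-- The pair `(k q₀, l q₀)`. -/
def multiples (x : CoprimePair × {q0 : Fin n → ZS p // q0 ≠ 0}) :
    (Fin n → ZS p) × (Fin n → ZS p) :=
  (fun b => x.1.1.1 * x.2.1 b, fun b => x.1.1.2 * x.2.1 b)

open Classical in
/-- The diagonal contribution of a pair of vectors. -/
def diagSum (z : (Fin n → ZS p) × (Fin n → ZS p)) : ℝ≥0∞ :=
  ∑' x, if z = multiples x then φ.diagTerm x else 0

theorem tsum_diagSum : ∑' z, φ.diagSum z = ∑' x, φ.diagTerm x := by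
  unfold diagSum
  rw [ENNReal.tsum_comm]
  exact tsum_congr fun x => tsum_ite_eq _ _

theorem tsum_diagTerm_le (hp : Function.Injective p) (hn : 0 < n) :
    ∑' x, φ.diagTerm x ≤ ∑' x : CoprimePair,
      2 ^ (m + n) * ((x.height : ℝ≥0∞)⁻¹ ^ (m + n) * φ.V) := by
  rw [ENNReal.tsum_prod']
  refine ENNReal.tsum_le_tsum fun x => ?_
  unfold diagTerm
  dsimp only
  rw [ENNReal.tsum_mul_left, ENNReal.tsum_mul_left]
  calc _ ≤ 2 ^ m * ((x.height : ℝ≥0∞)⁻¹ ^ m * (2 ^ n * ((x.height : ℝ≥0∞)⁻¹ ^ n * φ.V))) := by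
        gcongr
        exact φ.tsum_scaledWt_le hp hn x.height_pos
    _ = _ := by ring

section Moments

variable (hp : Function.Injective p) {N : ℕ} (hN : 0 < N) (hNS : Nat.Coprime N (∏ i, p i))
  {F : Fin m → Set (Fin n → SAdele p)} (hF : ∀ a, IsGoodTile N (F a)) (w : Fin m → ℚ)
include hp hN hNS hF

theorem lintegral_count {Q : Set (Fin n → ZS p)} (hQ : (0 : Fin n → ZS p) ∉ Q) :
    ∫⁻ A, φ.count N w Q A ∂(tileMeasure F) = φ.mean N Q := by
  have h1 := lintegral_tsum (μ := tileMeasure F) (f := fun q : Q => φ.hits N w q.1)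
    fun q => (φ.measurable_hits N w q.1).aemeasurable
  refine h1.trans ?_
  exact tsum_congr fun q => φ.lintegral_hits hp hN hNS hF w fun h => hQ (h ▸ q.2)

theorem lintegral_hits_mul_le (hm : 0 < m) {q q' : Fin n → ZS p} (hq : q ≠ 0) (hq' : q' ≠ 0)
    {δ : ℝ} (hδ : 0 < δ) :
    ∫⁻ A, φ.hits N w q A * φ.hits N w q' A ∂(tileMeasure F)
      ≤ ENNReal.ofReal (1 + δ) ^ m * (φ.expHits N q * φ.expHits N q')
        + ENNReal.ofReal (1 + δ⁻¹) ^ m * φ.diagSum (q, q') := by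
  by_cases h : ∀ b b', q b * q' b' = q b' * q' b
  · obtain ⟨x, hx, hx'⟩ := exists_coprimePair_of_dependent hq hq' h
    obtain ⟨α, β, hαβ⟩ := id x.1.2.2.2
    have h1 : φ.diagTerm x ≤ φ.diagSum (q, q') := by
      have h2 : (q, q') = multiples x := Prod.ext (funext hx) (funext hx')
      have h3 := ENNReal.le_tsum (f := fun y => open Classical in
        if (q, q') = multiples y then φ.diagTerm y else 0) x
      rw [if_pos h2] at h3
      exact h3
    rw [φ.lintegral_hits_mul hF]
    have h4 := fun a => φ.lintegral_rowSum_mul_le hp hN hNS hm (hF a) (w a) x.1.2.1 x.1.2.2.1 hαβ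
      x.2.2 hx hx'
    refine (Finset.prod_le_prod' fun a _ => h4 a).trans ?_
    rw [Finset.prod_const, Finset.card_univ, Fintype.card_fin]
    refine (ENNReal.add_pow_le_of_pos _ _ m hδ).trans ?_
    rw [φ.expHits_eq, φ.expHits_eq, mul_pow ((N : ℝ≥0∞)⁻¹ * boxVol (φ.box q))]
    refine add_le_add le_rfl (mul_le_mul' le_rfl ?_)
    exact (φ.prod_overlap_zero_pow_le x.1.2.1 x.1.2.2.1 hαβ hx hx' rfl).trans h1
  · push Not at h
    obtain ⟨b, b', h⟩ := h
    rw [φ.lintegral_hits_mul_of_independent hp hN hNS hF w h]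
    refine le_add_right (le_mul_of_one_le_left' (one_le_pow_of_one_le' ?_ m))
    exact ENNReal.one_le_ofReal.2 (by linarith)

theorem lintegral_count_sq_le (hm : 0 < m) {Q : Set (Fin n → ZS p)}
    (hQ : (0 : Fin n → ZS p) ∉ Q) {δ : ℝ} (hδ : 0 < δ) :
    ∫⁻ A, φ.count N w Q A ^ 2 ∂(tileMeasure F)
      ≤ ENNReal.ofReal (1 + δ) ^ m * φ.mean N Q ^ 2
        + ENNReal.ofReal (1 + δ⁻¹) ^ m * ∑' x, φ.diagTerm x := by
  have h1 : ∀ A, φ.count N w Q A ^ 2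
      = ∑' z : Q × Q, φ.hits N w z.1.1 A * φ.hits N w z.2.1 A := fun A => by
    rw [ENNReal.tsum_prod', sq, count, ← ENNReal.tsum_mul_right]
    exact tsum_congr fun q => ENNReal.tsum_mul_left.symm
  have h2 : φ.mean N Q ^ 2 = ∑' z : Q × Q, φ.expHits N z.1.1 * φ.expHits N z.2.1 := by
    rw [ENNReal.tsum_prod', sq, mean, ← ENNReal.tsum_mul_right]
    exact tsum_congr fun q => ENNReal.tsum_mul_left.symm
  have hne : ∀ q : Q, q.1 ≠ 0 := fun q h => hQ (h ▸ q.2)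
  simp_rw [h1]
  have h3 := lintegral_tsum (μ := tileMeasure F)
    (f := fun (z : Q × Q) A => φ.hits N w z.1.1 A * φ.hits N w z.2.1 A) fun z =>
    ((φ.measurable_hits N w z.1.1).mul (φ.measurable_hits N w z.2.1)).aemeasurable
  refine h3.le.trans ?_
  rw [h2]
  calc _ ≤ ∑' z : Q × Q, (ENNReal.ofReal (1 + δ) ^ m * (φ.expHits N z.1.1 * φ.expHits N z.2.1)
        + ENNReal.ofReal (1 + δ⁻¹) ^ m * φ.diagSum (z.1.1, z.2.1)) :=
        ENNReal.tsum_le_tsum fun z =>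
          φ.lintegral_hits_mul_le hp hN hNS hF w hm (hne z.1) (hne z.2) hδ
    _ = ENNReal.ofReal (1 + δ) ^ m * (∑' z : Q × Q, φ.expHits N z.1.1 * φ.expHits N z.2.1)
        + ENNReal.ofReal (1 + δ⁻¹) ^ m * ∑' z : Q × Q, φ.diagSum (z.1.1, z.2.1) := by
        rw [ENNReal.tsum_add, ENNReal.tsum_mul_left, ENNReal.tsum_mul_left]
    _ ≤ _ := by
        gcongr
        rw [← φ.tsum_diagSum]
        exact ENNReal.tsum_comp_le_tsum_of_injective (f := fun z : Q × Q => (z.1.1, z.2.1))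
          (fun x y h => Prod.ext (Subtype.ext (congrArg Prod.fst h))
            (Subtype.ext (congrArg Prod.snd h))) φ.diagSum

end Moments

end Profile

end

section

open Set
open scoped ENNReal NNReal

theorem ENNReal.tsum_ite_le_of_subsingleton {ι : Type*} (P : ι → Prop) [DecidablePred P]
    (hP : ∀ i j, P i → P j → i = j) (c : ℝ≥0∞) : ∑' i, (if P i then c else 0) ≤ c := by
  classical
  by_cases h : ∃ i, P i
  · obtain ⟨i, hi⟩ := h
    calc _ ≤ ∑' j, (if j = i then c else 0) := by
          refine ENNReal.tsum_le_tsum fun j => ?_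
          split_ifs with h1 h2 <;> first | exact le_rfl | exact zero_le | exact absurd (hP _ _ h1 hi) h2
      _ = c := tsum_ite_eq _ _
  · push Not at h
    simp [h]

variable {s : ℕ} {p : Fin s → ℕ} [∀ i, Fact (p i).Prime] {m n : ℕ}

theorem norm_intCast_eq_one_or_of_coprime {k l α β : ℤ} (hαβ : α * k + β * l = 1) (i : Fin s) :
    ‖(k : ℚ_[p i])‖ = 1 ∨ ‖(l : ℚ_[p i])‖ = 1 := by
  have hle : ∀ j : ℤ, ‖(j : ℚ_[p i])‖ ≤ 1 := fun j => Padic.norm_int_le_one j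
  by_contra! h
  have h3 : ‖(α : ℚ_[p i]) * k + β * l‖ < 1 := by
    refine (IsUltrametricDist.norm_add_le_max _ _).trans_lt (max_lt ?_ ?_)
    · rw [norm_mul]
      exact (mul_le_of_le_one_left (norm_nonneg _) (hle α)).trans_lt (lt_of_le_of_ne (hle k) h.1)
    · rw [norm_mul]
      exact (mul_le_of_le_one_left (norm_nonneg _) (hle β)).trans_lt (lt_of_le_of_ne (hle l) h.2)
  have h4 : (α : ℚ_[p i]) * k + β * l = 1 := by exact_mod_cast congrArg Int.cast hαβ
  rw [h4, norm_one] at h3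
  exact lt_irrefl _ h3

variable [∀ i, MeasurableSpace ℚ_[p i]] [∀ i, BorelSpace ℚ_[p i]]

namespace Profile

variable (φ : Profile p m n)

/-- The box attached to an integral vector, with the archimedean place rescaled by `M`. -/
def scaledBox (M : ℕ) (q : Fin n → ZS p) (v : Option (Fin s)) : Set (SField p v) :=
  {x | 0 < φ.g v (archScale M v * ‖placeVec q v‖) ∧
    (archScale M v * ‖x‖) ^ m ≤ φ.g v (archScale M v * ‖placeVec q v‖)}

theorem normLower_scaledBox (M : ℕ) (q : Fin n → ZS p) (v : Option (Fin s)) :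
    NormLower (φ.scaledBox M q v) := fun x _ hxy hy =>
  ⟨hy.1, (pow_le_pow_left₀ (mul_nonneg (archScale_nonneg M v) (norm_nonneg x))
    (mul_le_mul_of_nonneg_left hxy (archScale_nonneg M v)) m).trans hy.2⟩

theorem measurableSet_scaledBox (M : ℕ) (q : Fin n → ZS p) (v : Option (Fin s)) :
    MeasurableSet (φ.scaledBox M q v) :=
  (φ.normLower_scaledBox M q v).measurableSet

theorem volume_scaledBox {M : ℕ} (hM : 0 < M) (q : Fin n → ZS p) : ∀ v,
    volume (φ.scaledBox M q v) = ENNReal.ofReal (archScale M v)⁻¹ *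
      volume (sideOf m (φ.g v (archScale M v * ‖placeVec q v‖)) : Set (SField p v))
  | some i => by
    simp only [archScale, inv_one, ENNReal.ofReal_one, one_mul, scaledBox, sideOf]
  | none => by
    have hM' : (0 : ℝ) < M := by exact_mod_cast hM
    have h1 := Real.volume_preimage_mul_left (a := (M : ℝ)) hM'.ne'
      (sideOf m (φ.g none (archScale (M : ℝ) (none : Option (Fin s)) * ‖placeVec q none‖)))
    rw [abs_inv, abs_of_pos hM'] at h1
    refine Eq.trans (congrArg _ ?_) h1
    ext x
    have h2 : ∀ y : ℝ, ‖(M : ℝ) * y‖ = M * ‖y‖ := fun y => by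
      rw [norm_mul, Real.norm_of_nonneg hM'.le]
    have h3 := h2 x
    constructor
    · rintro ⟨ha, hb⟩
      refine ⟨ha, ?_⟩
      rw [h3]; exact hb
    · rintro ⟨ha, hb⟩
      refine ⟨ha, ?_⟩
      rw [h3] at hb; exact hb

theorem boxVol_scaledBox_pow {M : ℕ} (hM : 0 < M) (q : Fin n → ZS p) :
    boxVol (φ.scaledBox M q) ^ m = 2 ^ m * ((M : ℝ≥0∞)⁻¹ ^ m * φ.scaledWt M q) := by
  have h2 : ∀ v, volume (sideOf m (φ.g v (archScale M v * ‖placeVec q v‖)) : Set (SField p v)) ^ m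
      = v.elim (2 ^ m) (fun _ => 1) * ENNReal.ofReal (φ.g v (archScale M v * ‖placeVec q v‖)) := by
    intro v
    obtain ⟨y, hy⟩ := exists_norm_eq_archScale M q v
    rw [← hy, φ.vol v y]
  have h3 : ∏ v : Option (Fin s), ENNReal.ofReal (archScale (M : ℝ) v)⁻¹ = (M : ℝ≥0∞)⁻¹ := by
    rw [Fintype.prod_option]
    simp only [archScale, inv_one, ENNReal.ofReal_one, Finset.prod_const_one, mul_one]
    rw [ENNReal.ofReal_inv_of_pos (by exact_mod_cast hM), ENNReal.ofReal_natCast]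
  rw [boxVol, Finset.prod_congr rfl fun v _ => φ.volume_scaledBox hM q v, Finset.prod_mul_distrib,
    h3, mul_pow, ← Finset.prod_pow, mul_left_comm, Finset.prod_congr rfl fun v _ => h2 v,
    Finset.prod_mul_distrib, prod_elim_const]
  rfl

theorem mem_scaledBox {k l α β : ℤ} (hαβ : α * k + β * l = 1)
    {q0 q q' : Fin n → ZS p} (hq : ∀ b, q b = k * q0 b) (hq' : ∀ b, q' b = l * q0 b) {D : ℕ}
    (hD : D ≤ max k.natAbs l.natAbs) : ∀ {v} {z : SField p v}, (k : SField p v) * z ∈ φ.box q v →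
    (l : SField p v) * z ∈ φ.box q' v → z ∈ φ.scaledBox (max k.natAbs D) q0 v
  | none, z => by
    intro h1 h2
    have key : ∀ j : ℤ, ∀ (q : Fin n → ZS p), (∀ b, q b = j * q0 b) →
        max k.natAbs D ≤ j.natAbs → (j : SField p none) * z ∈ φ.box q none →
        z ∈ φ.scaledBox (max k.natAbs D) q0 none := by
      intro j q hq hj h
      have e1 : ‖(j : SField p none)‖ = (j.natAbs : ℝ) :=
        (Int.norm_eq_abs j).trans (by rw [Nat.cast_natAbs, Int.cast_abs])
      have hj' : ((max k.natAbs D : ℕ) : ℝ) ≤ j.natAbs := by exact_mod_cast hj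
      obtain ⟨ha, hb⟩ := h
      rw [norm_placeVec_intMul j q0 q hq, e1] at ha hb
      rw [norm_mul, e1] at hb
      have hg := φ.anti none (mul_le_mul_of_nonneg_right hj' (norm_nonneg (placeVec q0 none)))
      refine ⟨ha.trans_le hg, le_trans ?_ (hb.trans hg)⟩
      exact pow_le_pow_left₀ (mul_nonneg (Nat.cast_nonneg _) (norm_nonneg z))
        (mul_le_mul_of_nonneg_right hj' (norm_nonneg z)) m
    rcases le_total k.natAbs l.natAbs with h | h
    · rw [max_eq_right h] at hD
      exact key l q' hq' (max_le h hD) h2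
    · rw [max_eq_left h] at hD
      exact key k q hq (max_le le_rfl hD) h1
  | some i, z => by
    intro h1 h2
    have key : ∀ j : ℤ, ‖(j : SField p (some i))‖ = 1 → ∀ (q : Fin n → ZS p),
        (∀ b, q b = j * q0 b) → (j : SField p (some i)) * z ∈ φ.box q (some i) →
        z ∈ φ.scaledBox (max k.natAbs D) q0 (some i) := by
      intro j hj q hq hz
      obtain ⟨ha, hb⟩ := hz
      rw [norm_placeVec_intMul j q0 q hq, hj] at ha hb
      rw [norm_mul, hj] at hb
      exact ⟨ha, hb⟩
    rcases norm_intCast_eq_one_or_of_coprime (p := p) hαβ i with h | h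
    · exact key k h q hq h1
    · exact key l h q' hq' h2

end Profile

end

section

open Set
open scoped ENNReal NNReal

variable {s : ℕ} {p : Fin s → ℕ} [∀ i, Fact (p i).Prime] {n : ℕ}
  [∀ i, MeasurableSpace ℚ_[p i]] [∀ i, BorelSpace ℚ_[p i]]

theorem measurable_indicator_rowForm {B : ∀ v, Set (SField p v)} (hB : ∀ v, MeasurableSet (B v))
    (q : Fin n → ZS p) (y : ℚ) : Measurable fun r : Fin n → SAdele p =>
      ((boxSet B).indicator 1 (rowForm q r + emb p y) : ℝ≥0∞) :=
  (measurable_one.indicator (measurableSet_boxSet hB)).comp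
    ((measurable_rowForm q).add_const _)

namespace Profile

variable (φ : Profile p 1 n)

/-- The indicator of the event that `(q, y)` is a solution. -/
def hit (q : Fin n → ZS p) (y : ℚ) (r : Fin n → SAdele p) : ℝ≥0∞ :=
  (boxSet (φ.box q)).indicator 1 (rowForm q r + emb p y)

theorem measurable_hit (q : Fin n → ZS p) (y : ℚ) : Measurable (φ.hit q y) :=
  measurable_indicator_rowForm (φ.measurableSet_box q) q y

/-- The indicator of the event that `(q₀, y₀)` is a solution which has too many multiples that are
solutions, among them possibly its multiple by `k`. -/
def excTerm (D : ℕ) (x : {k : ℤ // k ≠ 0} × {q0 : Fin n → ZS p // q0 ≠ 0} × ZS p)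
    (r : Fin n → SAdele p) : ℝ≥0∞ :=
  (boxSet (φ.scaledBox (max x.1.1.natAbs D) x.2.1.1)).indicator 1
    (rowForm x.2.1.1 r + emb p x.2.2)

theorem measurable_excTerm (D : ℕ)
    (x : {k : ℤ // k ≠ 0} × {q0 : Fin n → ZS p // q0 ≠ 0} × ZS p) :
    Measurable (φ.excTerm D x) :=
  measurable_indicator_rowForm (φ.measurableSet_scaledBox _ _) _ _

/-- The total number of exceptional solutions. -/
def excess (D : ℕ) (r : Fin n → SAdele p) : ℝ≥0∞ := ∑' x, φ.excTerm D x r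

theorem measurable_excess (D : ℕ) : Measurable (φ.excess D) :=
  Measurable.tsum fun x => φ.measurable_excTerm D x

open Classical in
/-- The number of times the solution `(q, y)` is counted as an exceptional solution. -/
def exc (D : ℕ) (q : Fin n → ZS p) (y : ℚ) (r : Fin n → SAdele p) : ℝ≥0∞ :=
  ∑' x : {k : ℤ // k ≠ 0} × {q0 : Fin n → ZS p // q0 ≠ 0} × ZS p,
    if (∀ b, q b = x.1.1 * x.2.1.1 b) ∧ y = x.1.1 * x.2.2 then φ.excTerm D x r else 0

theorem measurable_exc (D : ℕ) (q : Fin n → ZS p) (y : ℚ) : Measurable (φ.exc D q y) := by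
  refine Measurable.tsum fun x => ?_
  split_ifs
  · exact φ.measurable_excTerm D x
  · exact measurable_const

/-- The number of solutions that are not exceptional. -/
def trimmed (N : ℕ) (w : ℚ) (Q : Set (Fin n → ZS p)) (D : ℕ) (r : Fin n → SAdele p) : ℝ≥0∞ :=
  ∑' z : Q × ZS p, φ.hit z.1.1 (w + N * z.2) r * (1 - φ.exc D z.1.1 (w + N * z.2) r)

theorem measurable_trimmed (N : ℕ) (w : ℚ) (Q : Set (Fin n → ZS p)) (D : ℕ) :
    Measurable (φ.trimmed N w Q D) :=
  Measurable.tsum fun _ => (φ.measurable_hit _ _).mul (measurable_const.sub (φ.measurable_exc _ _ _))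

theorem tsum_rowSum_eq (N : ℕ) (w : ℚ) (Q : Set (Fin n → ZS p)) (r : Fin n → SAdele p) :
    ∑' q : Q, rowSum N (φ.box q.1) q.1 w r = ∑' z : Q × ZS p, φ.hit z.1.1 (w + N * z.2) r := by
  rw [ENNReal.tsum_prod']
  rfl

theorem trimmed_le (N : ℕ) (w : ℚ) (Q : Set (Fin n → ZS p)) (D : ℕ) (r : Fin n → SAdele p) :
    φ.trimmed N w Q D r ≤ ∑' q : Q, rowSum N (φ.box q.1) q.1 w r := by
  rw [tsum_rowSum_eq]
  exact ENNReal.tsum_le_tsum fun z => mul_le_of_le_one_right' tsub_le_self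

theorem tsum_exc_le {N : ℕ} (hN : 0 < N) (w : ℚ) (Q : Set (Fin n → ZS p)) (D : ℕ)
    (r : Fin n → SAdele p) :
    ∑' z : Q × ZS p, φ.exc D z.1.1 (w + N * z.2) r ≤ φ.excess D r := by
  classical
  unfold exc excess
  rw [ENNReal.tsum_comm]
  refine ENNReal.tsum_le_tsum fun x => ?_
  have hN' : (N : ℚ) ≠ 0 := by exact_mod_cast hN.ne'
  convert ENNReal.tsum_ite_le_of_subsingleton (fun z : Q × ZS p =>
    (∀ b, z.1.1 b = x.1.1 * x.2.1.1 b) ∧ (w + N * z.2 : ℚ) = x.1.1 * x.2.2) ?_ (φ.excTerm D x r)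
  rintro z z' ⟨h1, h2⟩ ⟨h3, h4⟩
  refine Prod.ext (Subtype.ext (funext fun b => (h1 b).trans (h3 b).symm)) (Subtype.ext ?_)
  have h5 : (N : ℚ) * z.2 = N * z'.2 := by linarith
  exact mul_left_cancel₀ hN' h5

theorem tsum_rowSum_le {N : ℕ} (hN : 0 < N) (w : ℚ) (Q : Set (Fin n → ZS p)) (D : ℕ)
    (r : Fin n → SAdele p) :
    ∑' q : Q, rowSum N (φ.box q.1) q.1 w r ≤ φ.trimmed N w Q D r + φ.excess D r := by
  refine le_trans ?_ (add_le_add le_rfl (φ.tsum_exc_le hN w Q D r))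
  rw [tsum_rowSum_eq, trimmed, ← ENNReal.tsum_add]
  refine ENNReal.tsum_le_tsum fun z => ?_
  have h1 : φ.hit z.1.1 (w + N * z.2) r ≤ 1 := indicator_le_self' (fun _ _ => zero_le) _ |>.trans le_rfl
  calc φ.hit z.1.1 (w + N * z.2) r
      ≤ φ.hit z.1.1 (w + N * z.2) r * ((1 - φ.exc D z.1.1 (w + N * z.2) r)
        + φ.exc D z.1.1 (w + N * z.2) r) := le_mul_of_one_le_right' le_tsub_add
    _ ≤ _ := by
      rw [mul_add]
      exact add_le_add le_rfl (mul_le_of_le_one_left' h1)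

theorem hit_mul_hit_le {N : ℕ} (w : ℚ) (D : ℕ) {k l α β : ℤ} (hk : k ≠ 0)
    (hαβ : α * k + β * l = 1) {q0 q q' : Fin n → ZS p} (hq0 : q0 ≠ 0) (hq : ∀ b, q b = k * q0 b)
    (hq' : ∀ b, q' b = l * q0 b) (hw : w ∈ ZS p) (e e' : ZS p) (r : Fin n → SAdele p) :
    φ.hit q (w + N * e) r * (1 - φ.exc D q (w + N * e) r)
      * (φ.hit q' (w + N * e') r * (1 - φ.exc D q' (w + N * e') r))
    ≤ (if (l * (w + N * e) - k * (w + N * e') : ℚ) ≠ 0 ∨ max k.natAbs l.natAbs < D then 1 else 0)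
      * (φ.hit q (w + N * e) r * φ.hit q' (w + N * e') r) := by
  classical
  split_ifs with h
  · rw [one_mul]
    exact mul_le_mul' (mul_le_of_le_one_right' tsub_le_self) (mul_le_of_le_one_right' tsub_le_self)
  · push Not at h
    obtain ⟨hc, hD⟩ := h
    rw [zero_mul, nonpos_iff_eq_zero]
    by_cases h1 : rowForm q r + emb p (w + N * e) ∈ boxSet (φ.box q)
    swap
    · rw [hit, indicator_of_notMem h1, zero_mul, zero_mul]
    by_cases h2 : rowForm q' r + emb p (w + N * e') ∈ boxSet (φ.box q')
    swap
    · rw [mul_comm, hit, indicator_of_notMem h2, zero_mul, zero_mul]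
    suffices h3 : 1 ≤ φ.exc D q (w + N * e) r by
      rw [tsub_eq_zero_of_le h3, mul_zero, zero_mul]
    let y0 : ZS p := α * (⟨w, hw⟩ + N * e) + β * (⟨w, hw⟩ + N * e')
    have hy0 : (y0 : ℚ) = α * (w + N * e) + β * (w + N * e') := by
      simp [y0]
    have hαβ' : (α : ℚ) * k + β * l = 1 := by exact_mod_cast hαβ
    have e1 : (w + N * e : ℚ) = k * y0 := by
      rw [hy0]; linear_combination -(w + N * e : ℚ) * hαβ' - (-β : ℚ) * hc
    have e2 : (w + N * e' : ℚ) = l * y0 := by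
      rw [hy0]; linear_combination -(w + N * e' : ℚ) * hαβ' - (α : ℚ) * hc
    have key : ∀ (j : ℤ) (q : Fin n → ZS p), (∀ b, q b = j * q0 b) → ∀ v,
        (rowForm q r + emb p (j * y0)) v
          = (j : SField p v) * (rowForm q0 r + emb p y0) v := by
      intro j q hq v
      have h5 : rowForm q r + emb p (j * y0) = emb p j * (rowForm q0 r + emb p y0) := by
        rw [map_mul, mul_add, rowForm_apply, rowForm_apply, Finset.mul_sum]
        congr 1
        refine Finset.sum_congr rfl fun b _ => ?_
        rw [hq b]
        push_cast
        rw [map_mul]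
        ring
      rw [h5]
      have h6 : emb p (j : ℚ) v = (j : SField p v) := by
        rw [emb_apply]; exact_mod_cast rfl
      exact congrArg (· * _) h6
    have h3 : rowForm q0 r + emb p y0 ∈ boxSet (φ.scaledBox (max k.natAbs D) q0) := by
      intro v
      refine φ.mem_scaledBox hαβ hq hq' hD ?_ ?_
      · rw [← key k q hq v, ← e1]; exact h1 v
      · rw [← key l q' hq' v, ← e2]; exact h2 v
    have h4 := ENNReal.le_tsum (f := fun x : {k : ℤ // k ≠ 0} × {q0 : Fin n → ZS p // q0 ≠ 0} × ZS p =>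
      if (∀ b, q b = x.1.1 * x.2.1.1 b) ∧ (w + N * e : ℚ) = x.1.1 * x.2.2 then φ.excTerm D x r
        else 0) (⟨k, hk⟩, ⟨q0, hq0⟩, y0)
    rw [if_pos ⟨hq, e1⟩, excTerm, indicator_of_mem h3, Pi.one_apply] at h4
    unfold exc
    convert h4

section Moments

variable (hp : Function.Injective p) {N : ℕ} (hN : 0 < N) (hNS : Nat.Coprime N (∏ i, p i))
  {F : Set (Fin n → SAdele p)} (hF : IsGoodTile N F)
include hN hNS

theorem tsum_le_tsum_classes (f : ℚ → ℝ≥0∞) :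
    ∑' y : ZS p, f y ≤ ∑ v : Fin N, ∑' e : ZS p, f ((v : ℕ) + N * e) := by
  have hN' : (N : ℚ) ≠ 0 := by exact_mod_cast hN.ne'
  have h1 : ∀ y : ZS p, ∃ z : Fin N × ZS p, (y : ℚ) = (z.1 : ℕ) + N * z.2 := fun y => by
    obtain ⟨v, hv, hy⟩ := ZS.exists_nat_lt_sub_div_mem hN hNS y.2
    refine ⟨(⟨v, hv⟩, ⟨_, hy⟩), ?_⟩
    simp only
    field_simp
    ring
  choose g hg using h1
  have hinj : Function.Injective g := fun y y' h => Subtype.ext (by rw [hg y, hg y', h])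
  calc ∑' y : ZS p, f y = ∑' y : ZS p, f (((g y).1 : ℕ) + N * (g y).2) :=
        tsum_congr fun y => by rw [← hg y]
    _ ≤ ∑' z : Fin N × ZS p, f ((z.1 : ℕ) + N * z.2) :=
        ENNReal.tsum_comp_le_tsum_of_injective hinj fun z : Fin N × ZS p => f ((z.1 : ℕ) + N * z.2)
    _ = _ := by rw [ENNReal.tsum_prod', tsum_fintype]

include hp

include hF in
theorem lintegral_excess_le (hn : 0 < n) {D : ℕ} :
    ∫⁻ r, φ.excess D r ∂(ProbabilityTheory.cond volume F)
      ≤ ∑' k : {k : ℤ // k ≠ 0},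
        2 ^ (1 + n) * (((max k.1.natAbs D : ℕ) : ℝ≥0∞)⁻¹ ^ (1 + n) * φ.V) := by
  have h1 := lintegral_tsum (μ := ProbabilityTheory.cond volume F) (f := fun x => φ.excTerm D x)
    fun x => (φ.measurable_excTerm D x).aemeasurable
  refine h1.le.trans ?_
  rw [ENNReal.tsum_prod']
  refine ENNReal.tsum_le_tsum fun k => ?_
  have hM : 0 < max k.1.natAbs D := lt_max_of_lt_left (Int.natAbs_pos.2 k.2)
  set M := max k.1.natAbs D with hMdef
  rw [ENNReal.tsum_prod']
  have h2 : ∀ q0 : {q0 : Fin n → ZS p // q0 ≠ 0},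
      ∑' y : ZS p, ∫⁻ r, φ.excTerm D (k, q0, y) r ∂(ProbabilityTheory.cond volume F)
        ≤ 2 * ((M : ℝ≥0∞)⁻¹ * φ.scaledWt M q0.1) := by
    intro q0
    have h3 := φ.boxVol_scaledBox_pow hM q0.1
    simp only [pow_one] at h3
    rw [← h3]
    have h4 := lintegral_tsum (μ := ProbabilityTheory.cond volume F)
      (f := fun y => φ.excTerm D (k, q0, y))
      fun y => (φ.measurable_excTerm D (k, q0, y)).aemeasurable
    rw [← h4]
    have h5 : ∀ r, ∑' y, φ.excTerm D (k, q0, y) r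
        ≤ ∑ v : Fin N, rowSum N (φ.scaledBox M q0.1) q0.1 (v : ℕ) r := fun r =>
      tsum_le_tsum_classes hN hNS fun y =>
        (boxSet (φ.scaledBox M q0.1)).indicator 1 (rowForm q0.1 r + emb p y)
    refine (lintegral_mono h5).trans ?_
    rw [lintegral_finsetSum _ fun v _ => measurable_rowSum (φ.measurableSet_scaledBox M q0.1) _ _]
    rw [Finset.sum_congr rfl fun v _ => lintegral_rowSum hp hN hNS hF.1 hF.2.1 hF.2.2 q0.2
      (φ.measurableSet_scaledBox M q0.1) _]
    rw [Finset.sum_const, Finset.card_univ, Fintype.card_fin, nsmul_eq_mul, ← mul_assoc,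
      ENNReal.mul_inv_cancel (by exact_mod_cast hN.ne') (ENNReal.natCast_ne_top N), one_mul]
  refine (ENNReal.tsum_le_tsum h2).trans ?_
  rw [ENNReal.tsum_mul_left, ENNReal.tsum_mul_left]
  calc _ ≤ 2 * ((M : ℝ≥0∞)⁻¹ * (2 ^ n * ((M : ℝ≥0∞)⁻¹ ^ n * φ.V))) := by
        gcongr
        exact φ.tsum_scaledWt_le hp hn hM
    _ = _ := by ring

theorem sum_classes_overlap_le {ω : ∀ v, SField p v → ℝ≥0∞}
    (hω : ∀ v, NormAntitone (ω v)) (hfin : ∀ v y, ω v y ≠ ∞) (j : ℤ) (P : Prop) [Decidable P] :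
    ∑ a : Fin N, ∑' c : ZS p, (if (j * (a : ℕ) + N * c : ℚ) ≠ 0 ∨ P then 1 else 0)
        * ∏ v, ω v (emb p (j * (a : ℕ) + N * c) v)
      ≤ (∏ v, ∫⁻ y, ω v y) + N * (if P then ∏ v, ω v 0 else 0) := by
  classical
  have hN' : (N : ℚ) ≠ 0 := by exact_mod_cast hN.ne'
  have h1 := tsum_prod_classes_le hp hN hNS hω hfin j
  set f : Fin N × ZS p → ℝ≥0∞ := fun a => ∏ v, ω v (emb p (j * (a.1 : ℕ) + N * a.2) v) with hf
  have h2 : ∀ a : Fin N, ∀ c : ZS p, (if (j * (a : ℕ) + N * c : ℚ) ≠ 0 ∨ P then 1 else 0)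
        * f (a, c) ≤ {a : Fin N × ZS p | (j * (a.1 : ℕ) + N * a.2 : ℚ) ≠ 0}.indicator f (a, c)
          + if (j * (a : ℕ) + N * c : ℚ) = 0 then (if P then ∏ v, ω v 0 else 0) else 0 := by
    intro a c
    by_cases h : (j * (a : ℕ) + N * c : ℚ) = 0
    · rw [if_pos h]
      refine le_add_left ?_
      by_cases hP : P
      · rw [if_pos (Or.inr hP), if_pos hP, one_mul]
        simp only [hf, h, map_zero]
        exact le_rfl
      · rw [if_neg (by tauto), zero_mul]
        exact zero_le
    · rw [indicator_of_mem (by exact h), if_pos (Or.inl h), one_mul]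
      exact le_self_add
  calc _ ≤ ∑ a : Fin N, ∑' c : ZS p,
        ({a : Fin N × ZS p | (j * (a.1 : ℕ) + N * a.2 : ℚ) ≠ 0}.indicator f (a, c)
          + if (j * (a : ℕ) + N * c : ℚ) = 0 then (if P then ∏ v, ω v 0 else 0) else 0) :=
        Finset.sum_le_sum fun a _ => ENNReal.tsum_le_tsum fun c => h2 a c
    _ = (∑' a, {a : Fin N × ZS p | (j * (a.1 : ℕ) + N * a.2 : ℚ) ≠ 0}.indicator f a)
        + ∑ a : Fin N, ∑' c : ZS p,
          if (j * (a : ℕ) + N * c : ℚ) = 0 then (if P then ∏ v, ω v 0 else 0) else 0 := by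
        rw [ENNReal.tsum_prod', tsum_fintype, ← Finset.sum_add_distrib]
        exact Finset.sum_congr rfl fun a _ => ENNReal.tsum_add
    _ ≤ _ := by
        refine add_le_add ?_ ?_
        · rw [← tsum_subtype]
          exact h1
        · refine (Finset.sum_le_card_nsmul _ _ (if P then ∏ v, ω v 0 else 0) fun a _ => ?_).trans ?_
          · refine ENNReal.tsum_ite_le_of_subsingleton _ (fun c c' h h' => Subtype.ext ?_) _
            exact mul_left_cancel₀ hN' (by linarith)
          · simp

end Moments

end Profile

end

section

open Set
open scoped ENNReal NNReal

variable {s : ℕ} {p : Fin s → ℕ} [∀ i, Fact (p i).Prime] {n : ℕ}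
  [∀ i, MeasurableSpace ℚ_[p i]] [∀ i, BorelSpace ℚ_[p i]]

namespace Profile

open Classical in
/-- The diagonal contribution of a pair of vectors, restricted to heights below `D`. -/
def lowDiagSum (φ : Profile p 1 n) (D : ℕ) (z : (Fin n → ZS p) × (Fin n → ZS p)) : ℝ≥0∞ :=
  ∑' x, if z = multiples x then (if x.1.height < D then φ.diagTerm x else 0) else 0

theorem tsum_lowDiagSum (φ : Profile p 1 n) (D : ℕ) : ∑' z, φ.lowDiagSum D z
    = ∑' x, if x.1.height < D then φ.diagTerm x else 0 := by
  unfold lowDiagSum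
  rw [ENNReal.tsum_comm]
  exact tsum_congr fun x => tsum_ite_eq _ _

theorem tsum_low_diagTerm_le (φ : Profile p 1 n) (hp : Function.Injective p) (hn : 0 < n)
    (D : ℕ) : (∑' x, if x.1.height < D then φ.diagTerm x else 0)
      ≤ ∑' x : CoprimePair, if x.height < D then
        2 ^ (1 + n) * ((x.height : ℝ≥0∞)⁻¹ ^ (1 + n) * φ.V) else 0 := by
  rw [ENNReal.tsum_prod']
  refine ENNReal.tsum_le_tsum fun x => ?_
  dsimp only
  split_ifs
  · unfold diagTerm
    dsimp only
    rw [ENNReal.tsum_mul_left, ENNReal.tsum_mul_left]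
    calc _ ≤ 2 ^ 1 * ((x.height : ℝ≥0∞)⁻¹ ^ 1 * (2 ^ n * ((x.height : ℝ≥0∞)⁻¹ ^ n * φ.V))) := by
          gcongr
          exact φ.tsum_scaledWt_le hp hn x.height_pos
      _ = _ := by ring
  · simp

variable (φ : Profile p 1 n)

/-- The contribution of a single coefficient vector to `trimmed`. -/
def trimTerm (N : ℕ) (w : ℚ) (D : ℕ) (q : Fin n → ZS p) (e : ZS p) (r : Fin n → SAdele p) :
    ℝ≥0∞ := φ.hit q (w + N * e) r * (1 - φ.exc D q (w + N * e) r)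

theorem measurable_trimTerm (N : ℕ) (w : ℚ) (D : ℕ) (q : Fin n → ZS p) (e : ZS p) :
    Measurable (φ.trimTerm N w D q e) :=
  (φ.measurable_hit _ _).mul (measurable_const.sub (φ.measurable_exc _ _ _))

section Moments

variable (hp : Function.Injective p) {N : ℕ} (hN : 0 < N) (hNS : Nat.Coprime N (∏ i, p i))
  {F : Set (Fin n → SAdele p)} (hF : IsGoodTile N F)
include hp hN hNS hF

theorem sum_lintegral_trimTerm_mul_le (D : ℕ) {q q' : Fin n → ZS p} (hq : q ≠ 0) (hq' : q' ≠ 0)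
    (hdep : ∀ b b', q b * q' b' = q b' * q' b) :
    ∑ a : Fin N, ∫⁻ r, ∑' e : ZS p × ZS p,
        φ.trimTerm N (a : ℕ) D q e.1 r * φ.trimTerm N (a : ℕ) D q' e.2 r
        ∂(ProbabilityTheory.cond volume F)
      ≤ N * (φ.expHits N q * φ.expHits N q') + φ.lowDiagSum D (q, q') := by
  classical
  obtain ⟨x, hx, hx'⟩ := exists_coprimePair_of_dependent hq hq' hdep
  obtain ⟨α, β, hαβ⟩ := id x.1.2.2.2
  set k := x.1.1.1 with hk
  set l := x.1.1.2 with hl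
  have hαβv : ∀ v, (α : SField p v) * k + β * l = 1 := fun v => by
    exact_mod_cast congrArg (Int.cast : ℤ → SField p v) hαβ
  let wt : ℚ → ℝ≥0∞ := fun t => if t ≠ 0 ∨ max k.natAbs l.natAbs < D then 1 else 0
  have h1 : ∀ a : Fin N, ∫⁻ r, ∑' e : ZS p × ZS p,
        φ.trimTerm N (a : ℕ) D q e.1 r * φ.trimTerm N (a : ℕ) D q' e.2 r
        ∂(ProbabilityTheory.cond volume F)
      ≤ (N : ℝ≥0∞)⁻¹ * ∑' c : ZS p, wt ((l - k : ℤ) * (a : ℕ) + N * c) * ∏ v,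
        overlap (k : SField p v) l α β (φ.box q v) (φ.box q' v)
          (emb p ((l - k : ℤ) * (a : ℕ) + N * c) v) := by
    intro a
    have h2 := lintegral_tsum_dependent hp hN hNS hF.1 hF.2.1 hF.2.2 x.2.2 hαβ hx hx'
      (φ.measurableSet_box q) (φ.measurableSet_box q') (a : ℕ) (a : ℕ) wt
    have h3 : ∀ c : ZS p, (l * (a : ℕ) - k * (a : ℕ) + N * c : ℚ)
        = (l - k : ℤ) * (a : ℕ) + N * c := fun c => by push_cast; ring
    simp only [h3] at h2
    rw [← h2]
    refine lintegral_mono fun r => ENNReal.tsum_le_tsum fun e => ?_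
    exact φ.hit_mul_hit_le (a : ℕ) D x.1.2.1 hαβ x.2.2 hx hx' (natCast_mem (ZS p) _) e.1 e.2 r
  refine (Finset.sum_le_sum fun a _ => h1 a).trans ?_
  rw [← Finset.mul_sum]
  have h4 := sum_classes_overlap_le hp hN hNS
    (ω := fun v => overlap (k : SField p v) l α β (φ.box q v) (φ.box q' v))
    (fun v => normAntitone_overlap (by exact_mod_cast x.1.2.1) (by exact_mod_cast x.1.2.2.1)
      (hαβv v) (φ.normLower_box q v) (φ.normLower_box q' v))
    (φ.overlap_ne_top one_pos x.1.2.1 x.1.2.2.1 hαβ hx hx') (l - k)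
    (max k.natAbs l.natAbs < D)
  rw [φ.lintegral_overlap_box x.1.2.1 hαβ] at h4
  refine (mul_le_mul' le_rfl h4).trans ?_
  have hN0 : (N : ℝ≥0∞) ≠ 0 := by exact_mod_cast hN.ne'
  have hN1 : (N : ℝ≥0∞)⁻¹ * N = 1 := ENNReal.inv_mul_cancel hN0 (ENNReal.natCast_ne_top N)
  rw [mul_add, ← mul_assoc (N : ℝ≥0∞)⁻¹ (N : ℝ≥0∞), hN1, one_mul]
  refine add_le_add (le_of_eq ?_) ?_
  · rw [φ.expHits_eq, φ.expHits_eq, pow_one, pow_one]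
    calc _ = 1 * (N : ℝ≥0∞)⁻¹ * (boxVol (φ.box q) * boxVol (φ.box q')) := by rw [one_mul]
      _ = _ := by rw [← hN1]; ring
  · have h5 : (q, q') = multiples x := Prod.ext (funext hx) (funext hx')
    have h6 := ENNReal.le_tsum (f := fun y =>
      if (q, q') = multiples y then (if y.1.height < D then φ.diagTerm y else 0) else 0) x
    rw [if_pos h5] at h6
    refine le_trans ?_ (h6.trans (le_of_eq (by unfold lowDiagSum; congr! )))
    have h7 := φ.prod_overlap_zero_pow_le x.1.2.1 x.1.2.2.1 hαβ hx hx' rfl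
    rw [pow_one] at h7
    change (if x.1.height < D then _ else _) ≤ _
    split_ifs
    · exact h7
    · exact le_rfl

theorem sum_lintegral_trimmed_sq_le (D : ℕ) {Q : Set (Fin n → ZS p)}
    (hQ : (0 : Fin n → ZS p) ∉ Q)
    (hdep : ∀ q ∈ Q, ∀ q' ∈ Q, ∀ b b', q b * q' b' = q b' * q' b) :
    ∑ a : Fin N, ∫⁻ r, φ.trimmed N (a : ℕ) Q D r ^ 2 ∂(ProbabilityTheory.cond volume F)
      ≤ N * φ.mean N Q ^ 2 + ∑' x, if x.1.height < D then φ.diagTerm x else 0 := by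
  have hne : ∀ q : Q, q.1 ≠ 0 := fun q h => hQ (h ▸ q.2)
  have h1 : ∀ (a : Fin N) r, φ.trimmed N (a : ℕ) Q D r ^ 2 = ∑' z : Q × Q, ∑' e : ZS p × ZS p,
      φ.trimTerm N (a : ℕ) D z.1.1 e.1 r * φ.trimTerm N (a : ℕ) D z.2.1 e.2 r := by
    intro a r
    have h2 : φ.trimmed N (a : ℕ) Q D r = ∑' q : Q, ∑' e, φ.trimTerm N (a : ℕ) D q.1 e r := by
      rw [trimmed, ENNReal.tsum_prod']
      rfl
    have h3 : ∀ {ι κ : Type} (f : ι → ℝ≥0∞) (g : κ → ℝ≥0∞),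
        ∑' z : ι × κ, f z.1 * g z.2 = (∑' i, f i) * ∑' j, g j := fun f g => by
      rw [ENNReal.tsum_prod', ← ENNReal.tsum_mul_right]
      exact tsum_congr fun i => ENNReal.tsum_mul_left (a := f i) (f := g)
    rw [h2, sq, ← h3]
    exact tsum_congr fun z => (h3 _ _).symm
  have h2 : φ.mean N Q ^ 2 = ∑' z : Q × Q, φ.expHits N z.1.1 * φ.expHits N z.2.1 := by
    rw [ENNReal.tsum_prod', sq, mean, ← ENNReal.tsum_mul_right]
    exact tsum_congr fun q => ENNReal.tsum_mul_left.symm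
  have h3 : ∀ a : Fin N, ∫⁻ r, φ.trimmed N (a : ℕ) Q D r ^ 2 ∂(ProbabilityTheory.cond volume F)
      = ∑' z : Q × Q, ∫⁻ r, ∑' e : ZS p × ZS p,
        φ.trimTerm N (a : ℕ) D z.1.1 e.1 r * φ.trimTerm N (a : ℕ) D z.2.1 e.2 r
          ∂(ProbabilityTheory.cond volume F) := fun a => by
    rw [lintegral_congr (h1 a)]
    exact lintegral_tsum (f := fun (z : Q × Q) r => ∑' e : ZS p × ZS p,
        φ.trimTerm N (a : ℕ) D z.1.1 e.1 r * φ.trimTerm N (a : ℕ) D z.2.1 e.2 r)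
        fun z => (Measurable.tsum fun e => (φ.measurable_trimTerm _ _ _ _ _).mul
          (φ.measurable_trimTerm _ _ _ _ _)).aemeasurable
  rw [Finset.sum_congr rfl fun a _ => h3 a,
    ← Summable.tsum_finsetSum fun a _ => ENNReal.summable, h2, ← ENNReal.tsum_mul_left,
    ← φ.tsum_lowDiagSum D]
  refine (ENNReal.tsum_le_tsum fun z : Q × Q => φ.sum_lintegral_trimTerm_mul_le hp hN hNS hF D
    (hne z.1) (hne z.2) (hdep _ z.1.2 _ z.2.2)).trans ?_
  rw [ENNReal.tsum_add]
  refine add_le_add le_rfl ?_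
  exact ENNReal.tsum_comp_le_tsum_of_injective (f := fun z : Q × Q => (z.1.1, z.2.1))
    (fun x y h => Prod.ext (Subtype.ext (congrArg Prod.fst h))
      (Subtype.ext (congrArg Prod.snd h))) (φ.lowDiagSum D)

end Moments

end Profile

end

section

open Set
open scoped ENNReal NNReal

theorem ENNReal.sq_tsub_add_sq_tsub {e : ℝ≥0∞} (he : e ≠ ∞) (x : ℝ≥0∞) :
    (x - e) ^ 2 + (e - x) ^ 2 + 2 * e * x = x ^ 2 + e ^ 2 := by
  rcases le_total e x with h | h
  · obtain ⟨t, rfl⟩ := exists_add_of_le h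
    rw [ENNReal.add_sub_cancel_left he, tsub_eq_zero_of_le h]
    ring
  · have hx : x ≠ ∞ := ne_top_of_le_ne_top he h
    obtain ⟨t, rfl⟩ := exists_add_of_le h
    rw [ENNReal.add_sub_cancel_left hx, tsub_eq_zero_of_le h]
    ring

theorem sum_lintegral_sq_tsub_le {Ω ι : Type*} [MeasurableSpace Ω] {P : Measure Ω}
    [IsProbabilityMeasure P] [Fintype ι] {X : ι → Ω → ℝ≥0∞} (hX : ∀ i, Measurable (X i))
    {e y z : ℝ≥0∞} (he : e ≠ ∞)
    (h1 : ∑ i, ∫⁻ ω, X i ω ^ 2 ∂P ≤ Fintype.card ι * e ^ 2 + z)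
    (h2 : ∀ i, e ≤ ∫⁻ ω, X i ω ∂P + y) :
    ∑ i, ∫⁻ ω, ((X i ω - e) ^ 2 + (e - X i ω) ^ 2) ∂P ≤ z + Fintype.card ι * (2 * e * y) := by
  have hm : ∀ i, Measurable fun ω => (X i ω - e) ^ 2 + (e - X i ω) ^ 2 := fun i =>
    (((hX i).sub measurable_const).pow_const 2).add ((measurable_const.sub (hX i)).pow_const 2)
  have h3 : ∀ i, ∫⁻ ω, ((X i ω - e) ^ 2 + (e - X i ω) ^ 2) ∂P + 2 * e * ∫⁻ ω, X i ω ∂P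
      = ∫⁻ ω, X i ω ^ 2 ∂P + e ^ 2 := fun i => by
    have h4 : ∫⁻ _, e ^ 2 ∂P = e ^ 2 := by simp
    rw [← lintegral_const_mul _ (hX i), ← lintegral_add_left (hm i), ← h4,
      ← lintegral_add_left ((hX i).pow_const 2)]
    exact lintegral_congr fun ω => ENNReal.sq_tsub_add_sq_tsub he _
  have h4 : (Fintype.card ι : ℝ≥0∞) * (2 * e ^ 2)
      ≤ ∑ i, 2 * e * ∫⁻ ω, X i ω ∂P + Fintype.card ι * (2 * e * y) := by
    have h5 : ∑ _i : ι, (2 * e * e) ≤ ∑ i, (2 * e * ∫⁻ ω, X i ω ∂P + 2 * e * y) :=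
      Finset.sum_le_sum fun i _ => by
        rw [← mul_add]
        exact mul_le_mul' le_rfl (h2 i)
    rw [Finset.sum_add_distrib] at h5
    simp only [Finset.sum_const, Finset.card_univ, nsmul_eq_mul] at h5
    refine le_trans (le_of_eq ?_) h5
    ring
  have h5 : ∑ i, ∫⁻ ω, ((X i ω - e) ^ 2 + (e - X i ω) ^ 2) ∂P + ∑ i, 2 * e * ∫⁻ ω, X i ω ∂P
      ≤ Fintype.card ι * (2 * e ^ 2) + z := by
    rw [← Finset.sum_add_distrib, Finset.sum_congr rfl fun i _ => h3 i, Finset.sum_add_distrib]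
    simp only [Finset.sum_const, Finset.card_univ, nsmul_eq_mul]
    calc _ ≤ Fintype.card ι * e ^ 2 + z + Fintype.card ι * e ^ 2 := add_le_add h1 le_rfl
      _ = _ := by ring
  have htop : (Fintype.card ι : ℝ≥0∞) * (2 * e ^ 2) ≠ ∞ :=
    ENNReal.mul_ne_top (ENNReal.natCast_ne_top _)
      (ENNReal.mul_ne_top (by simp) (ENNReal.pow_ne_top he))
  refine (ENNReal.add_le_add_iff_left htop).1 ?_
  calc _ ≤ (∑ i, 2 * e * ∫⁻ ω, X i ω ∂P + Fintype.card ι * (2 * e * y))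
        + ∑ i, ∫⁻ ω, ((X i ω - e) ^ 2 + (e - X i ω) ^ 2) ∂P := add_le_add h4 le_rfl
    _ = (∑ i, ∫⁻ ω, ((X i ω - e) ^ 2 + (e - X i ω) ^ 2) ∂P + ∑ i, 2 * e * ∫⁻ ω, X i ω ∂P)
        + Fintype.card ι * (2 * e * y) := by ring
    _ ≤ Fintype.card ι * (2 * e ^ 2) + z + Fintype.card ι * (2 * e * y) := add_le_add h5 le_rfl
    _ = _ := by ring

theorem one_add_pow_le_one_add_mul {δ : ℝ} (h0 : 0 ≤ δ) (h1 : δ ≤ 1) (m : ℕ) :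
    (1 + δ) ^ m ≤ 1 + (2 ^ m - 1) * δ := by
  induction m with
  | zero => simp
  | succ k ih =>
    have h2 : (1 : ℝ) ≤ 2 ^ k := one_le_pow₀ (by norm_num)
    calc (1 + δ) ^ (k + 1) = (1 + δ) ^ k * (1 + δ) := pow_succ _ _
      _ ≤ (1 + (2 ^ k - 1) * δ) * (1 + δ) := by gcongr
      _ ≤ 1 + (2 ^ (k + 1) - 1) * δ := by
        rw [pow_succ]
        nlinarith [mul_nonneg (mul_nonneg h0 (sub_nonneg.2 h1)) (sub_nonneg.2 h2)]

variable {s : ℕ} {p : Fin s → ℕ} [∀ i, Fact (p i).Prime] {m n : ℕ}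
  [∀ i, MeasurableSpace ℚ_[p i]] [∀ i, BorelSpace ℚ_[p i]]

theorem rowSum_add_mul (N : ℕ) (B : ∀ v, Set (SField p v)) (q : Fin n → ZS p) (w : ℚ) (t : ZS p)
    (r : Fin n → SAdele p) : rowSum N B q (w + N * t) r = rowSum N B q w r := by
  unfold rowSum
  rw [← (Equiv.addLeft t).tsum_eq fun e : ZS p =>
    ((boxSet B).indicator 1 (rowForm q r + emb p (w + N * e)) : ℝ≥0∞)]
  refine tsum_congr fun e => ?_
  simp only [Equiv.coe_addLeft, Subring.coe_add, mul_add, add_assoc]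

theorem isProbabilityMeasure_tileMeasure {N : ℕ} {F : Fin m → Set (Fin n → SAdele p)}
    (hF : ∀ a, IsGoodTile N (F a)) : IsProbabilityMeasure (tileMeasure F) := by
  have := fun a => (hF a).isProbabilityMeasure
  unfold tileMeasure
  infer_instance

theorem lintegral_tileMeasure_one {N : ℕ} {F : Fin 1 → Set (Fin n → SAdele p)}
    (hF : ∀ a, IsGoodTile N (F a)) {f : (Fin n → SAdele p) → ℝ≥0∞} (hf : Measurable f) :
    ∫⁻ A, f (A 0) ∂(tileMeasure F) = ∫⁻ r, f r ∂(ProbabilityTheory.cond volume (F 0)) := by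
  have := fun a => (hF a).isProbabilityMeasure
  unfold tileMeasure
  have h := lintegral_pi_prod (fun a => ProbabilityTheory.cond volume (F a)) (fun _ => f)
    fun _ => hf
  simpa using h

namespace Profile

variable (φ : Profile p m n)

theorem scaledWt_one (q : Fin n → ZS p) : φ.scaledWt 1 q = φ.wt q := by
  unfold scaledWt wt G
  refine Finset.prod_congr rfl fun v _ => ?_
  cases v <;> simp [archScale]

theorem mean_le (hp : Function.Injective p) (hn : 0 < n) {N : ℕ} (hN : 0 < N)
    {Q : Set (Fin n → ZS p)} (hQ : (0 : Fin n → ZS p) ∉ Q) :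
    φ.mean N Q ≤ 2 ^ (m + n) * φ.V := by
  have h1 := φ.tsum_scaledWt_le hp hn one_pos
  simp only [scaledWt_one, Nat.cast_one, inv_one, one_pow, one_mul] at h1
  have h2 : ∑' q : Q, φ.wt q.1 ≤ ∑' q : {q : Fin n → ZS p // q ≠ 0}, φ.wt q.1 :=
    ENNReal.tsum_comp_le_tsum_of_injective
      (f := fun q : Q => (⟨q.1, fun h => hQ (h ▸ q.2)⟩ : {q : Fin n → ZS p // q ≠ 0}))
      (fun x y h => Subtype.ext (congrArg (fun z => z.1) h)) (fun q => φ.wt q.1)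
  have h3 : (2 / N : ℝ≥0∞) ≤ 2 := ENNReal.div_le_of_le_mul (by
    refine le_mul_of_one_le_right' ?_
    exact_mod_cast hN)
  unfold mean expHits
  rw [ENNReal.tsum_mul_left]
  calc _ ≤ 2 ^ m * (2 ^ n * φ.V) := mul_le_mul' (pow_le_pow_left' h3 m) (h2.trans h1)
    _ = _ := by ring

end Profile

end

section

open Set
open scoped ENNReal NNReal

/-- `X` is close to `e` outside a small set, with an error controlled by powers of `V`. -/
def Concentrated {Ω : Type*} [MeasurableSpace Ω] (P : Measure Ω) (X : Ω → ℝ≥0∞)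
    (e V C : ℝ≥0∞) (κ : ℝ) : Prop :=
  ∃ Z Y : Ω → ℝ≥0∞, Measurable Z ∧ Measurable Y ∧ (∀ ω, Z ω ≤ X ω) ∧ (∀ ω, X ω ≤ Z ω + Y ω) ∧
    ∫⁻ ω, Y ω ∂P ≤ C * V ^ (1 - κ) ∧
    ∫⁻ ω, ((Z ω - e) ^ 2 + (e - Z ω) ^ 2) ∂P ≤ C * V ^ (2 - κ)

theorem ENNReal.natCast_inv_pow_le_rpow {M j : ℕ} (hM : 0 < M) {t : ℝ} (hj : t ≤ j) :
    (M : ℝ≥0∞)⁻¹ ^ j ≤ (M : ℝ≥0∞) ^ (-t) := by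
  rw [← ENNReal.rpow_natCast, ENNReal.inv_rpow, ← ENNReal.rpow_neg]
  exact ENNReal.rpow_le_rpow_of_exponent_le (by exact_mod_cast hM) (by linarith)

theorem ENNReal.rpow_neg_le_rpow_neg {a b : ℝ≥0∞} (h : a ≤ b) {t : ℝ} (ht : 0 ≤ t) :
    b ^ (-t) ≤ a ^ (-t) := by
  rw [ENNReal.rpow_neg, ENNReal.rpow_neg]
  exact ENNReal.inv_le_inv.2 (ENNReal.rpow_le_rpow h ht)

variable {s : ℕ} {p : Fin s → ℕ} [∀ i, Fact (p i).Prime] {m n : ℕ}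
  [∀ i, MeasurableSpace ℚ_[p i]] [∀ i, BorelSpace ℚ_[p i]]

theorem exists_concentrated_of_three_le (hp : Function.Injective p) {N : ℕ} (hN : 0 < N)
    (hNS : Nat.Coprime N (∏ i, p i)) (hm : 0 < m) (hn : 0 < n) (hmn : 3 ≤ m + n) :
    ∃ C : ℝ≥0∞, C ≠ ∞ ∧ ∀ (φ : Profile p m n) (w : Fin m → ℚ) (F : Fin m → Set (Fin n → SAdele p))
      (Q : Set (Fin n → ZS p)), (∀ a, IsGoodTile N (F a)) → (0 : Fin n → ZS p) ∉ Q →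
      1 ≤ φ.V → φ.V ≠ ∞ →
      Concentrated (tileMeasure F) (φ.count N w Q) (φ.mean N Q) φ.V C (1 / (m + 1)) := by
  set S : ℝ≥0∞ := ∑' x : CoprimePair, (x.height : ℝ≥0∞) ^ (-(5 / 2) : ℝ) with hS
  have hS' : S ≠ ∞ := CoprimePair.tsum_height_rpow_ne_top
  set C : ℝ≥0∞ := 2 ^ m * (2 ^ (m + n)) ^ 2 + 2 ^ m * (2 ^ (m + n) * S) with hC
  refine ⟨C, ?_, fun φ w F Q hF hQ hV1 hV => ?_⟩
  · have h2 : ∀ j : ℕ, (2 : ℝ≥0∞) ^ j ≠ ∞ := fun j => ENNReal.pow_ne_top (by simp)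
    exact ENNReal.add_ne_top.2 ⟨ENNReal.mul_ne_top (h2 _) (ENNReal.pow_ne_top (h2 _)),
      ENNReal.mul_ne_top (h2 _) (ENNReal.mul_ne_top (h2 _) hS')⟩
  have hprob := isProbabilityMeasure_tileMeasure hF
  set κ : ℝ := 1 / (m + 1) with hκ
  have hκ0 : 0 < κ := by positivity
  have hκm : κ * m = 1 - κ := by rw [hκ]; field_simp; ring
  have hV0 : φ.V ≠ 0 := (zero_lt_one.trans_le hV1).ne'
  set δ : ℝ := φ.V.toReal ^ (-κ) with hδ
  have hVr : 1 ≤ φ.V.toReal := by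
    rw [← ENNReal.toReal_one]; exact ENNReal.toReal_mono hV hV1
  have hδ0 : 0 < δ := Real.rpow_pos_of_pos (by linarith) _
  have hδ1 : δ ≤ 1 := Real.rpow_le_one_of_one_le_of_nonpos hVr (by linarith)
  have hδE : ENNReal.ofReal δ = φ.V ^ (-κ) := by
    rw [hδ, ← ENNReal.ofReal_rpow_of_pos (by linarith), ENNReal.ofReal_toReal hV]
  have hδE' : ENNReal.ofReal δ⁻¹ = φ.V ^ κ := by
    rw [ENNReal.ofReal_inv_of_pos hδ0, hδE, ENNReal.rpow_neg, inv_inv]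
  have b1 : ENNReal.ofReal (1 + δ) ^ m ≤ 1 + 2 ^ m * φ.V ^ (-κ) := by
    rw [← ENNReal.ofReal_pow (by linarith), ← hδE]
    refine (ENNReal.ofReal_le_ofReal ((one_add_pow_le_one_add_mul hδ0.le hδ1 m).trans
      (?_ : _ ≤ 1 + 2 ^ m * δ))).trans_eq ?_
    · nlinarith
    · rw [ENNReal.ofReal_add zero_le_one (by positivity), ENNReal.ofReal_mul (by positivity),
        ENNReal.ofReal_pow (by norm_num)]
      simp
  have b2 : ENNReal.ofReal (1 + δ⁻¹) ^ m ≤ 2 ^ m * φ.V ^ (1 - κ) := by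
    have h1 : 1 + δ⁻¹ ≤ 2 * δ⁻¹ := by
      have := (one_le_inv₀ hδ0).2 hδ1
      linarith
    refine (pow_le_pow_left' (ENNReal.ofReal_le_ofReal h1) m).trans_eq ?_
    rw [ENNReal.ofReal_mul (by norm_num), hδE', mul_pow, ← ENNReal.rpow_natCast (φ.V ^ κ),
      ← ENNReal.rpow_mul, hκm]
    simp
  have b3 : ∑' x, φ.diagTerm x ≤ 2 ^ (m + n) * S * φ.V := by
    refine (φ.tsum_diagTerm_le hp hn).trans ?_
    rw [ENNReal.tsum_mul_left, ENNReal.tsum_mul_right, mul_assoc]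
    refine mul_le_mul' le_rfl (mul_le_mul' (ENNReal.tsum_le_tsum fun x => ?_) le_rfl)
    refine ENNReal.natCast_inv_pow_le_rpow x.height_pos ?_
    have : (3 : ℝ) ≤ (m + n : ℕ) := by exact_mod_cast hmn
    linarith
  have hmean := φ.mean_le hp hn hN hQ
  have hmean' : φ.mean N Q ≠ ∞ :=
    ne_top_of_le_ne_top (ENNReal.mul_ne_top (ENNReal.pow_ne_top (by simp)) hV) hmean
  have hsq : ∫⁻ A, φ.count N w Q A ^ 2 ∂(tileMeasure F)
      ≤ φ.mean N Q ^ 2 + C * φ.V ^ (2 - κ) := by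
    refine (φ.lintegral_count_sq_le hp hN hNS hF w hm hQ hδ0).trans ?_
    have r1 : φ.V ^ (-κ) * φ.V ^ 2 = φ.V ^ (2 - κ) := by
      rw [← ENNReal.rpow_natCast φ.V 2, ← ENNReal.rpow_add _ _ hV0 hV]
      congr 1; push_cast; ring
    have r2 : φ.V ^ (1 - κ) * φ.V = φ.V ^ (2 - κ) := by
      nth_rewrite 2 [← ENNReal.rpow_one φ.V]
      rw [← ENNReal.rpow_add _ _ hV0 hV]
      congr 1; ring
    calc _ ≤ (1 + 2 ^ m * φ.V ^ (-κ)) * φ.mean N Q ^ 2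
          + 2 ^ m * φ.V ^ (1 - κ) * (2 ^ (m + n) * S * φ.V) :=
          add_le_add (mul_le_mul' b1 le_rfl) (mul_le_mul' b2 b3)
      _ = φ.mean N Q ^ 2 + 2 ^ m * φ.V ^ (-κ) * φ.mean N Q ^ 2
          + 2 ^ m * (2 ^ (m + n) * S) * (φ.V ^ (1 - κ) * φ.V) := by ring
      _ ≤ φ.mean N Q ^ 2 + 2 ^ m * φ.V ^ (-κ) * (2 ^ (m + n) * φ.V) ^ 2
          + 2 ^ m * (2 ^ (m + n) * S) * (φ.V ^ (1 - κ) * φ.V) := by gcongr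
      _ = φ.mean N Q ^ 2 + 2 ^ m * (2 ^ (m + n)) ^ 2 * (φ.V ^ (-κ) * φ.V ^ 2)
          + 2 ^ m * (2 ^ (m + n) * S) * (φ.V ^ (1 - κ) * φ.V) := by ring
      _ = _ := by rw [r1, r2, hC]; ring
  refine ⟨φ.count N w Q, fun _ => 0, φ.measurable_count N w Q, measurable_const, fun _ => le_rfl,
    fun _ => le_self_add, by simp, ?_⟩
  have := sum_lintegral_sq_tsub_le (P := tileMeasure F) (ι := Unit) (X := fun _ => φ.count N w Q)
    (fun _ => φ.measurable_count N w Q) (y := 0) hmean' (z := C * φ.V ^ (2 - κ)) (by simpa using hsq)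
    (fun _ => by rw [add_zero]; exact (φ.lintegral_count hp hN hNS hF w hQ).ge)
  simpa using this

theorem tsum_ne_zero_natAbs_rpow_ne_top :
    ∑' k : {k : ℤ // k ≠ 0}, (k.1.natAbs : ℝ≥0∞) ^ (-(3 / 2) : ℝ) ≠ ∞ := by
  have h1 : Summable fun k : ℤ => |(k : ℝ)| ^ (-(3 / 2) : ℝ) :=
    Real.summable_abs_int_rpow (by norm_num)
  have h2 := (h1.comp_injective
    (Subtype.val_injective : Function.Injective (fun k : {k : ℤ // k ≠ 0} => k.1))).tsum_ofReal_ne_top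
  refine ne_of_eq_of_ne (tsum_congr fun k => ?_) h2
  have h3 : (0 : ℝ) < k.1.natAbs := by exact_mod_cast Int.natAbs_pos.2 k.2
  simp only [Function.comp_apply]
  rw [← Int.cast_abs, ← Nat.cast_natAbs, ← ENNReal.ofReal_rpow_of_pos h3, ENNReal.ofReal_natCast]

set_option maxHeartbeats 400000 in
theorem exists_concentrated_one_one (hp : Function.Injective p) {N : ℕ} (hN : 0 < N)
    (hNS : Nat.Coprime N (∏ i, p i)) :
    ∃ C : ℝ≥0∞, C ≠ ∞ ∧ ∀ (φ : Profile p 1 1) (w : Fin 1 → ℚ) (F : Fin 1 → Set (Fin 1 → SAdele p))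
      (Q : Set (Fin 1 → ZS p)), w 0 ∈ ZS p → (∀ a, IsGoodTile N (F a)) → (0 : Fin 1 → ZS p) ∉ Q →
      1 ≤ φ.V → φ.V ≠ ∞ →
      Concentrated (tileMeasure F) (φ.count N w Q) (φ.mean N Q) φ.V C (1 / 2) := by
  set S : ℝ≥0∞ := ∑' x : CoprimePair, (x.height : ℝ≥0∞) ^ (-(5 / 2) : ℝ) with hS
  have hS' : S ≠ ∞ := CoprimePair.tsum_height_rpow_ne_top
  set R : ℝ≥0∞ := ∑' k : {k : ℤ // k ≠ 0}, (k.1.natAbs : ℝ≥0∞) ^ (-(3 / 2) : ℝ) with hR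
  have hR' : R ≠ ∞ := tsum_ne_zero_natAbs_rpow_ne_top
  set C : ℝ≥0∞ := 2 ^ 2 * R + (2 ^ 2 * (2 * S) + N * (2 * 2 ^ 2 * (2 ^ 2 * R))) with hC
  refine ⟨C, ?_, fun φ w F Q hw hF hQ hV1 hV => ?_⟩
  · have h2 : ∀ j : ℕ, (2 : ℝ≥0∞) ^ j ≠ ∞ := fun j => ENNReal.pow_ne_top (by simp)
    have h3 : (2 : ℝ≥0∞) ≠ ∞ := by simp
    exact ENNReal.add_ne_top.2 ⟨ENNReal.mul_ne_top (h2 _) hR', ENNReal.add_ne_top.2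
      ⟨ENNReal.mul_ne_top (h2 _) (ENNReal.mul_ne_top h3 hS'),
        ENNReal.mul_ne_top (ENNReal.natCast_ne_top N) (ENNReal.mul_ne_top
          (ENNReal.mul_ne_top h3 (h2 _)) (ENNReal.mul_ne_top (h2 _) hR'))⟩⟩
  have hprob := isProbabilityMeasure_tileMeasure hF
  have hV0 : φ.V ≠ 0 := (zero_lt_one.trans_le hV1).ne'
  have hVr : 1 ≤ φ.V.toReal := by
    rw [← ENNReal.toReal_one]; exact ENNReal.toReal_mono hV hV1
  set D : ℕ := ⌈φ.V.toReal⌉₊ with hD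
  have hD1 : φ.V ≤ D := by
    rw [← ENNReal.ofReal_toReal hV, ← ENNReal.ofReal_natCast]
    exact ENNReal.ofReal_le_ofReal (Nat.le_ceil _)
  have hD2 : (D : ℝ≥0∞) ≤ 2 * φ.V := by
    rw [← ENNReal.ofReal_toReal hV, ← ENNReal.ofReal_natCast, ← ENNReal.ofReal_ofNat,
      ← ENNReal.ofReal_mul (by norm_num)]
    refine ENNReal.ofReal_le_ofReal ?_
    have := (Nat.ceil_lt_add_one (zero_le_one.trans hVr)).le
    linarith
  have hD0 : (D : ℝ≥0∞) ≠ 0 := (zero_lt_one.trans_le (hV1.trans hD1)).ne'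
  have hDt : (D : ℝ≥0∞) ≠ ∞ := ENNReal.natCast_ne_top D
  have rV : φ.V * φ.V ^ (1 / 2 : ℝ) = φ.V ^ (2 - 1 / 2 : ℝ) := by
    nth_rewrite 1 [← ENNReal.rpow_one φ.V]
    rw [← ENNReal.rpow_add _ _ hV0 hV]
    norm_num
  have hdiag : (∑' x, if x.1.height < D then φ.diagTerm x else 0)
      ≤ 2 ^ 2 * (2 * S) * φ.V ^ (2 - 1 / 2 : ℝ) := by
    refine (φ.tsum_low_diagTerm_le hp one_pos D).trans ?_
    have h1 : ∀ x : CoprimePair, (if x.height < D then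
        2 ^ (1 + 1) * ((x.height : ℝ≥0∞)⁻¹ ^ (1 + 1) * φ.V) else 0)
        ≤ 2 ^ 2 * ((D : ℝ≥0∞) ^ (1 / 2 : ℝ) * φ.V) * (x.height : ℝ≥0∞) ^ (-(5 / 2) : ℝ) := by
      intro x
      split_ifs with h
      swap
      · exact zero_le
      have hx0 : (x.height : ℝ≥0∞) ≠ 0 := by exact_mod_cast x.height_pos.ne'
      have h2 : (x.height : ℝ≥0∞)⁻¹ ^ (1 + 1)
          = (x.height : ℝ≥0∞) ^ (1 / 2 : ℝ) * (x.height : ℝ≥0∞) ^ (-(5 / 2) : ℝ) := by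
        rw [← ENNReal.rpow_add _ _ hx0 (ENNReal.natCast_ne_top _), ← ENNReal.rpow_natCast,
          ENNReal.inv_rpow, ← ENNReal.rpow_neg]
        norm_num
      have h3 : (x.height : ℝ≥0∞) ^ (1 / 2 : ℝ) ≤ (D : ℝ≥0∞) ^ (1 / 2 : ℝ) :=
        ENNReal.rpow_le_rpow (by exact_mod_cast h.le) (by norm_num)
      calc _ = 2 ^ 2 * ((x.height : ℝ≥0∞) ^ (1 / 2 : ℝ) * φ.V)
            * (x.height : ℝ≥0∞) ^ (-(5 / 2) : ℝ) := by rw [h2]; ring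
        _ ≤ _ := by gcongr
    refine (ENNReal.tsum_le_tsum h1).trans ?_
    rw [ENNReal.tsum_mul_left]
    have h4 : (D : ℝ≥0∞) ^ (1 / 2 : ℝ) ≤ 2 * φ.V ^ (1 / 2 : ℝ) := by
      refine (ENNReal.rpow_le_rpow hD2 (by norm_num)).trans ?_
      rw [ENNReal.mul_rpow_of_nonneg _ _ (by norm_num)]
      gcongr
      nth_rewrite 2 [← ENNReal.rpow_one 2]
      exact ENNReal.rpow_le_rpow_of_exponent_le (by norm_num) (by norm_num)
    calc _ ≤ 2 ^ 2 * (2 * φ.V ^ (1 / 2 : ℝ) * φ.V) * S := by gcongr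
      _ = 2 ^ 2 * (2 * S) * (φ.V * φ.V ^ (1 / 2 : ℝ)) := by ring
      _ = _ := by rw [rV]
  have hexc : ∫⁻ r, φ.excess D r ∂(ProbabilityTheory.cond volume (F 0))
      ≤ 2 ^ 2 * R * φ.V ^ (1 / 2 : ℝ) := by
    refine (φ.lintegral_excess_le hp hN hNS (hF 0) one_pos).trans ?_
    have h1 : ∀ k : {k : ℤ // k ≠ 0},
        2 ^ (1 + 1) * (((max k.1.natAbs D : ℕ) : ℝ≥0∞)⁻¹ ^ (1 + 1) * φ.V)
        ≤ 2 ^ 2 * ((D : ℝ≥0∞) ^ (-(1 / 2) : ℝ) * φ.V) * (k.1.natAbs : ℝ≥0∞) ^ (-(3 / 2) : ℝ) := by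
      intro k
      have hk : 0 < k.1.natAbs := Int.natAbs_pos.2 k.2
      set M := max k.1.natAbs D with hM
      have hM0 : (M : ℝ≥0∞) ≠ 0 := by exact_mod_cast (lt_max_of_lt_left hk).ne'
      have h2 : (M : ℝ≥0∞)⁻¹ ^ (1 + 1)
          = (M : ℝ≥0∞) ^ (-(1 / 2) : ℝ) * (M : ℝ≥0∞) ^ (-(3 / 2) : ℝ) := by
        rw [← ENNReal.rpow_add _ _ hM0 (ENNReal.natCast_ne_top _), ← ENNReal.rpow_natCast,
          ENNReal.inv_rpow, ← ENNReal.rpow_neg]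
        norm_num
      have h3 : (M : ℝ≥0∞) ^ (-(1 / 2) : ℝ) ≤ (D : ℝ≥0∞) ^ (-(1 / 2) : ℝ) :=
        ENNReal.rpow_neg_le_rpow_neg (by exact_mod_cast le_max_right _ _) (by norm_num)
      have h4 : (M : ℝ≥0∞) ^ (-(3 / 2) : ℝ) ≤ (k.1.natAbs : ℝ≥0∞) ^ (-(3 / 2) : ℝ) :=
        ENNReal.rpow_neg_le_rpow_neg (by exact_mod_cast le_max_left _ _) (by norm_num)
      rw [h2]
      calc _ ≤ 2 ^ 2 * (((D : ℝ≥0∞) ^ (-(1 / 2) : ℝ) * (k.1.natAbs : ℝ≥0∞) ^ (-(3 / 2) : ℝ))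
            * φ.V) := by gcongr
        _ = _ := by ring
    refine (ENNReal.tsum_le_tsum h1).trans ?_
    rw [ENNReal.tsum_mul_left]
    have h4 : (D : ℝ≥0∞) ^ (-(1 / 2) : ℝ) ≤ φ.V ^ (-(1 / 2) : ℝ) :=
      ENNReal.rpow_neg_le_rpow_neg hD1 (by norm_num)
    have h5 : φ.V ^ (-(1 / 2) : ℝ) * φ.V = φ.V ^ (1 / 2 : ℝ) := by
      nth_rewrite 2 [← ENNReal.rpow_one φ.V]
      rw [← ENNReal.rpow_add _ _ hV0 hV]
      norm_num
    calc _ ≤ 2 ^ 2 * (φ.V ^ (-(1 / 2) : ℝ) * φ.V) * R := by gcongr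
      _ = _ := by rw [h5]; ring
  obtain ⟨a, haN, ha⟩ := ZS.exists_nat_lt_sub_div_mem hN hNS hw
  have hcount : ∀ A, φ.count N w Q A = ∑' q : Q, rowSum N (φ.box q.1) q.1 ((a : ℕ) : ℚ) (A 0) := by
    intro A
    refine tsum_congr fun q => ?_
    have h1 : w 0 = (a : ℕ) + N * ((⟨_, ha⟩ : ZS p) : ℚ) := by
      have : (N : ℚ) ≠ 0 := by exact_mod_cast hN.ne'
      simp only; field_simp; ring
    simp only [Profile.hits, Finset.univ_unique, Fin.default_eq_zero, Finset.prod_singleton]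
    rw [h1, rowSum_add_mul]
  have hmean := φ.mean_le hp one_pos hN hQ
  have hmean' : φ.mean N Q ≠ ∞ :=
    ne_top_of_le_ne_top (ENNReal.mul_ne_top (ENNReal.pow_ne_top (by simp)) hV) hmean
  have hlow : ∀ i : Fin N, φ.mean N Q ≤ ∫⁻ r, φ.trimmed N ((i : ℕ) : ℚ) Q D r
      ∂(ProbabilityTheory.cond volume (F 0)) + 2 ^ 2 * R * φ.V ^ (1 / 2 : ℝ) := by
    intro i
    rw [← φ.lintegral_count hp hN hNS hF (fun _ => ((i : ℕ) : ℚ)) hQ]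
    refine le_trans ?_ (add_le_add le_rfl hexc)
    rw [← lintegral_add_left (φ.measurable_trimmed N _ Q D),
      ← lintegral_tileMeasure_one hF
        (f := fun r => φ.trimmed N ((i : ℕ) : ℚ) Q D r + φ.excess D r)
        ((φ.measurable_trimmed N _ Q D).add (φ.measurable_excess D))]
    refine lintegral_mono fun A => le_trans (le_of_eq (tsum_congr fun q => ?_))
      (φ.tsum_rowSum_le hN _ Q D (A 0))
    simp only [Profile.hits, Finset.univ_unique, Fin.default_eq_zero, Finset.prod_singleton]
  have hprob0 := (hF 0).isProbabilityMeasure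
  have hkey := sum_lintegral_sq_tsub_le (P := ProbabilityTheory.cond volume (F 0))
    (X := fun (i : Fin N) r => φ.trimmed N ((i : ℕ) : ℚ) Q D r)
    (fun i => φ.measurable_trimmed N _ Q D) hmean'
    (by
      rw [Fintype.card_fin]
      exact φ.sum_lintegral_trimmed_sq_le hp hN hNS (hF 0) D hQ fun q _ q' _ b b' => by
        rw [Subsingleton.elim b b']) hlow
  refine ⟨fun A => φ.trimmed N ((a : ℕ) : ℚ) Q D (A 0), fun A => φ.excess D (A 0),
    (φ.measurable_trimmed N _ Q D).comp (measurable_pi_apply 0),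
    (φ.measurable_excess D).comp (measurable_pi_apply 0),
    fun A => (φ.trimmed_le N _ Q D (A 0)).trans_eq (hcount A).symm,
    fun A => (hcount A).trans_le (φ.tsum_rowSum_le hN _ Q D (A 0)), ?_, ?_⟩
  · rw [lintegral_tileMeasure_one hF (φ.measurable_excess D)]
    refine hexc.trans ?_
    rw [show (1 - 1 / 2 : ℝ) = 1 / 2 by norm_num]
    exact mul_le_mul' le_self_add le_rfl
  · have hmZ := φ.measurable_trimmed N ((a : ℕ) : ℚ) Q D
    rw [lintegral_tileMeasure_one hF
      (f := fun r => (φ.trimmed N ((a : ℕ) : ℚ) Q D r - φ.mean N Q) ^ 2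
        + (φ.mean N Q - φ.trimmed N ((a : ℕ) : ℚ) Q D r) ^ 2)
      (((hmZ.sub measurable_const).pow_const 2).add ((measurable_const.sub hmZ).pow_const 2))]
    have hsingle : ∀ (f : Fin N → ℝ≥0∞) (i : Fin N), f i ≤ ∑ j, f j := fun f i =>
      Finset.single_le_sum (fun _ _ => zero_le) (Finset.mem_univ i)
    refine le_trans ?_ (((hsingle _ ⟨a, haN⟩).trans hkey).trans ?_)
    · exact le_rfl
    rw [Fintype.card_fin]
    calc _ ≤ 2 ^ 2 * (2 * S) * φ.V ^ (2 - 1 / 2 : ℝ)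
          + N * (2 * (2 ^ (1 + 1) * φ.V) * (2 ^ 2 * R * φ.V ^ (1 / 2 : ℝ))) := by gcongr
      _ = (2 ^ 2 * (2 * S) + N * (2 * 2 ^ 2 * (2 ^ 2 * R))) * φ.V ^ (2 - 1 / 2 : ℝ) := by
        rw [← rV]; ring
      _ ≤ _ := by
        rw [hC]
        exact mul_le_mul' le_add_self le_rfl

end

section

open Set
open scoped ENNReal NNReal

theorem Concentrated.measure_le {Ω : Type*} [MeasurableSpace Ω] {P : Measure Ω} {X : Ω → ℝ≥0∞}
    {e V C : ℝ≥0∞} {κ : ℝ} (h : Concentrated P X e V C κ) (hV0 : V ≠ 0) (hV : V ≠ ∞)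
    {τ : ℝ≥0∞} (hτ0 : τ ≠ 0) (hτ : τ ≠ ∞) :
    P {ω | e + 2 * (τ * V) < X ω ∨ X ω + τ * V < e} ≤ (C / τ + C / τ ^ 2) * V ^ (-κ) := by
  obtain ⟨Z, Y, hZ, hY, hZX, hXZ, h1, h2⟩ := h
  have ht0 : τ * V ≠ 0 := mul_ne_zero hτ0 hV0
  have ht : τ * V ≠ ∞ := ENNReal.mul_ne_top hτ hV
  have hsub : {ω | e + 2 * (τ * V) < X ω ∨ X ω + τ * V < e}
      ⊆ {ω | τ * V ≤ Y ω} ∪ {ω | (τ * V) ^ 2 ≤ (Z ω - e) ^ 2 + (e - Z ω) ^ 2} := by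
    rintro ω (hω | hω)
    · by_cases hYt : τ * V ≤ Y ω
      · exact Or.inl hYt
      · right
        change (τ * V) ^ 2 ≤ _
        refine le_add_right (pow_le_pow_left' ?_ 2)
        by_contra! hc
        have h3 : Z ω ≤ e + τ * V := tsub_le_iff_left.1 hc.le
        refine absurd hω (not_lt.2 ((hXZ ω).trans ((add_le_add h3 (not_le.1 hYt).le).trans_eq ?_)))
        ring
    · right
      change (τ * V) ^ 2 ≤ _
      refine le_add_left (pow_le_pow_left' ?_ 2)
      refine ENNReal.le_sub_of_add_le_left (ne_top_of_lt (lt_of_le_of_lt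
        ((hZX ω).trans le_self_add) hω)) ((add_le_add (hZX ω) le_rfl).trans hω.le)
  have hmeas : Measurable fun ω => (Z ω - e) ^ 2 + (e - Z ω) ^ 2 :=
    ((hZ.sub measurable_const).pow_const 2).add ((measurable_const.sub hZ).pow_const 2)
  have m1 : P {ω | τ * V ≤ Y ω} ≤ C / τ * V ^ (-κ) := by
    refine (meas_ge_le_lintegral_div hY.aemeasurable ht0 ht).trans ?_
    refine (ENNReal.div_le_div_right h1 _).trans_eq ?_
    have : V ^ (1 - κ) = V ^ (-κ) * V := by
      nth_rewrite 3 [← ENNReal.rpow_one V]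
      rw [← ENNReal.rpow_add _ _ hV0 hV]; congr 1; ring
    rw [this, ← mul_assoc, ENNReal.mul_div_mul_right _ _ hV0 hV]
    simp only [div_eq_mul_inv]; ring
  have m2 : P {ω | (τ * V) ^ 2 ≤ (Z ω - e) ^ 2 + (e - Z ω) ^ 2} ≤ C / τ ^ 2 * V ^ (-κ) := by
    refine (meas_ge_le_lintegral_div hmeas.aemeasurable (pow_ne_zero 2 ht0)
      (ENNReal.pow_ne_top ht)).trans ?_
    refine (ENNReal.div_le_div_right h2 _).trans_eq ?_
    have : V ^ (2 - κ) = V ^ (-κ) * V ^ 2 := by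
      rw [← ENNReal.rpow_natCast, ← ENNReal.rpow_add _ _ hV0 hV]; congr 1; push_cast; ring
    rw [this, mul_pow, ← mul_assoc, ENNReal.mul_div_mul_right _ _ (pow_ne_zero 2 hV0)
      (ENNReal.pow_ne_top hV)]
    simp only [div_eq_mul_inv]; ring
  rw [add_mul]
  exact (measure_mono hsub).trans ((measure_union_le _ _).trans (add_le_add m1 m2))

variable {s : ℕ} {p : Fin s → ℕ} [∀ i, Fact (p i).Prime] {m n : ℕ}
  [∀ i, MeasurableSpace ℚ_[p i]] [∀ i, BorelSpace ℚ_[p i]]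

theorem exists_concentrated (hp : Function.Injective p) {N : ℕ} (hN : 0 < N)
    (hNS : Nat.Coprime N (∏ i, p i)) (hm : 0 < m) (hn : 0 < n) :
    ∃ C : ℝ≥0∞, C ≠ ∞ ∧ ∀ (φ : Profile p m n) (w : Fin m → ℚ) (F : Fin m → Set (Fin n → SAdele p))
      (Q : Set (Fin n → ZS p)), (∀ a, w a ∈ ZS p) → (∀ a, IsGoodTile N (F a)) →
      (0 : Fin n → ZS p) ∉ Q → 1 ≤ φ.V → φ.V ≠ ∞ →
      Concentrated (tileMeasure F) (φ.count N w Q) (φ.mean N Q) φ.V C (1 / (m + 1)) := by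
  by_cases h : 3 ≤ m + n
  · obtain ⟨C, hC, H⟩ := exists_concentrated_of_three_le hp hN hNS hm hn h
    exact ⟨C, hC, fun φ w F Q _ => H φ w F Q⟩
  · obtain rfl : m = 1 := by omega
    obtain rfl : n = 1 := by omega
    obtain ⟨C, hC, H⟩ := exists_concentrated_one_one hp hN hNS
    refine ⟨C, hC, fun φ w F Q hw => ?_⟩
    have := H φ w F Q (hw 0)
    norm_num at this ⊢
    exact this

/-- The nonzero integral vectors in the residue class of `v` modulo `N`. -/
def cosetVecs (p : Fin s → ℕ) [∀ i, Fact (p i).Prime] (N : ℕ) (v : Fin n → ℚ) :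
    Set (Fin n → ZS p) :=
  {q | q ≠ 0 ∧ ∀ b, ((q b : ℚ) - v b) / N ∈ ZS p}

theorem zero_notMem_cosetVecs (N : ℕ) (v : Fin n → ℚ) : (0 : Fin n → ZS p) ∉ cosetVecs p N v :=
  fun h => h.1 rfl

/-- The asymptotic density of solutions. -/
def kgDensity (m n N : ℕ) : ℝ≥0∞ := 2 ^ m / N ^ (m + n)

theorem kgDensity_ne_zero (m n N : ℕ) : kgDensity m n N ≠ 0 := by
  refine ENNReal.div_ne_zero.2 ⟨pow_ne_zero _ two_ne_zero, ?_⟩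
  exact ENNReal.pow_ne_top (ENNReal.natCast_ne_top N)

theorem kgDensity_ne_top (m n : ℕ) {N : ℕ} (hN : 0 < N) : kgDensity m n N ≠ ∞ :=
  ENNReal.div_ne_top (ENNReal.pow_ne_top (by simp)) (pow_ne_zero _ (by exact_mod_cast hN.ne'))

theorem kgDensity_eq (m n : ℕ) {N : ℕ} :
    kgDensity m n N = (2 / (N : ℝ≥0∞)) ^ m * (N : ℝ≥0∞)⁻¹ ^ n := by
  rw [kgDensity, pow_add, div_eq_mul_inv, div_eq_mul_inv, mul_pow, ENNReal.mul_inv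
    (Or.inr (ENNReal.pow_ne_top (ENNReal.natCast_ne_top N)))
      (Or.inl (ENNReal.pow_ne_top (ENNReal.natCast_ne_top N))), mul_assoc]
  simp only [ENNReal.inv_pow]

namespace Profile

variable (φ : Profile p m n)

theorem mean_eq (N : ℕ) (Q : Set (Fin n → ZS p)) :
    φ.mean N Q = (2 / (N : ℝ≥0∞)) ^ m * ∑' q : Q, φ.wt q.1 := ENNReal.tsum_mul_left

theorem tsum_wt_cosetVecs_le {N : ℕ} (hN : 0 < N) (v : Fin n → ℚ) :
    ∑' q : cosetVecs p N v, φ.wt q.1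
      ≤ ∑' f : Fin n → ZS p, ∏ u, φ.G u (fun b => emb p (v b + N * f b) u) := by
  have hN' : (N : ℚ) ≠ 0 := by exact_mod_cast hN.ne'
  let ι : cosetVecs p N v → (Fin n → ZS p) := fun q b => ⟨_, q.2.2 b⟩
  have hι : ∀ (q : cosetVecs p N v) b, v b + N * (ι q b : ℚ) = q.1 b := fun q b => by
    change v b + N * (((q.1 b : ℚ) - v b) / N) = _
    field_simp; ring
  have hinj : Function.Injective ι := fun q q' h => Subtype.ext (funext fun b => Subtype.ext (by
    rw [← hι q b, ← hι q' b, h]))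
  refine le_trans (le_of_eq (tsum_congr fun q => ?_)) (ENNReal.tsum_comp_le_tsum_of_injective hinj _)
  simp only [hι]
  rfl

theorem le_tsum_wt_cosetVecs {N : ℕ} (hN : 0 < N) {v : Fin n → ℚ} (hv : ∀ b, v b ∈ ZS p) :
    ∑' f : Fin n → ZS p, ∏ u, φ.G u (fun b => emb p (v b + N * f b) u)
      ≤ ∑' q : cosetVecs p N v, φ.wt q.1 + 1 := by
  classical
  have hN' : (N : ℚ) ≠ 0 := by exact_mod_cast hN.ne'
  let c : (Fin n → ZS p) → (Fin n → ZS p) := fun f b =>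
    ⟨v b + N * f b, add_mem (hv b) (mul_mem (natCast_mem _ N) (f b).2)⟩
  have hinj : Function.Injective c := fun f f' h => funext fun b => Subtype.ext (by
    have h1 : v b + N * (f b : ℚ) = v b + N * (f' b : ℚ) := congrArg Subtype.val (congrFun h b)
    exact mul_left_cancel₀ hN' (add_left_cancel h1))
  have hwt : ∀ f : Fin n → ZS p, ∏ u, φ.G u (fun b => emb p (v b + N * f b) u) = φ.wt (c f) :=
    fun _ => rfl
  have hle : ∀ f, φ.wt (c f) ≤ (cosetVecs p N v).indicator φ.wt (c f)
      + (if c f = 0 then 1 else 0) := by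
    intro f
    split_ifs with h
    · exact (φ.wt_le_one _).trans le_add_self
    · rw [indicator_of_mem, add_zero]
      refine ⟨h, fun b => ?_⟩
      have : ((c f b : ℚ) - v b) / N = f b := by
        change (v b + N * (f b : ℚ) - v b) / N = f b
        field_simp; ring
      rw [this]
      exact (f b).2
  simp only [hwt]
  refine (ENNReal.tsum_le_tsum hle).trans ?_
  rw [ENNReal.tsum_add]
  refine add_le_add ?_ ?_
  · rw [tsum_subtype]
    exact ENNReal.tsum_comp_le_tsum_of_injective hinj ((cosetVecs p N v).indicator φ.wt)
  · exact (ENNReal.tsum_comp_le_tsum_of_injective hinj (fun q => if q = 0 then 1 else 0)).trans_eq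
      (tsum_ite_eq 0 _)

theorem mean_cosetVecs_le (hp : Function.Injective p) {N : ℕ} (hN : 0 < N)
    (hNS : Nat.Coprime N (∏ i, p i)) (hn : 0 < n) (v : Fin n → ℚ) {δ : ℝ} (hδ : 0 < δ) :
    φ.mean N (cosetVecs p N v) ≤ ENNReal.ofReal (1 + δ) ^ n * (kgDensity m n N * φ.V)
      + (2 / (N : ℝ≥0∞)) ^ m * ENNReal.ofReal (1 + δ⁻¹) ^ n := by
  rw [φ.mean_eq]
  have h := (φ.tsum_wt_cosetVecs_le hN v).trans (tsum_prod_coset_le hp hN hNS hn φ.normAntitone_G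
    (fun _ _ => ENNReal.ofReal_ne_top) v hδ)
  have h0 : ∏ u, φ.G u 0 ≤ 1 := Finset.prod_le_one' fun u _ => ENNReal.ofReal_le_one.2 (φ.le_one u _)
  refine (mul_le_mul' le_rfl (h.trans (add_le_add le_rfl (mul_le_of_le_one_right' h0)))).trans_eq ?_
  rw [kgDensity_eq, div_eq_mul_inv (ENNReal.ofReal _), mul_pow, mul_add]
  change _ * (_ * φ.V) + _ = _
  ring

theorem le_mean_cosetVecs (hp : Function.Injective p) {N : ℕ} (hN : 0 < N)
    (hNS : Nat.Coprime N (∏ i, p i)) (hn : 0 < n) {v : Fin n → ℚ} (hv : ∀ b, v b ∈ ZS p)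
    (hsupp : ∀ u, ∃ R : ℝ, ∀ y, R < ‖y‖ → φ.G u y = 0) {δ : ℝ} (hδ : 0 < δ) :
    kgDensity m n N * φ.V ≤ ENNReal.ofReal (1 + δ) ^ n * φ.mean N (cosetVecs p N v)
      + (2 / (N : ℝ≥0∞)) ^ m * (ENNReal.ofReal (1 + δ) ^ n + ENNReal.ofReal (1 + δ⁻¹) ^ n) := by
  have hN0 : (N : ℝ≥0∞) ≠ 0 := by exact_mod_cast hN.ne'
  have h0 : ∏ u, φ.G u 0 ≤ 1 := Finset.prod_le_one' fun u _ => ENNReal.ofReal_le_one.2 (φ.le_one u _)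
  have h := (prod_lintegral_le_tsum_coset hp hN hNS hn φ.normAntitone_G
    (fun _ _ => ENNReal.ofReal_ne_top) hsupp v hδ).trans
    (add_le_add (mul_le_mul' le_rfl (φ.le_tsum_wt_cosetVecs hN hv)) (mul_le_of_le_one_right' h0))
  have hNN : (N : ℝ≥0∞)⁻¹ ^ n * (N : ℝ≥0∞) ^ n = 1 := by
    rw [← mul_pow, ENNReal.inv_mul_cancel hN0 (ENNReal.natCast_ne_top N), one_pow]
  rw [φ.mean_eq, kgDensity_eq]
  refine (mul_le_mul' le_rfl h).trans_eq ?_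
  set S := ∑' q : cosetVecs p N v, φ.wt q.1
  calc _ = ((N : ℝ≥0∞)⁻¹ ^ n * (N : ℝ≥0∞) ^ n) * (2 / (N : ℝ≥0∞)) ^ m
        * (ENNReal.ofReal (1 + δ) ^ n * (S + 1) + ENNReal.ofReal (1 + δ⁻¹) ^ n) := by
        rw [mul_pow, mul_pow]; ring
    _ = _ := by rw [hNN]; ring

end Profile

end

section

open Set
open scoped ENNReal NNReal

variable {s : ℕ} {p : Fin s → ℕ} [∀ i, Fact (p i).Prime] {m n : ℕ}
  [∀ i, MeasurableSpace ℚ_[p i]] [∀ i, BorelSpace ℚ_[p i]]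

theorem exists_one_add_pow_le (n : ℕ) {ε : ℝ} (hε : 0 < ε) :
    ∃ δ : ℝ, 0 < δ ∧ ENNReal.ofReal (1 + δ) ^ n ≤ ENNReal.ofReal (1 + ε) := by
  refine ⟨min 1 (ε / 2 ^ n), lt_min one_pos (by positivity), ?_⟩
  have h0 : 0 ≤ min 1 (ε / 2 ^ n) := le_min zero_le_one (by positivity)
  rw [← ENNReal.ofReal_pow (by linarith)]
  refine ENNReal.ofReal_le_ofReal ((one_add_pow_le_one_add_mul h0 (min_le_left _ _) n).trans ?_)
  have h1 : (1 : ℝ) ≤ 2 ^ n := one_le_pow₀ (by norm_num)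
  have h2 := mul_le_mul_of_nonneg_left (min_le_right 1 (ε / 2 ^ n)) (zero_le_one.trans h1)
  rw [mul_div_cancel₀ _ (by positivity)] at h2
  nlinarith

theorem exists_mean_cosetVecs_le (hp : Function.Injective p) {N : ℕ} (hN : 0 < N)
    (hNS : Nat.Coprime N (∏ i, p i)) (hn : 0 < n) {ε : ℝ} (hε : 0 < ε) :
    ∃ K : ℝ≥0∞, K ≠ ∞ ∧ ∀ (φ : Profile p m n) (v : Fin n → ℚ), (∀ b, v b ∈ ZS p) →
      φ.mean N (cosetVecs p N v) ≤ ENNReal.ofReal (1 + ε) * (kgDensity m n N * φ.V) + K ∧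
      ((∀ u, ∃ R : ℝ, ∀ y, R < ‖y‖ → φ.G u y = 0) →
        kgDensity m n N * φ.V ≤ ENNReal.ofReal (1 + ε) * φ.mean N (cosetVecs p N v) + K) := by
  obtain ⟨δ, hδ, h⟩ := exists_one_add_pow_le n hε
  have hN0 : (N : ℝ≥0∞) ≠ 0 := by exact_mod_cast hN.ne'
  refine ⟨(2 / (N : ℝ≥0∞)) ^ m * (ENNReal.ofReal (1 + δ) ^ n + ENNReal.ofReal (1 + δ⁻¹) ^ n),
    ENNReal.mul_ne_top (ENNReal.pow_ne_top (ENNReal.div_ne_top (by simp) hN0))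
      (ENNReal.add_ne_top.2 ⟨ENNReal.pow_ne_top ENNReal.ofReal_ne_top,
        ENNReal.pow_ne_top ENNReal.ofReal_ne_top⟩), fun φ v hv => ⟨?_, fun hsupp => ?_⟩⟩
  · exact (φ.mean_cosetVecs_le hp hN hNS hn v hδ).trans
      (add_le_add (mul_le_mul' h le_rfl) (mul_le_mul' le_rfl le_add_self))
  · exact (φ.le_mean_cosetVecs hp hN hNS hn hv hsupp hδ).trans
      (add_le_add (mul_le_mul' h le_rfl) le_rfl)

theorem lower_tail_arith {c V X e K ε : ℝ} (hc : 0 < c) (hV : 0 < V) (hε : 0 < ε)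
    {τ : ℝ} (hτ : τ = ε / 2 / (2 * ((1 + ε) * (2 + ε / 2))) * c) (hK : K ≤ τ * V)
    (h1 : (1 + ε) * X < c * V) (h2 : c * V ≤ (1 + ε / 2) * e + K) : X + τ * V < e := by
  by_contra! h3
  have h4 : c * V ≤ (1 + ε / 2) * X + (2 + ε / 2) * (τ * V) := by nlinarith
  have h5 : (1 + ε) * ((2 + ε / 2) * (τ * V)) = ε / 4 * (c * V) := by
    rw [hτ]; field_simp; ring
  have h6 : 0 < c * V := mul_pos hc hV
  have h7 := mul_le_mul_of_nonneg_left h4 (by linarith : 0 ≤ 1 + ε)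
  nlinarith

theorem exists_tail_bound (hp : Function.Injective p) {N : ℕ} (hN : 0 < N)
    (hNS : Nat.Coprime N (∏ i, p i)) (hm : 0 < m) (hn : 0 < n) {ε : ℝ} (hε : 0 < ε) :
    ∃ C : ℝ≥0∞, C ≠ ∞ ∧ ∀ (φ : Profile p m n) (w : Fin m → ℚ) (v : Fin n → ℚ)
      (F : Fin m → Set (Fin n → SAdele p)), (∀ a, w a ∈ ZS p) → (∀ b, v b ∈ ZS p) →
      (∀ a, IsGoodTile N (F a)) → 1 ≤ φ.V → φ.V ≠ ∞ →
      tileMeasure F {A | ENNReal.ofReal (1 + ε) * (kgDensity m n N * φ.V)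
        < φ.count N w (cosetVecs p N v) A} ≤ C * φ.V ^ (-(1 / (m + 1) : ℝ)) ∧
      ((∀ u, ∃ R : ℝ, ∀ y, R < ‖y‖ → φ.G u y = 0) →
        tileMeasure F {A | ENNReal.ofReal (1 + ε) * φ.count N w (cosetVecs p N v) A
          < kgDensity m n N * φ.V} ≤ C * φ.V ^ (-(1 / (m + 1) : ℝ))) := by
  obtain ⟨C, hC, H⟩ := exists_concentrated hp hN hNS hm hn
  obtain ⟨K, hK, HK⟩ := exists_mean_cosetVecs_le (m := m) hp hN hNS hn (half_pos hε)
  set c := kgDensity m n N with hcdef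
  have hc0 : c ≠ 0 := kgDensity_ne_zero m n N
  have hct : c ≠ ∞ := kgDensity_ne_top m n hN
  set r : ℝ := ε / 2 / (2 * ((1 + ε) * (2 + ε / 2))) with hr
  have hr0 : 0 < r := by positivity
  have hr3 : 3 * r ≤ ε / 2 := by
    have h : (3 : ℝ) ≤ 2 * ((1 + ε) * (2 + ε / 2)) := by nlinarith
    rw [hr, mul_div_assoc', div_le_iff₀ (by positivity)]
    nlinarith
  set τ : ℝ≥0∞ := ENNReal.ofReal r * c with hτ
  have hτ0 : τ ≠ 0 := mul_ne_zero (ENNReal.ofReal_pos.2 hr0).ne' hc0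
  have hτt : τ ≠ ∞ := ENNReal.mul_ne_top ENNReal.ofReal_ne_top hct
  have hκ : (0 : ℝ) ≤ 1 / (m + 1) := by positivity
  set C' : ℝ≥0∞ := (C / τ + C / τ ^ 2) + (K / τ) ^ (1 / (m + 1) : ℝ) with hC'
  refine ⟨C', ENNReal.add_ne_top.2 ⟨ENNReal.add_ne_top.2 ⟨ENNReal.div_ne_top hC hτ0,
    ENNReal.div_ne_top hC (pow_ne_zero 2 hτ0)⟩, ENNReal.rpow_ne_top_of_nonneg hκ
      (ENNReal.div_ne_top hK hτ0)⟩, fun φ w v F hw hv hF hV1 hV => ?_⟩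
  have hprob := isProbabilityMeasure_tileMeasure hF
  have hV0 : φ.V ≠ 0 := (zero_lt_one.trans_le hV1).ne'
  set κ : ℝ := 1 / (m + 1) with hκdef
  by_cases hsmall : τ * φ.V < K
  · have hle : φ.V ≤ K / τ := by
      rw [ENNReal.le_div_iff_mul_le (Or.inl hτ0) (Or.inl hτt), mul_comm]
      exact hsmall.le
    have h1 : 1 ≤ C' * φ.V ^ (-κ) := by
      have h2 : φ.V ^ κ * φ.V ^ (-κ) = 1 := by
        rw [← ENNReal.rpow_add _ _ hV0 hV, add_neg_cancel, ENNReal.rpow_zero]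
      rw [← h2]
      exact mul_le_mul' ((ENNReal.rpow_le_rpow hle hκ).trans le_add_self) le_rfl
    exact ⟨prob_le_one.trans h1, fun _ => prob_le_one.trans h1⟩
  rw [not_lt] at hsmall
  have hdev := (H φ w F (cosetVecs p N v) hw hF (zero_notMem_cosetVecs N v) hV1 hV).measure_le
    hV0 hV hτ0 hτt
  obtain ⟨hU, hL⟩ := HK φ v hv
  set e := φ.mean N (cosetVecs p N v) with he
  have het : e ≠ ∞ := ne_top_of_le_ne_top (ENNReal.add_ne_top.2 ⟨ENNReal.mul_ne_top
    ENNReal.ofReal_ne_top (ENNReal.mul_ne_top hct hV), hK⟩) hU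
  have hfin : (C / τ + C / τ ^ 2) * φ.V ^ (-κ) ≤ C' * φ.V ^ (-κ) := mul_le_mul' le_self_add le_rfl
  refine ⟨(measure_mono fun A hA => Or.inl ?_).trans (hdev.trans hfin),
    fun hsupp => (measure_mono fun A hA => Or.inr ?_).trans (hdev.trans hfin)⟩
  · refine lt_of_le_of_lt ?_ hA
    have h3 : 3 * τ ≤ ENNReal.ofReal (ε / 2) * c := by
      rw [hτ, ← mul_assoc]
      refine mul_le_mul' ?_ le_rfl
      rw [← ENNReal.ofReal_ofNat 3, ← ENNReal.ofReal_mul (by norm_num)]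
      exact ENNReal.ofReal_le_ofReal hr3
    calc e + 2 * (τ * φ.V) ≤ ENNReal.ofReal (1 + ε / 2) * (c * φ.V) + τ * φ.V
          + 2 * (τ * φ.V) := add_le_add (hU.trans (add_le_add le_rfl hsmall)) le_rfl
      _ = ENNReal.ofReal (1 + ε / 2) * (c * φ.V) + 3 * τ * φ.V := by ring
      _ ≤ ENNReal.ofReal (1 + ε / 2) * (c * φ.V) + ENNReal.ofReal (ε / 2) * c * φ.V :=
          add_le_add le_rfl (mul_le_mul' h3 le_rfl)
      _ = (ENNReal.ofReal (1 + ε / 2) + ENNReal.ofReal (ε / 2)) * (c * φ.V) := by ring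
      _ = _ := by
        rw [← ENNReal.ofReal_add (by positivity) (by positivity)]
        congr 2; ring
  · replace hA : ENNReal.ofReal (1 + ε) * φ.count N w (cosetVecs p N v) A < c * φ.V := hA
    have hL := hL hsupp
    set X := φ.count N w (cosetVecs p N v) A with hX
    have hε1 : ENNReal.ofReal (1 + ε) ≠ 0 := (ENNReal.ofReal_pos.2 (by linarith)).ne'
    have hXt : X ≠ ∞ := fun h => by
      rw [h, ENNReal.mul_top hε1] at hA
      exact not_top_lt hA
    have hcV : c * φ.V ≠ ∞ := ENNReal.mul_ne_top hct hV
    have hτr : τ.toReal = r * c.toReal := by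
      rw [hτ, ENNReal.toReal_mul, ENNReal.toReal_ofReal hr0.le]
    have g1 : (1 + ε) * X.toReal < c.toReal * φ.V.toReal := by
      have := (ENNReal.toReal_lt_toReal (ENNReal.mul_ne_top ENNReal.ofReal_ne_top hXt) hcV).2 hA
      rwa [ENNReal.toReal_mul, ENNReal.toReal_mul, ENNReal.toReal_ofReal (by linarith)] at this
    have g2 : c.toReal * φ.V.toReal ≤ (1 + ε / 2) * e.toReal + K.toReal := by
      have h5 : ENNReal.ofReal (1 + ε / 2) * e ≠ ∞ := ENNReal.mul_ne_top ENNReal.ofReal_ne_top het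
      have := ENNReal.toReal_mono (ENNReal.add_ne_top.2 ⟨h5, hK⟩) hL
      rwa [ENNReal.toReal_add h5 hK, ENNReal.toReal_mul, ENNReal.toReal_mul,
        ENNReal.toReal_ofReal (by linarith)] at this
    have g3 : K.toReal ≤ τ.toReal * φ.V.toReal := by
      rw [← ENNReal.toReal_mul]
      exact ENNReal.toReal_mono (ENNReal.mul_ne_top hτt hV) hsmall
    have g4 := lower_tail_arith (ENNReal.toReal_pos hc0 hct) (ENNReal.toReal_pos hV0 hV) hε
      hτr g3 g1 g2
    have g5 : τ * φ.V ≠ ∞ := ENNReal.mul_ne_top hτt hV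
    rw [← ENNReal.toReal_mul, ← ENNReal.toReal_add hXt g5,
      ENNReal.toReal_lt_toReal (ENNReal.add_ne_top.2 ⟨hXt, g5⟩) het] at g4
    exact g4

end

section

open Set
open scoped ENNReal NNReal

theorem exists_lowerSet_superset_measure_le (ρ : Measure ℝ) (L : Set ℝ) {b : ℝ≥0∞}
    (h : ∀ t ∈ L, ρ (Iic t) ≤ b) :
    ∃ D : LowerSet ℝ, (∀ t ∈ L, Iic t ⊆ (D : Set ℝ)) ∧ ρ D ≤ b := by
  by_cases hmax : ∃ t, IsGreatest L t
  · obtain ⟨t, ht, ht'⟩ := hmax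
    exact ⟨LowerSet.Iic t, fun u hu => by
      rw [LowerSet.coe_Iic]; exact Iic_subset_Iic.2 (ht' hu), by
      rw [LowerSet.coe_Iic]; exact h t ht⟩
  · obtain ⟨S, hSL, hS, hSU⟩ := TopologicalSpace.isOpen_biUnion_countable L (fun t : ℝ => Iio t)
      fun t _ => isOpen_Iio
    refine ⟨⟨⋃ t ∈ L, Iio t, isLowerSet_iUnion₂ fun t _ => isLowerSet_Iio t⟩, fun t ht x hx => ?_, ?_⟩
    · have : ∃ u ∈ L, t < u := by
        by_contra! hc
        exact hmax ⟨t, ht, hc⟩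
      obtain ⟨u, hu, htu⟩ := this
      exact mem_biUnion hu (lt_of_le_of_lt hx htu)
    · change ρ (⋃ t ∈ L, Iio t) ≤ b
      rw [← hSU, measure_biUnion_eq_iSup hS]
      · exact iSup₂_le fun t ht => (measure_mono Iio_subset_Iic_self).trans (h t (hSL ht))
      · intro x hx y hy
        rcases le_total x y with hxy | hxy
        · exact ⟨y, hy, Iio_subset_Iio hxy, subset_rfl⟩
        · exact ⟨x, hx, subset_rfl, Iio_subset_Iio hxy⟩

theorem exists_lowerSet_subset_le_measure {ρ : Measure ℝ} (hρ : ∀ t, ρ (Iic t) ≠ ∞) {L : Set ℝ}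
    (hL : L.Nonempty) (hb : BddBelow L) {a : ℝ≥0∞} (h : ∀ t ∈ L, a ≤ ρ (Iic t)) :
    ∃ D : LowerSet ℝ, (∀ t ∈ L, (D : Set ℝ) ⊆ Iic t) ∧ a ≤ ρ D := by
  have hglb := isGLB_csInf hL hb
  obtain ⟨u, hu, hxu, hlim, huL⟩ := hglb.exists_seq_antitone_tendsto hL
  refine ⟨LowerSet.Iic (sInf L), fun t ht => ?_, ?_⟩
  · rw [LowerSet.coe_Iic]
    exact Iic_subset_Iic.2 (hglb.1 ht)
  · have h1 : Iic (sInf L) = ⋂ k, Iic (u k) := by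
      ext x
      simp only [mem_Iic, mem_iInter]
      exact ⟨fun hx k => hx.trans (hxu k), fun hx => ge_of_tendsto' hlim hx⟩
    rw [LowerSet.coe_Iic, h1, Antitone.measure_iInter (fun i j hij => Iic_subset_Iic.2 (hu hij))
      (fun k => measurableSet_Iic.nullMeasurableSet) ⟨0, hρ _⟩]
    exact le_iInf fun k => h _ (huL k)

variable {s : ℕ} {p : Fin s → ℕ} [∀ i, Fact (p i).Prime] {m n : ℕ}
  [∀ i, MeasurableSpace ℚ_[p i]] [∀ i, BorelSpace ℚ_[p i]]

theorem rowSum_mono (N : ℕ) {B B' : ∀ v, Set (SField p v)} (h : ∀ v, B v ⊆ B' v)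
    (q : Fin n → ZS p) (w : ℚ) (r : Fin n → SAdele p) : rowSum N B q w r ≤ rowSum N B' q w r := by
  have hsub : boxSet B ⊆ boxSet B' := fun x (hx : ∀ v, x v ∈ B v) v => h v (hx v)
  exact ENNReal.tsum_le_tsum fun _ =>
    indicator_le_indicator_of_subset hsub (fun _ => zero_le) _

namespace Profile

theorem box_mono {φ φ' : Profile p m n} (h : ∀ v t, φ.g v t ≤ φ'.g v t) (q : Fin n → ZS p)
    (v : Option (Fin s)) : φ.box q v ⊆ φ'.box q v := fun _ hx =>
  ⟨hx.1.trans_le (h v _), hx.2.trans (h v _)⟩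

theorem hits_mono {φ φ' : Profile p m n} (h : ∀ v t, φ.g v t ≤ φ'.g v t) (N : ℕ)
    (w : Fin m → ℚ) (q : Fin n → ZS p) (A : Fin m → Fin n → SAdele p) :
    φ.hits N w q A ≤ φ'.hits N w q A :=
  Finset.prod_le_prod' fun _ _ => rowSum_mono N (box_mono h q) _ _ _

theorem count_mono {φ φ' : Profile p m n} (h : ∀ v t, φ.g v t ≤ φ'.g v t) (N : ℕ)
    (w : Fin m → ℚ) (Q : Set (Fin n → ZS p)) (A : Fin m → Fin n → SAdele p) :
    φ.count N w Q A ≤ φ'.count N w Q A :=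
  ENNReal.tsum_le_tsum fun q => hits_mono h N w q.1 A

variable (φ : Profile p m n)

/-- The profile obtained by restricting the norms of the vectors `q` to given lower sets. -/
def trunc (hm : 0 < m) (D : Option (Fin s) → LowerSet ℝ) : Profile p m n where
  g v := (D v : Set ℝ).indicator (φ.g v)
  anti v x y hxy := by
    classical
    by_cases hy : y ∈ (D v : Set ℝ)
    · rw [indicator_of_mem hy, indicator_of_mem ((D v).lower hxy hy)]
      exact φ.anti v hxy
    · rw [indicator_of_notMem hy]
      exact indicator_nonneg (fun _ _ => φ.nonneg v _) _
  nonneg v t := indicator_nonneg (fun _ _ => φ.nonneg v _) _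
  le_one v t := (indicator_le_self' (fun _ _ => φ.nonneg v _) t).trans (φ.le_one v t)
  vol v y := by
    by_cases hy : ‖y‖ ∈ (D v : Set ℝ)
    · rw [indicator_of_mem hy]
      exact φ.vol v y
    · rw [indicator_of_notMem hy]
      have : (sideOf m 0 : Set (SField p v)) = ∅ := by
        ext x; simp [sideOf]
      rw [this, measure_empty, zero_pow hm.ne', ENNReal.ofReal_zero, mul_zero]

theorem trunc_g_mono (hm : 0 < m) {D D' : Option (Fin s) → LowerSet ℝ}
    (h : ∀ v, (D v : Set ℝ) ⊆ D' v) (v : Option (Fin s)) (t : ℝ) :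
    (φ.trunc hm D).g v t ≤ (φ.trunc hm D').g v t :=
  indicator_le_indicator_of_subset (h v) (fun _ => φ.nonneg v _) t

/-- The distribution of the norm under the weight at a place. -/
def normMeasure (v : Option (Fin s)) : Measure ℝ :=
  (volume.withDensity (φ.G v)).map fun y : Fin n → SField p v => ‖y‖

theorem trunc_W (hm : 0 < m) (D : Option (Fin s) → LowerSet ℝ) (v : Option (Fin s)) :
    (φ.trunc hm D).W v = φ.normMeasure v (D v) := by
  have hD : MeasurableSet (D v : Set ℝ) := (D v).lower.ordConnected.measurableSet
  rw [normMeasure, Measure.map_apply measurable_norm hD,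
    withDensity_apply _ (measurable_norm hD), ← lintegral_indicator (measurable_norm hD)]
  refine lintegral_congr fun y => ?_
  by_cases hy : ‖y‖ ∈ (D v : Set ℝ)
  · rw [indicator_of_mem (show y ∈ (fun y => ‖y‖) ⁻¹' (D v : Set ℝ) from hy)]
    change ENNReal.ofReal ((D v : Set ℝ).indicator (φ.g v) ‖y‖) = _
    rw [indicator_of_mem hy]
    rfl
  · rw [indicator_of_notMem (show y ∉ (fun y => ‖y‖) ⁻¹' (D v : Set ℝ) from hy)]
    change ENNReal.ofReal ((D v : Set ℝ).indicator (φ.g v) ‖y‖) = _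
    rw [indicator_of_notMem hy, ENNReal.ofReal_zero]

theorem normMeasure_Iic_ne_top (v : Option (Fin s)) (t : ℝ) : φ.normMeasure v (Iic t) ≠ ∞ := by
  rw [normMeasure, Measure.map_apply measurable_norm measurableSet_Iic,
    withDensity_apply _ (measurable_norm measurableSet_Iic)]
  have h1 : (fun y : Fin n → SField p v => ‖y‖) ⁻¹' Iic t = Metric.closedBall 0 t := by
    ext y; simp
  rw [h1]
  refine ne_top_of_le_ne_top (measure_closedBall_lt_top (μ := volume) (x := (0 : Fin n → SField p v))
    (r := t)).ne ?_
  rw [← setLIntegral_one]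
  exact lintegral_mono fun y => ENNReal.ofReal_le_one.2 (φ.le_one v _)

theorem one_le_volume_unitBall : ∀ v : Option (Fin s),
    1 ≤ volume (Metric.closedBall (0 : Fin n → SField p v) 1)
  | none => by
    have h := Real.volume_pi_closedBall (ι := Fin n) (a := 0) (r := 1) zero_le_one
    refine le_of_le_of_eq ?_ h.symm
    rw [mul_one]
    exact ENNReal.one_le_ofReal.2 (one_le_pow₀ (by norm_num))
  | some i => by
    rw [closedBall_pi _ zero_le_one]
    have h := Measure.pi_pi (fun _ : Fin n => padicHaar (p i)) fun _ => Metric.closedBall 0 1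
    simp only [padicHaar_closedBall_one, Finset.prod_const_one] at h
    exact h.ge

theorem one_le_normMeasure_Iic (h1 : ∀ v t, t ≤ 1 → φ.g v t = 1) (v : Option (Fin s)) {t : ℝ}
    (ht : 1 ≤ t) : 1 ≤ φ.normMeasure v (Iic t) := by
  refine le_trans ?_ (measure_mono (Iic_subset_Iic.2 ht))
  rw [normMeasure, Measure.map_apply measurable_norm measurableSet_Iic,
    withDensity_apply _ (measurable_norm measurableSet_Iic)]
  have h2 : (fun y : Fin n → SField p v => ‖y‖) ⁻¹' Iic 1 = Metric.closedBall 0 1 := by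
    ext y; simp
  rw [h2, setLIntegral_congr_fun (g := fun _ => 1) Metric.isClosed_closedBall.measurableSet, setLIntegral_one]
  · exact one_le_volume_unitBall v
  · intro y hy
    rw [mem_closedBall_zero_iff] at hy
    change ENNReal.ofReal (φ.g v ‖y‖) = 1
    rw [h1 v _ hy, ENNReal.ofReal_one]

end Profile

end

section

open Set
open scoped ENNReal NNReal

/-- The radii whose balls have measure between two consecutive powers of `η`. -/
def levelSet (ρ : Measure ℝ) (η : ℝ≥0∞) (j : ℕ) : Set ℝ :=
  {t | 1 ≤ t ∧ η ^ j ≤ ρ (Iic t) ∧ ρ (Iic t) ≤ η ^ (j + 1)}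

theorem exists_lowerSet_sandwich {ρ : Measure ℝ} (hρ : ∀ t, ρ (Iic t) ≠ ∞) (η : ℝ≥0∞) (j : ℕ) :
    ∃ D E : LowerSet ℝ, (levelSet ρ η j).Nonempty →
      (∀ t ∈ levelSet ρ η j, (D : Set ℝ) ⊆ Iic t ∧ Iic t ⊆ (E : Set ℝ)) ∧
        η ^ j ≤ ρ D ∧ ρ E ≤ η ^ (j + 1) := by
  by_cases h : (levelSet ρ η j).Nonempty
  · obtain ⟨E, hE, hE'⟩ := exists_lowerSet_superset_measure_le ρ (levelSet ρ η j)
      (b := η ^ (j + 1)) fun t ht => ht.2.2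
    obtain ⟨D, hD, hD'⟩ := exists_lowerSet_subset_le_measure hρ h (a := η ^ j)
      ⟨1, fun t ht => ht.1⟩ fun t ht => ht.2.1
    exact ⟨D, E, fun _ => ⟨fun t ht => ⟨hD t ht, hE t ht⟩, hD', hE'⟩⟩
  · exact ⟨⊥, ⊥, fun h' => absurd h' h⟩

theorem exists_mem_levelSet {ρ : Measure ℝ} {t : ℝ} (ht : 1 ≤ t) (h1 : 1 ≤ ρ (Iic t))
    (htop : ρ (Iic t) ≠ ∞) {δ : ℝ} (hδ : 0 < δ) :
    ∃ j, t ∈ levelSet ρ (ENNReal.ofReal (1 + δ)) j := by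
  have h2 : 1 ≤ (ρ (Iic t)).toReal := by
    rw [← ENNReal.toReal_one]
    exact ENNReal.toReal_mono htop h1
  obtain ⟨j, hj, hj'⟩ := exists_nat_pow_near h2 (show 1 < 1 + δ by linarith)
  refine ⟨j, ht, ?_, ?_⟩
  · rw [← ENNReal.ofReal_pow (by linarith)]
    exact ENNReal.ofReal_le_of_le_toReal hj
  · rw [← ENNReal.ofReal_pow (by linarith)]
    exact ENNReal.le_ofReal_iff_toReal_le htop (by positivity) |>.2 hj'.le

theorem tsum_prod_pow_rpow_neg_ne_top {ι : Type*} [Fintype ι] {η : ℝ≥0∞} (hη : 1 < η)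
    {κ : ℝ} (hκ : 0 < κ) : ∑' J : ι → ℕ, (∏ v, η ^ J v) ^ (-κ) ≠ ∞ := by
  classical
  have h : ∀ J : ι → ℕ, (∏ v, η ^ J v) ^ (-κ) = ∏ v, (η ^ (-κ)) ^ J v := fun J => by
    rw [ENNReal.rpow_neg, ← ENNReal.prod_rpow_of_nonneg hκ.le, ENNReal.prod_inv_distrib]
    · refine Finset.prod_congr rfl fun v _ => ?_
      rw [ENNReal.rpow_neg, ← ENNReal.inv_pow, ← ENNReal.rpow_natCast, ← ENNReal.rpow_natCast,
        ← ENNReal.rpow_mul, ← ENNReal.rpow_mul, mul_comm]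
    · exact fun v _ u _ _ => Or.inl fun h0 =>
        pow_ne_zero _ (zero_lt_one.trans hη).ne' ((ENNReal.rpow_eq_zero_iff_of_pos hκ).1 h0)
  rw [tsum_congr h]
  have e := Fintype.equivFin ι
  rw [← (e.arrowCongr (Equiv.refl ℕ)).symm.tsum_eq]
  have h2 : ∀ J : Fin (Fintype.card ι) → ℕ,
      ∏ v, (η ^ (-κ)) ^ ((e.arrowCongr (Equiv.refl ℕ)).symm J v) = ∏ k, (η ^ (-κ)) ^ J k :=
    fun J => Fintype.prod_equiv e _ _ fun v => rfl
  rw [tsum_congr h2, ENNReal.tsum_pi_prod fun _ j => (η ^ (-κ)) ^ j]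
  refine ENNReal.prod_ne_top fun k _ => ?_
  rw [ENNReal.tsum_geometric, ENNReal.inv_ne_top]
  refine (tsub_pos_of_lt ?_).ne'
  exact ENNReal.rpow_lt_one_of_one_lt_of_neg hη (neg_neg_of_pos hκ)

variable {s : ℕ} {p : Fin s → ℕ} [∀ i, Fact (p i).Prime] {m n : ℕ}
  [∀ i, MeasurableSpace ℚ_[p i]] [∀ i, BorelSpace ℚ_[p i]]

/-- Almost surely, the counts over all boxes of large weighted volume are close to that volume. -/
theorem Profile.ae_tileMeasure_count (φ : Profile p m n) (h1 : ∀ v t, t ≤ 1 → φ.g v t = 1)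
    (hp : Function.Injective p) {N : ℕ} (hN : 0 < N) (hNS : Nat.Coprime N (∏ i, p i)) (hm : 0 < m)
    (hn : 0 < n) {ε : ℝ} (hε : 0 < ε) {w : Fin m → ℚ} (hw : ∀ a, w a ∈ ZS p) {u : Fin n → ℚ}
    (hu : ∀ b, u b ∈ ZS p) {F : Fin m → Set (Fin n → SAdele p)} (hF : ∀ a, IsGoodTile N (F a)) :
    ∀ᵐ A ∂(tileMeasure F), ∃ M : ℝ≥0∞, M ≠ ∞ ∧ ∀ R : Option (Fin s) → ℝ, (∀ v, 1 ≤ R v) →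
      M ≤ (φ.trunc hm fun v => LowerSet.Iic (R v)).V →
      (φ.trunc hm fun v => LowerSet.Iic (R v)).count N w (cosetVecs p N u) A ≤
          ENNReal.ofReal (1 + ε) *
            (kgDensity m n N * (φ.trunc hm fun v => LowerSet.Iic (R v)).V) ∧
        kgDensity m n N * (φ.trunc hm fun v => LowerSet.Iic (R v)).V ≤ ENNReal.ofReal (1 + ε) *
          (φ.trunc hm fun v => LowerSet.Iic (R v)).count N w (cosetVecs p N u) A := by
  obtain ⟨δ, hδ, hδε⟩ := exists_one_add_pow_le (s + 2) hε
  obtain ⟨C, hC, H⟩ := exists_tail_bound hp hN hNS hm hn hδ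
  set η := ENNReal.ofReal (1 + δ) with hηdef
  have hη : 1 < η := by
    rw [hηdef, ENNReal.one_lt_ofReal]
    linarith
  have hηt : η ≠ ∞ := ENNReal.ofReal_ne_top
  set c := kgDensity m n N
  choose D E hDE using fun v j => exists_lowerSet_sandwich (φ.normMeasure_Iic_ne_top v) η j
  have hV : ∀ D : Option (Fin s) → LowerSet ℝ,
      (φ.trunc hm D).V = ∏ v, φ.normMeasure v (D v) := fun D =>
    Finset.prod_congr rfl fun v _ => φ.trunc_W hm D v
  let lo (J : Option (Fin s) → ℕ) := φ.trunc hm fun v => D v (J v)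
  let hi (J : Option (Fin s) → ℕ) := φ.trunc hm fun v => E v (J v)
  let ne (J : Option (Fin s) → ℕ) : Prop := ∀ v, (levelSet (φ.normMeasure v) η (J v)).Nonempty
  let bad (J : Option (Fin s) → ℕ) : Set (Fin m → Fin n → SAdele p) :=
    {A | ne J ∧ (η * (c * (hi J).V) < (hi J).count N w (cosetVecs p N u) A ∨
      η * (lo J).count N w (cosetVecs p N u) A < c * (lo J).V)}
  have hlow : ∀ J, ne J → ∏ v, η ^ J v ≤ (lo J).V := fun J hJ => by
    rw [hV]
    exact Finset.prod_le_prod' fun v _ => (hDE v (J v) (hJ v)).2.1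
  have hhigh : ∀ J, ne J → (hi J).V ≤ η ^ (s + 1) * ∏ v, η ^ J v := fun J hJ => by
    rw [hV]
    refine (Finset.prod_le_prod' fun v _ => (hDE v (J v) (hJ v)).2.2).trans_eq ?_
    simp only [pow_succ, Finset.prod_mul_distrib, Finset.prod_const, Finset.card_univ,
      Fintype.card_option, Fintype.card_fin]
    ring
  have hsub : ∀ J : Option (Fin s) → ℕ, ∀ R : Option (Fin s) → ℝ,
      (∀ v, R v ∈ levelSet (φ.normMeasure v) η (J v)) →
      (∀ v, (D v (J v) : Set ℝ) ⊆ LowerSet.Iic (R v)) ∧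
        ∀ v, (LowerSet.Iic (R v) : Set ℝ) ⊆ E v (J v) := fun J R hR =>
    ⟨fun v => by
      rw [LowerSet.coe_Iic]
      exact ((hDE v (J v) ⟨_, hR v⟩).1 _ (hR v)).1, fun v => by
      rw [LowerSet.coe_Iic]
      exact ((hDE v (J v) ⟨_, hR v⟩).1 _ (hR v)).2⟩
  have hVmono : ∀ D D' : Option (Fin s) → LowerSet ℝ, (∀ v, (D v : Set ℝ) ⊆ D' v) →
      (φ.trunc hm D).V ≤ (φ.trunc hm D').V := fun D D' h => by
    rw [hV, hV]
    exact Finset.prod_le_prod' fun v _ => measure_mono (h v)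
  have hone : ∀ J : Option (Fin s) → ℕ, 1 ≤ ∏ v, η ^ J v := fun J =>
    Finset.one_le_prod' fun v _ => one_le_pow₀ hη.le
  have hpt : ∀ J : Option (Fin s) → ℕ, ∏ v, η ^ J v ≠ ∞ := fun J =>
    ENNReal.prod_ne_top fun v _ => ENNReal.pow_ne_top hηt
  have hsupp : ∀ J, ne J → ∀ v, ∃ R : ℝ, ∀ y, R < ‖y‖ → (lo J).G v y = 0 := fun J hJ v => by
    obtain ⟨t, ht⟩ := hJ v
    refine ⟨t, fun y hy => ?_⟩
    have hy' : ‖y‖ ∉ (D v (J v) : Set ℝ) := fun hmem =>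
      hy.not_ge (((hDE v (J v) (hJ v)).1 t ht).1 hmem)
    change ENNReal.ofReal ((D v (J v) : Set ℝ).indicator (φ.g v) ‖y‖) = 0
    rw [indicator_of_notMem hy', ENNReal.ofReal_zero]
  have hlohi : ∀ J, ne J → (lo J).V ≤ (hi J).V := fun J hJ => by
    choose R hR using hJ
    exact hVmono _ _ fun v => ((hsub J R hR).1 v).trans ((hsub J R hR).2 v)
  set κ : ℝ := 1 / (m + 1) with hκ
  have hκ0 : 0 < κ := by positivity
  have hbad : ∀ J, tileMeasure F (bad J) ≤ 2 * C * (∏ v, η ^ J v) ^ (-κ) := fun J => by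
    by_cases hJ : ne J
    · have hhit : (hi J).V ≠ ∞ :=
        ne_top_of_le_ne_top (ENNReal.mul_ne_top (ENNReal.pow_ne_top hηt) (hpt J)) (hhigh J hJ)
      have hlot : (lo J).V ≠ ∞ := ne_top_of_le_ne_top hhit (hlohi J hJ)
      have h3 := (H (hi J) w u F hw hu hF ((hone J).trans ((hlow J hJ).trans (hlohi J hJ))) hhit).1
      have h4 := (H (lo J) w u F hw hu hF ((hone J).trans (hlow J hJ)) hlot).2 (hsupp J hJ)
      have h5 : bad J ⊆ {A | η * (c * (hi J).V) < (hi J).count N w (cosetVecs p N u) A} ∪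
          {A | η * (lo J).count N w (cosetVecs p N u) A < c * (lo J).V} := fun A hA => hA.2
      refine (measure_mono h5).trans ((measure_union_le _ _).trans ((add_le_add h3 h4).trans ?_))
      rw [two_mul, add_mul]
      exact add_le_add
        (mul_le_mul' le_rfl (ENNReal.rpow_neg_le_rpow_neg ((hlow J hJ).trans (hlohi J hJ)) hκ0.le))
        (mul_le_mul' le_rfl (ENNReal.rpow_neg_le_rpow_neg (hlow J hJ) hκ0.le))
    · have : bad J = ∅ := eq_empty_of_forall_notMem fun A hA => hJ hA.1
      rw [this, measure_empty]
      exact zero_le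
  have hsum : ∑' J, tileMeasure F (bad J) ≠ ∞ := by
    refine ne_top_of_le_ne_top ?_ (ENNReal.tsum_le_tsum hbad)
    rw [ENNReal.tsum_mul_left]
    exact ENNReal.mul_ne_top (ENNReal.mul_ne_top (by simp) hC)
      (tsum_prod_pow_rpow_neg_ne_top hη hκ0)
  filter_upwards [ae_finite_setOfPred_mem hsum] with A hA
  refine ⟨∑ J ∈ hA.toFinset, η ^ (s + 1) * ∏ v, η ^ J v + 1,
    ENNReal.add_ne_top.2 ⟨ENNReal.sum_ne_top.2 fun J _ =>
      ENNReal.mul_ne_top (ENNReal.pow_ne_top hηt) (hpt J), by simp⟩, fun R hR hM => ?_⟩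
  choose J hJ using fun v => exists_mem_levelSet (hR v) (φ.one_le_normMeasure_Iic h1 v (hR v))
    (φ.normMeasure_Iic_ne_top v (R v)) hδ
  have hJne : ne J := fun v => ⟨_, hJ v⟩
  obtain ⟨hs1, hs2⟩ := hsub J R hJ
  have hVlo : (lo J).V ≤ (φ.trunc hm fun v => LowerSet.Iic (R v)).V := hVmono _ _ hs1
  have hVhi : (φ.trunc hm fun v => LowerSet.Iic (R v)).V ≤ (hi J).V := hVmono _ _ hs2
  have hgood : A ∉ bad J := fun hb => by
    have h6 : J ∈ hA.toFinset := hA.mem_toFinset.2 hb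
    have h7 : η ^ (s + 1) * ∏ v, η ^ J v ≤ ∑ J ∈ hA.toFinset, η ^ (s + 1) * ∏ v, η ^ J v :=
      Finset.single_le_sum (f := fun J : Option (Fin s) → ℕ => η ^ (s + 1) * ∏ v, η ^ J v)
        (fun _ _ => zero_le) h6
    have h8 := hM.trans (hVhi.trans ((hhigh J hJne).trans h7))
    refine absurd h8 (not_le.2 (ENNReal.lt_add_right ?_ one_ne_zero))
    exact ENNReal.sum_ne_top.2 fun J _ => ENNReal.mul_ne_top (ENNReal.pow_ne_top hηt) (hpt J)
  have hg1 : (hi J).count N w (cosetVecs p N u) A ≤ η * (c * (hi J).V) :=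
    not_lt.1 fun h => hgood ⟨hJne, Or.inl h⟩
  have hg2 : c * (lo J).V ≤ η * (lo J).count N w (cosetVecs p N u) A :=
    not_lt.1 fun h => hgood ⟨hJne, Or.inr h⟩
  constructor
  · calc _ ≤ (hi J).count N w (cosetVecs p N u) A :=
          count_mono (φ.trunc_g_mono hm hs2) _ _ _ _
      _ ≤ η * (c * (η ^ (s + 1) * ∏ v, η ^ J v)) :=
          hg1.trans (mul_le_mul' le_rfl (mul_le_mul' le_rfl (hhigh J hJne)))
      _ = η ^ (s + 2) * (c * ∏ v, η ^ J v) := by ring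
      _ ≤ _ := mul_le_mul' hδε (mul_le_mul' le_rfl ((hlow J hJne).trans hVlo))
  · calc c * (φ.trunc hm fun v => LowerSet.Iic (R v)).V
        ≤ c * (η ^ (s + 1) * (lo J).V) := mul_le_mul' le_rfl
          (hVhi.trans ((hhigh J hJne).trans (mul_le_mul' le_rfl (hlow J hJne))))
      _ = η ^ (s + 1) * (c * (lo J).V) := by ring
      _ ≤ η ^ (s + 1) * (η * (lo J).count N w (cosetVecs p N u) A) := mul_le_mul' le_rfl hg2
      _ = η ^ (s + 2) * (lo J).count N w (cosetVecs p N u) A := by ring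
      _ ≤ _ := mul_le_mul' hδε (count_mono (φ.trunc_g_mono hm hs1) _ _ _ _)

end

section

open Set
open scoped ENNReal NNReal

variable {s : ℕ} {p : Fin s → ℕ} [∀ i, Fact (p i).Prime] {m n : ℕ}
  [∀ i, MeasurableSpace ℚ_[p i]] [∀ i, BorelSpace ℚ_[p i]]

theorem tileMeasure_eq_smul_restrict {N : ℕ} {F : Fin m → Set (Fin n → SAdele p)}
    (hF : ∀ a, IsGoodTile N (F a)) :
    tileMeasure F = (∏ a, (volume (F a))⁻¹) • volume.restrict (univ.pi F) := by
  have hprob : ∀ a, IsProbabilityMeasure (ProbabilityTheory.cond volume (F a)) := fun a =>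
    (hF a).isProbabilityMeasure
  refine Measure.pi_eq fun t ht => ?_
  have h := Measure.restrict_pi_pi (fun _ : Fin m => (volume : Measure (Fin n → SAdele p))) F
  change (∏ a, (volume (F a))⁻¹) • (Measure.pi fun _ : Fin m => volume).restrict (univ.pi F)
    (univ.pi t) = _
  rw [h, Measure.pi_pi, smul_eq_mul, ← Finset.prod_mul_distrib]
  refine Finset.prod_congr rfl fun a _ => ?_
  rw [ProbabilityTheory.cond, Measure.smul_apply, smul_eq_mul]

theorem ae_of_forall_ae_tileMeasure (hp : Function.Injective p) {N : ℕ} (hN : 0 < N)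
    (hNS : Nat.Coprime N (∏ i, p i)) {P : (Fin m → Fin n → SAdele p) → Prop}
    (h : ∀ F : Fin m → Set (Fin n → SAdele p), (∀ a, IsGoodTile N (F a)) →
      ∀ᵐ A ∂(tileMeasure F), P A) : ∀ᵐ A, P A := by
  obtain ⟨T, hT, hTvol⟩ := exists_isTile_latt hp hN hNS
  set F₀ : Set (Fin n → SAdele p) := univ.pi fun _ : Fin n => T
  have hF₀ : IsTile (AddMonoidHom.compLeft (latt p N) (Fin n)) F₀ := hT.pi
  have hvol : volume F₀ = (N : ℝ≥0∞) ^ n := by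
    rw [volume_pi_pi]
    simp [hTvol]
  have hgood : ∀ y, IsGoodTile N ((fun x => x + y) ⁻¹' F₀) := fun y => by
    refine ⟨hF₀.preimage_add y, ?_⟩
    rw [measure_preimage_add_right, hvol]
    exact ⟨pow_ne_zero _ (by exact_mod_cast hN.ne'), ENNReal.pow_ne_top (by simp)⟩
  have hae : ∀ᵐ A : Fin m → Fin n → SAdele p, ∀ l : Fin m → Fin n → ZS p,
      A ∈ univ.pi (fun a => (fun x => x + AddMonoidHom.compLeft (latt p N) (Fin n) (l a)) ⁻¹' F₀) →
        P A := by
    refine ae_all_iff.2 fun l => ?_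
    refine (ae_restrict_iff' (MeasurableSet.univ_pi fun a => (hgood _).1.1)).1 ?_
    have h1 := h _ fun a => hgood (AddMonoidHom.compLeft (latt p N) (Fin n) (l a))
    rw [tileMeasure_eq_smul_restrict fun a => hgood _] at h1
    have hc : ∏ a, (volume ((fun x => x + AddMonoidHom.compLeft (latt p N) (Fin n) (l a)) ⁻¹' F₀))⁻¹
        ≠ 0 := Finset.prod_ne_zero_iff.2 fun a _ => ENNReal.inv_ne_zero.2 (hgood _).2.2
    exact (Measure.ae_ennreal_smul_measure_iff hc).1 h1
  filter_upwards [hae] with A hA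
  choose l hl _ using fun a => hF₀.2 (A a)
  exact hA l fun a _ => hl a

theorem Profile.ae_count (φ : Profile p m n) (h1 : ∀ v t, t ≤ 1 → φ.g v t = 1)
    (hp : Function.Injective p) {N : ℕ} (hN : 0 < N) (hNS : Nat.Coprime N (∏ i, p i)) (hm : 0 < m)
    (hn : 0 < n) {w : Fin m → ℚ} (hw : ∀ a, w a ∈ ZS p) {u : Fin n → ℚ}
    (hu : ∀ b, u b ∈ ZS p) :
    ∀ᵐ A, ∀ ε : ℝ, 0 < ε → ∃ M : ℝ≥0∞, M ≠ ∞ ∧ ∀ R : Option (Fin s) → ℝ, (∀ v, 1 ≤ R v) →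
      M ≤ (φ.trunc hm fun v => LowerSet.Iic (R v)).V →
      (φ.trunc hm fun v => LowerSet.Iic (R v)).count N w (cosetVecs p N u) A ≤
          ENNReal.ofReal (1 + ε) *
            (kgDensity m n N * (φ.trunc hm fun v => LowerSet.Iic (R v)).V) ∧
        kgDensity m n N * (φ.trunc hm fun v => LowerSet.Iic (R v)).V ≤ ENNReal.ofReal (1 + ε) *
          (φ.trunc hm fun v => LowerSet.Iic (R v)).count N w (cosetVecs p N u) A := by
  have h := ae_all_iff.2 fun k : ℕ => ae_of_forall_ae_tileMeasure hp hN hNS fun F hF =>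
    φ.ae_tileMeasure_count h1 hp hN hNS hm hn (ε := 1 / ((k : ℝ) + 1)) Nat.one_div_pos_of_nat
      hw hu hF
  filter_upwards [h] with A hA ε hε
  obtain ⟨k, hk⟩ := exists_nat_one_div_lt hε
  obtain ⟨M, hM, H⟩ := hA k
  have hle : ENNReal.ofReal (1 + 1 / ((k : ℝ) + 1)) ≤ ENNReal.ofReal (1 + ε) :=
    ENNReal.ofReal_le_ofReal (by linarith)
  exact ⟨M, hM, fun R hR hMR => ⟨(H R hR hMR).1.trans (mul_le_mul' hle le_rfl),
    (H R hR hMR).2.trans (mul_le_mul' hle le_rfl)⟩⟩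

end

section

open Set
open scoped ENNReal NNReal

theorem volume_real_sideOf_pow {m : ℕ} (hm : 0 < m) {c : ℝ} (hc : 0 < c) :
    volume (sideOf m c : Set ℝ) ^ m = 2 ^ m * ENNReal.ofReal c := by
  set r : ℝ := c ^ (m⁻¹ : ℝ) with hr
  have hr0 : 0 ≤ r := Real.rpow_nonneg hc.le _
  have hrm : r ^ m = c := Real.rpow_inv_natCast_pow hc.le hm.ne'
  have h : (sideOf m c : Set ℝ) = Metric.closedBall 0 r := by
    ext x
    rw [mem_closedBall_zero_iff]
    change (0 < c ∧ ‖x‖ ^ m ≤ c) ↔ _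
    rw [← hrm, pow_le_pow_iff_left₀ (norm_nonneg x) hr0 hm.ne', hrm]
    exact and_iff_right hc
  rw [h, Real.volume_closedBall, ← ENNReal.ofReal_pow (by positivity), mul_pow, hrm,
    ENNReal.ofReal_mul (by positivity), ENNReal.ofReal_pow zero_le_two, ENNReal.ofReal_ofNat]

theorem padicHaar_sideOf_pow (p : ℕ) [Fact p.Prime] [MeasurableSpace ℚ_[p]] [BorelSpace ℚ_[p]]
    {m : ℕ} (hm : 0 < m) (l : ℤ) :
    padicHaar p (sideOf m ((p : ℝ) ^ (m * l : ℤ))) ^ m = ENNReal.ofReal ((p : ℝ) ^ (m * l : ℤ)) := by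
  have hp0 : (0 : ℝ) < p := by exact_mod_cast (Fact.out : p.Prime).pos
  have hpow : (p : ℝ) ^ (m * l : ℤ) = ((p : ℝ) ^ l) ^ m := by
    rw [mul_comm, _root_.zpow_mul, zpow_natCast]
  have h : (sideOf m ((p : ℝ) ^ (m * l : ℤ)) : Set ℚ_[p]) = Metric.closedBall 0 ((p : ℝ) ^ l) := by
    ext x
    rw [mem_closedBall_zero_iff]
    change (0 < _ ∧ ‖x‖ ^ m ≤ _) ↔ _
    rw [hpow, pow_le_pow_iff_left₀ (norm_nonneg x) (by positivity) hm.ne']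
    exact and_iff_right (by positivity)
  rw [h, padicHaar_closedBall, hpow, ENNReal.ofReal_pow (by positivity)]

theorem Padic.exists_norm_pi_eq_zpow {p : ℕ} [Fact p.Prime] {n : ℕ} {y : Fin n → ℚ_[p]}
    (hy : y ≠ 0) : ∃ k : ℤ, ‖y‖ = (p : ℝ) ^ k := by
  obtain ⟨b, hb⟩ := Function.ne_iff.1 hy
  have : Nonempty (Fin n) := ⟨b⟩
  obtain ⟨j, -, hj⟩ := Finset.exists_mem_eq_sup Finset.univ Finset.univ_nonempty
    fun b => ‖y b‖₊
  have hj' : ‖y‖ = ‖y j‖ := by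
    rw [Pi.norm_def, hj, coe_nnnorm]
  refine ⟨-(y j).valuation, ?_⟩
  rw [hj', Padic.norm_eq_zpow_neg_valuation]
  intro h0
  rw [h0, norm_zero, norm_eq_zero] at hj'
  exact hy hj'

namespace ApproxFamily

variable {s : ℕ} {p : Fin s → ℕ} {m n : ℕ} (ψ : ApproxFamily m n s p)

/-- The approximating functions, indexed by all the places. -/
def place (v : Option (Fin s)) : ℝ → ℝ := v.elim ψ.psiR ψ.psiP

theorem place_pos : ∀ v t, 0 < ψ.place v t
  | none => ψ.posR
  | some i => ψ.posP i

theorem place_one : ∀ v {t}, t ≤ 1 → ψ.place v t = 1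
  | none, _, h => ψ.oneR h
  | some i, _, h => ψ.oneP i h

theorem place_anti_of_pos : ∀ v {t u}, 0 < t → t ≤ u → ψ.place v u ≤ ψ.place v t
  | none, _, _, h, h' => ψ.antiR h h'
  | some i, _, _, h, h' => ψ.antiP i h h'

theorem place_le_one (v : Option (Fin s)) (t : ℝ) : ψ.place v t ≤ 1 := by
  rcases le_total t 1 with h | h
  · exact (ψ.place_one v h).le
  · exact (ψ.place_anti_of_pos v one_pos h).trans_eq (ψ.place_one v le_rfl)

theorem place_anti (v : Option (Fin s)) : Antitone (ψ.place v) := fun t u h => by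
  rcases lt_or_ge 0 t with h0 | h0
  · exact ψ.place_anti_of_pos v h0 h
  · exact (ψ.place_le_one v u).trans_eq (ψ.place_one v (h0.trans zero_le_one)).symm

variable [∀ i, Fact (p i).Prime] [∀ i, MeasurableSpace ℚ_[p i]] [∀ i, BorelSpace ℚ_[p i]]

/-- The profile attached to a collection of approximating functions. -/
def profile (hm : 0 < m) (hn : 0 < n) : Profile p m n where
  g v t := ψ.place v (max t 0 ^ n)
  anti v t u h := ψ.place_anti v (pow_le_pow_left₀ (le_max_right _ _) (max_le_max_right 0 h) n)
  nonneg v t := (ψ.place_pos v _).le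
  le_one v t := ψ.place_le_one v _
  vol
  | none, y => volume_real_sideOf_pow hm (ψ.posR _)
  | some i, y => by
    change padicHaar (p i) (sideOf m (ψ.psiP i (max ‖y‖ 0 ^ n))) ^ m
      = 1 * ENNReal.ofReal (ψ.psiP i (max ‖y‖ 0 ^ n))
    have h : ∃ l : ℤ, ψ.psiP i (max ‖y‖ 0 ^ n) = (p i : ℝ) ^ (m * l : ℤ) := by
      rw [max_eq_left (norm_nonneg y)]
      by_cases hy : y = 0
      · refine ⟨0, ?_⟩
        rw [hy, norm_zero, zero_pow hn.ne', ψ.oneP i zero_le_one]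
        simp
      · obtain ⟨k, hk⟩ := Padic.exists_norm_pi_eq_zpow (p := p i) (y := y) hy
        obtain ⟨l, hl⟩ := ψ.valsP i (k * n)
        refine ⟨l, ?_⟩
        have hk' : ‖y‖ = (p i : ℝ) ^ k := hk
        rw [← hl, hk', _root_.zpow_mul, zpow_natCast]
    obtain ⟨l, hl⟩ := h
    rw [hl, one_mul, padicHaar_sideOf_pow (p i) hm l]

theorem profile_g_eq_one (hm : 0 < m) (hn : 0 < n) (v : Option (Fin s)) (t : ℝ) (ht : t ≤ 1) :
    (ψ.profile hm hn).g v t = 1 :=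
  ψ.place_one v (pow_le_one₀ (le_max_right _ _) (max_le ht zero_le_one))

end ApproxFamily

end

section

open Set
open scoped ENNReal NNReal

variable {s : ℕ} {p : Fin s → ℕ} [∀ i, Fact (p i).Prime] {m n : ℕ}
  [∀ i, MeasurableSpace ℚ_[p i]] [∀ i, BorelSpace ℚ_[p i]]

theorem isAddHaarMeasure_eq_pi_padicHaar (q : ℕ) [Fact q.Prime] [MeasurableSpace ℚ_[q]]
    [BorelSpace ℚ_[q]] (μ : Measure (Fin n → ℚ_[q])) [μ.IsAddHaarMeasure]
    (hμ : μ {y | ∀ j, ‖y j‖ ≤ 1} = 1) : μ = Measure.pi fun _ : Fin n => padicHaar q := by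
  have h := Measure.isAddLeftInvariant_eq_smul μ (Measure.pi fun _ : Fin n => padicHaar q)
  have hset : {y : Fin n → ℚ_[q] | ∀ j, ‖y j‖ ≤ 1} = univ.pi fun _ => Metric.closedBall 0 1 := by
    ext y
    simp [mem_pi]
  have h1 : (Measure.pi fun _ : Fin n => padicHaar q) {y | ∀ j, ‖y j‖ ≤ 1} = 1 := by
    rw [hset, Measure.pi_pi]
    simp [padicHaar_closedBall_one]
  have h2 := hμ
  rw [h, Measure.smul_apply, h1, ENNReal.smul_def, smul_eq_mul, mul_one, ENNReal.coe_eq_one] at h2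
  rw [h, h2, one_smul]

namespace ApproxFamily

variable (ψ : ApproxFamily m n s p) (hm : 0 < m) (hn : 0 < n)

/-- The profile of a collection of approximating functions, cut off at height `T`. -/
def cut (T : Option (Fin s) → ℝ) : Profile p m n :=
  (ψ.profile hm hn).trunc hm fun v => LowerSet.Iic (T v ^ (n⁻¹ : ℝ))

theorem mem_Iic_root_iff {t x : ℝ} (hn : 0 < n) (ht : 0 ≤ t) (hx : 0 ≤ x) :
    x ∈ (LowerSet.Iic (t ^ (n⁻¹ : ℝ)) : Set ℝ) ↔ x ^ n ≤ t := by
  rw [LowerSet.coe_Iic, mem_Iic]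
  conv_rhs => rw [← Real.rpow_inv_natCast_pow ht hn.ne']
  rw [pow_le_pow_iff_left₀ hx (Real.rpow_nonneg ht _) hn.ne']

theorem cut_g_norm {T : Option (Fin s) → ℝ} (hT : ∀ v, 0 ≤ T v) (v : Option (Fin s))
    (y : Fin n → SField p v) :
    (ψ.cut hm hn T).g v ‖y‖ = {x : ℝ | x ^ n ≤ T v}.indicator (fun x => ψ.place v (x ^ n)) ‖y‖ := by
  classical
  change ((LowerSet.Iic (T v ^ (n⁻¹ : ℝ)) : LowerSet ℝ) : Set ℝ).indicator
    (fun t => ψ.place v (max t 0 ^ n)) ‖y‖ = _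
  rw [indicator_apply, indicator_apply, mem_Iic_root_iff hn (hT v) (norm_nonneg y),
    max_eq_left (norm_nonneg y)]
  rfl

theorem mem_sideOf_cut {T : Option (Fin s) → ℝ} (hT : ∀ v, 0 ≤ T v) (v : Option (Fin s))
    (y : Fin n → SField p v) (x : SField p v) :
    x ∈ (sideOf m ((ψ.cut hm hn T).g v ‖y‖) : Set (SField p v)) ↔
      ‖y‖ ^ n ≤ T v ∧ ‖x‖ ^ m ≤ ψ.place v (‖y‖ ^ n) := by
  rw [cut_g_norm ψ hm hn hT]
  change (0 < _ ∧ ‖x‖ ^ m ≤ _) ↔ _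
  by_cases h : ‖y‖ ^ n ≤ T v
  · rw [indicator_of_mem (show ‖y‖ ∈ {x : ℝ | x ^ n ≤ T v} from h)]
    exact and_congr_left fun _ => ⟨fun _ => h, fun _ => ψ.place_pos v _⟩
  · rw [indicator_of_notMem (show ‖y‖ ∉ {x : ℝ | x ^ n ≤ T v} from h)]
    exact ⟨fun h' => absurd h'.1 (lt_irrefl _), fun h' => absurd h'.1 h⟩

theorem ofReal_psi_eq_prod_G {TR : ℝ} {TP : Fin s → ℝ} (hTR : 0 ≤ TR) (hTP : ∀ i, 0 ≤ TP i)
    (y : (Fin n → ℝ) × (∀ i, Fin n → ℚ_[p i])) :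
    {y : (Fin n → ℝ) × (∀ i, Fin n → ℚ_[p i]) | ‖y.1‖ ^ n ≤ TR ∧ ∀ i, ‖y.2 i‖ ^ n ≤ TP i}.indicator
      (fun y => ENNReal.ofReal (ψ.psiR (‖y.1‖ ^ n) * ∏ i, ψ.psiP i (‖y.2 i‖ ^ n))) y
    = (ψ.cut hm hn fun v => v.elim TR TP).G none y.1 *
      ∏ i, (ψ.cut hm hn fun v => v.elim TR TP).G (some i) (y.2 i) := by
  have hT : ∀ v : Option (Fin s), 0 ≤ v.elim TR TP
    | none => hTR
    | some i => hTP i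
  have h0 : (ψ.cut hm hn fun v => v.elim TR TP).G none y.1
      = ENNReal.ofReal ({x : ℝ | x ^ n ≤ TR}.indicator (fun x => ψ.psiR (x ^ n)) ‖y.1‖) :=
    congrArg ENNReal.ofReal (ψ.cut_g_norm hm hn hT none y.1)
  have h1 : ∀ i, (ψ.cut hm hn fun v => v.elim TR TP).G (some i) (y.2 i)
      = ENNReal.ofReal ({x : ℝ | x ^ n ≤ TP i}.indicator (fun x => ψ.psiP i (x ^ n)) ‖y.2 i‖) :=
    fun i => congrArg ENNReal.ofReal (ψ.cut_g_norm hm hn hT (some i) (y.2 i))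
  rw [h0, Finset.prod_congr rfl fun i _ => h1 i]
  by_cases h : ‖y.1‖ ^ n ≤ TR ∧ ∀ i, ‖y.2 i‖ ^ n ≤ TP i
  · rw [indicator_of_mem (show y ∈ {y : (Fin n → ℝ) × (∀ i, Fin n → ℚ_[p i]) |
        ‖y.1‖ ^ n ≤ TR ∧ ∀ i, ‖y.2 i‖ ^ n ≤ TP i} from h), ENNReal.ofReal_mul (ψ.posR _).le,
      ENNReal.ofReal_prod_of_nonneg fun i _ => (ψ.posP i _).le,
      indicator_of_mem (show ‖y.1‖ ∈ {x : ℝ | x ^ n ≤ TR} from h.1)]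
    congr 1
    refine Finset.prod_congr rfl fun i _ => ?_
    rw [indicator_of_mem (show ‖y.2 i‖ ∈ {x : ℝ | x ^ n ≤ TP i} from h.2 i)]
  · rw [indicator_of_notMem (show y ∉ {y : (Fin n → ℝ) × (∀ i, Fin n → ℚ_[p i]) |
        ‖y.1‖ ^ n ≤ TR ∧ ∀ i, ‖y.2 i‖ ^ n ≤ TP i} from h)]
    symm
    by_cases h2 : ‖y.1‖ ^ n ≤ TR
    · obtain ⟨i, hi⟩ := not_forall.1 fun h3 => h ⟨h2, h3⟩
      refine mul_eq_zero_of_right _ (Finset.prod_eq_zero (Finset.mem_univ i) ?_)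
      rw [indicator_of_notMem (show ‖y.2 i‖ ∉ {x : ℝ | x ^ n ≤ TP i} from hi), ENNReal.ofReal_zero]
    · rw [indicator_of_notMem (show ‖y.1‖ ∉ {x : ℝ | x ^ n ≤ TR} from h2), ENNReal.ofReal_zero,
        zero_mul]

theorem KGvol_eq (μ : ∀ i, Measure (Fin n → ℚ_[p i])) [∀ i, (μ i).IsAddHaarMeasure]
    (hμ : ∀ i, μ i {y | ∀ j, ‖y j‖ ≤ 1} = 1) {TR : ℝ} {TP : Fin s → ℝ} (hTR : 0 ≤ TR)
    (hTP : ∀ i, 0 ≤ TP i) :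
    KGvol m n p ψ μ TR TP = 2 ^ m * ((ψ.cut hm hn fun v => v.elim TR TP).V).toReal := by
  have hμ' : ∀ i, μ i = Measure.pi fun _ : Fin n => padicHaar (p i) := fun i =>
    isAddHaarMeasure_eq_pi_padicHaar (p i) (μ i) (hμ i)
  set χ := ψ.cut hm hn fun v => v.elim TR TP
  have hG : ∀ v, Measurable (χ.G v) := fun v => (χ.normAntitone_G v).measurable
  have hmeas : MeasurableSet {y : (Fin n → ℝ) × (∀ i, Fin n → ℚ_[p i]) |
      ‖y.1‖ ^ n ≤ TR ∧ ∀ i, ‖y.2 i‖ ^ n ≤ TP i} := by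
    have h1 : MeasurableSet {y : (Fin n → ℝ) × (∀ i, Fin n → ℚ_[p i]) | ‖y.1‖ ^ n ≤ TR} :=
      measurableSet_le (measurable_fst.norm.pow_const n) measurable_const
    have h2 : ∀ i, MeasurableSet {y : (Fin n → ℝ) × (∀ i, Fin n → ℚ_[p i]) |
        ‖y.2 i‖ ^ n ≤ TP i} := fun i =>
      measurableSet_le (((measurable_pi_apply i).comp measurable_snd).norm.pow_const n)
        measurable_const
    have h3 := h1.inter (MeasurableSet.iInter h2)
    convert h3 using 1
    ext y
    simp
  rw [KGvol, ← lintegral_indicator hmeas]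
  congr 2
  rw [lintegral_congr (ψ.ofReal_psi_eq_prod_G hm hn hTR hTP)]
  have hG2 : Measurable fun z : ∀ i, Fin n → ℚ_[p i] => ∏ i, χ.G (some i) (z i) :=
    Finset.measurable_prod _ fun i _ => (hG (some i)).comp (measurable_pi_apply i)
  have h1 := lintegral_prod_mul (μ := (volume : Measure (Fin n → ℝ))) (ν := Measure.pi μ)
    (f := χ.G none) (g := fun z => ∏ i, χ.G (some i) (z i)) (hG none).aemeasurable
    hG2.aemeasurable
  have h2 := lintegral_pi_prod μ (fun i => χ.G (some i)) fun i => hG (some i)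
  rw [h1, h2, Profile.V, Fintype.prod_option]
  congr 1
  refine Finset.prod_congr rfl fun i _ => ?_
  rw [hμ' i]
  rfl

end ApproxFamily

end

section

open Set
open scoped ENNReal NNReal

variable {s : ℕ} {p : Fin s → ℕ} [∀ i, Fact (p i).Prime] {m n : ℕ}

theorem pi_norm_pow_le_iff {E : Type*} [SeminormedAddCommGroup E] (hm : 0 < m) (x : Fin m → E)
    (c : ℝ) : ‖x‖ ^ m ≤ c ↔ ∀ a, ‖x a‖ ^ m ≤ c := by
  refine ⟨fun h a => (pow_le_pow_left₀ (norm_nonneg _) (norm_le_pi_norm x a) m).trans h,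
    fun h => ?_⟩
  have : Nonempty (Fin m) := ⟨⟨0, hm⟩⟩
  obtain ⟨j, -, hj⟩ := Finset.exists_mem_eq_sup Finset.univ Finset.univ_nonempty
    fun b => ‖x b‖₊
  have hj' : ‖x‖ = ‖x j‖ := by
    rw [Pi.norm_def, hj, coe_nnnorm]
  rw [hj']
  exact h j

variable [∀ i, MeasurableSpace ℚ_[p i]] [∀ i, BorelSpace ℚ_[p i]]

theorem Profile.hits_eq_encard (φ : Profile p m n) (N : ℕ) (w : Fin m → ℚ) (q : Fin n → ZS p)
    (A : Fin m → Fin n → SAdele p) :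
    φ.hits N w q A = ((({e : Fin m → ZS p | ∀ a v,
      (rowForm q (A a) + emb p (w a + N * e a)) v ∈ φ.box q v}).encard : ℕ∞) : ℝ≥0∞) := by
  rw [← tsum_indicator_one_eq_encard]
  have h := ENNReal.tsum_pi_prod fun a (e : ZS p) =>
    (boxSet (φ.box q)).indicator (1 : SAdele p → ℝ≥0∞) (rowForm q (A a) + emb p (w a + N * e))
  refine h.symm.trans (tsum_congr fun e => ?_)
  by_cases he : ∀ a v, (rowForm q (A a) + emb p (w a + N * e a)) v ∈ φ.box q v
  · rw [indicator_of_mem (show e ∈ {e : Fin m → ZS p | ∀ a v,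
      (rowForm q (A a) + emb p (w a + N * e a)) v ∈ φ.box q v} from he)]
    refine Finset.prod_eq_one fun a _ => ?_
    rw [indicator_of_mem (show _ ∈ boxSet (φ.box q) from he a)]
    rfl
  · rw [indicator_of_notMem (show e ∉ {e : Fin m → ZS p | ∀ a v,
      (rowForm q (A a) + emb p (w a + N * e a)) v ∈ φ.box q v} from he)]
    obtain ⟨a, ha⟩ := not_forall.1 he
    refine Finset.prod_eq_zero (Finset.mem_univ a) ?_
    rw [indicator_of_notMem (show _ ∉ boxSet (φ.box q) from ha)]

/-- The vectors over `ℤ_S` in a given residue class. -/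
def residueVecs (p : Fin s → ℕ) [∀ i, Fact (p i).Prime] (N : ℕ) (u : Fin n → ℚ) :
    Set (Fin n → ZS p) := {q | ∀ b, ((q b : ℚ) - u b) / N ∈ ZS p}

/-- The set of pairs counted by `KGcount`. -/
def solutionSet (ψ : ApproxFamily m n s p) (N : ℕ) (vm : Fin m → ℚ) (vn : Fin n → ℚ)
    (AR : Fin m → Fin n → ℝ) (AP : ∀ i, Fin m → Fin n → ℚ_[p i]) (TR : ℝ) (TP : Fin s → ℝ) :
    Set ((Fin m → ℚ) × (Fin n → ℚ)) :=
  {pq : (Fin m → ℚ) × (Fin n → ℚ) |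
    (∀ a, IsZS (∏ i, p i) (pq.1 a)) ∧ (∀ b, IsZS (∏ i, p i) (pq.2 b)) ∧
    (∀ a, IsZS (∏ i, p i) ((pq.1 a - vm a) / N)) ∧
    (∀ b, IsZS (∏ i, p i) ((pq.2 b - vn b) / N)) ∧
    ‖fun a => (∑ b, AR a b * (pq.2 b : ℝ)) + (pq.1 a : ℝ)‖ ^ m
      ≤ ψ.psiR (‖ratR pq.2‖ ^ n) ∧
    ‖ratR pq.2‖ ^ n ≤ TR ∧
    ∀ i, ‖fun a => (∑ b, AP i a b * ((pq.2 b : ℚ) : ℚ_[p i])) + ((pq.1 a : ℚ) : ℚ_[p i])‖ ^ m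
        ≤ ψ.psiP i (‖ratP p i pq.2‖ ^ n) ∧
      ‖ratP p i pq.2‖ ^ n ≤ TP i}

variable (ψ : ApproxFamily m n s p) (hm : 0 < m) (hn : 0 < n)

theorem solutionSet_eq_image {N : ℕ} (hN : 0 < N) {vm : Fin m → ℚ} (hvm : ∀ a, vm a ∈ ZS p)
    (vn : Fin n → ℚ) (A : Fin m → Fin n → SAdele p) {TR : ℝ} {TP : Fin s → ℝ} (hTR : 0 ≤ TR)
    (hTP : ∀ i, 0 ≤ TP i) :
    solutionSet ψ N vm vn (fun a b => A a b none) (fun i a b => A a b (some i)) TR TP =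
      (fun x : residueVecs p N vn × (Fin m → ZS p) =>
        ((fun a => vm a + N * x.2 a, fun b => x.1.1 b) : (Fin m → ℚ) × (Fin n → ℚ))) ''
      {x | ∀ a v, (rowForm x.1.1 (A a) + emb p (vm a + N * x.2 a)) v ∈
        (ψ.cut hm hn fun v => v.elim TR TP).box x.1.1 v} := by
  have hT : ∀ v : Option (Fin s), 0 ≤ v.elim TR TP
    | none => hTR
    | some i => hTP i
  have hN0 : (N : ℚ) ≠ 0 := by exact_mod_cast hN.ne'
  have hrow : ∀ (q : Fin n → ZS p) (z : ℚ) (a : Fin m) (v : Option (Fin s)),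
      (rowForm q (A a) + emb p z) v = (∑ b, A a b v * ((q b : ℚ) : SField p v)) + (z : SField p v) :=
    fun q z a v => by
      exact congrArg (fun x => x + (z : SField p v)) (Finset.sum_apply v Finset.univ
        fun b => (A a b * emb p (q b) : ∀ v, SField p v))
  let AR : Fin m → Fin n → ℝ := fun a b => A a b none
  let AP : ∀ i, Fin m → Fin n → ℚ_[p i] := fun i a b => A a b (some i)
  have key : ∀ (q : Fin n → ZS p) (z : Fin m → ℚ),
      (∀ a v, (rowForm q (A a) + emb p (z a)) v ∈
        (ψ.cut hm hn fun v => v.elim TR TP).box q v) ↔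
      (‖fun a => (∑ b, AR a b * ((q b : ℚ) : ℝ)) + (z a : ℝ)‖ ^ m
        ≤ ψ.psiR (‖ratR fun b => (q b : ℚ)‖ ^ n) ∧ ‖ratR fun b => (q b : ℚ)‖ ^ n ≤ TR ∧
      ∀ i, ‖fun a => (∑ b, AP i a b * ((q b : ℚ) : ℚ_[p i])) + ((z a : ℚ) : ℚ_[p i])‖ ^ m
        ≤ ψ.psiP i (‖ratP p i fun b => (q b : ℚ)‖ ^ n) ∧
        ‖ratP p i fun b => (q b : ℚ)‖ ^ n ≤ TP i) := by
    intro q z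
    have h1 : ∀ a v, (rowForm q (A a) + emb p (z a)) v ∈
        (ψ.cut hm hn fun v => v.elim TR TP).box q v ↔
        ‖placeVec q v‖ ^ n ≤ v.elim TR TP ∧
          ‖(∑ b, A a b v * ((q b : ℚ) : SField p v)) + (z a : SField p v)‖ ^ m
            ≤ ψ.place v (‖placeVec q v‖ ^ n) := fun a v => by
      rw [hrow]
      exact ψ.mem_sideOf_cut hm hn hT v _ _
    simp only [h1]
    rw [forall_comm, Option.forall, ← and_assoc]
    have aux : ∀ {P : Prop} {Q : Fin m → Prop}, (∀ a, P ∧ Q a) ↔ (∀ a, Q a) ∧ P := by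
      intro P Q
      exact ⟨fun h => ⟨fun a => (h a).2, (h ⟨0, hm⟩).1⟩, fun h a => ⟨h.2, h.1 a⟩⟩
    refine and_congr ?_ (forall_congr' fun i => ?_)
    · rw [aux, pi_norm_pow_le_iff hm]
      rfl
    · rw [aux, pi_norm_pow_le_iff hm]
      rfl
  ext ⟨z, y⟩
  constructor
  · rintro ⟨-, h2, h3, h4, h5⟩
    refine ⟨(⟨fun b => ⟨y b, h2 b⟩, h4⟩, fun a => ⟨(z a - vm a) / N, h3 a⟩), ?_, ?_⟩
    · have hz : ∀ a, vm a + N * ((z a - vm a) / N) = z a := fun a => by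
        field_simp
        ring
      change ∀ a v, (rowForm _ (A a) + emb p (vm a + N * ((z a - vm a) / N))) v ∈ _
      simp only [hz]
      exact (key _ z).2 h5
    · refine Prod.ext (funext fun a => ?_) rfl
      change vm a + N * ((z a - vm a) / N) = z a
      field_simp
      ring
  · rintro ⟨⟨⟨q, hq⟩, e⟩, hx, heq⟩
    obtain ⟨rfl, rfl⟩ := Prod.mk.inj heq
    refine ⟨fun a => ?_, fun b => (q b).2, fun a => ?_, hq, (key q _).1 hx⟩
    · exact (ZS p).add_mem (hvm a) ((ZS p).mul_mem (natCast_mem _ N) (e a).2)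
    · change (vm a + N * e a - vm a) / N ∈ ZS p
      rw [add_sub_cancel_left, mul_div_cancel_left₀ _ hN0]
      exact (e a).2

theorem encard_solutionSet {N : ℕ} (hN : 0 < N) {vm : Fin m → ℚ} (hvm : ∀ a, vm a ∈ ZS p)
    (vn : Fin n → ℚ) (A : Fin m → Fin n → SAdele p) {TR : ℝ} {TP : Fin s → ℝ} (hTR : 0 ≤ TR)
    (hTP : ∀ i, 0 ≤ TP i) :
    ((solutionSet ψ N vm vn (fun a b => A a b none) (fun i a b => A a b (some i)) TR TP).encard
      : ℝ≥0∞) = (ψ.cut hm hn fun v => v.elim TR TP).count N vm (residueVecs p N vn) A := by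
  have hN0 : (N : ℚ) ≠ 0 := by exact_mod_cast hN.ne'
  rw [solutionSet_eq_image ψ hm hn hN hvm vn A hTR hTP, Function.Injective.encard_image,
    ← tsum_indicator_one_eq_encard, ENNReal.tsum_prod']
  · refine tsum_congr fun q => ?_
    rw [Profile.hits_eq_encard, ← tsum_indicator_one_eq_encard]
    rfl
  · rintro ⟨⟨q, hq⟩, e⟩ ⟨⟨q', hq'⟩, e'⟩ h
    obtain ⟨h1, h2⟩ := Prod.mk.inj h
    have h3 : q = q' := funext fun b => Subtype.ext (congrFun h2 b)
    have h4 : e = e' := funext fun a => Subtype.ext (by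
      have := congrFun h1 a
      simpa [hN0] using this)
    subst h3 h4
    rfl

theorem Profile.count_residueVecs_le (φ : Profile p m n) (N : ℕ) (w : Fin m → ℚ) (u : Fin n → ℚ)
    (A : Fin m → Fin n → SAdele p) :
    φ.count N w (cosetVecs p N u) A ≤ φ.count N w (residueVecs p N u) A ∧
    φ.count N w (residueVecs p N u) A ≤ φ.count N w (cosetVecs p N u) A + φ.hits N w 0 A := by
  refine ⟨ENNReal.tsum_mono_subtype (fun q => φ.hits N w q A) fun q hq => hq.2, ?_⟩
  have hsub : residueVecs p N u ⊆ cosetVecs p N u ∪ {0} := fun q hq => by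
    by_cases h : q = 0
    · exact Or.inr h
    · exact Or.inl ⟨h, hq⟩
  refine (ENNReal.tsum_mono_subtype (fun q => φ.hits N w q A) hsub).trans
    ((ENNReal.tsum_union_le (fun q => φ.hits N w q A) _ _).trans_eq ?_)
  rw [tsum_singleton (0 : Fin n → ZS p) fun q => φ.hits N w q A]
  rfl

theorem Profile.hits_zero_ne_top (hp : Function.Injective p) {N : ℕ} (hN : 0 < N)
    (hNS : Nat.Coprime N (∏ i, p i)) (φ : Profile p m n) (hm : 0 < m) (w : Fin m → ℚ)
    (A : Fin m → Fin n → SAdele p) : φ.hits N w 0 A ≠ ∞ := by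
  have hN0 : (N : ℝ≥0∞) ≠ 0 := by exact_mod_cast hN.ne'
  refine ENNReal.prod_ne_top fun a _ => ?_
  have h := encard_coset_box_le hp hN hNS (φ.normLower_box 0)
    (rowForm (0 : Fin n → ZS p) (A a) + emb p (w a))
  rw [← tsum_indicator_one_eq_encard] at h
  refine ne_top_of_le_ne_top (ENNReal.add_ne_top.2 ⟨ENNReal.div_ne_top ?_ hN0, ENNReal.one_ne_top⟩)
    (le_trans (le_of_eq (tsum_congr fun e => ?_)) h)
  · exact ENNReal.prod_ne_top fun v _ => φ.volume_sideOf_ne_top hm v _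
  · rw [map_add, ← add_assoc]
    rfl

end

section

open Set
open scoped ENNReal NNReal

variable {s : ℕ} {p : Fin s → ℕ} [∀ i, Fact (p i).Prime] {m n : ℕ}

/-- The matrix over `ℚ_S` with given components at the places in `S`. -/
def adeleMatrix (A : (Fin m → Fin n → ℝ) × (∀ i, Fin m → Fin n → ℚ_[p i])) :
    Fin m → Fin n → SAdele p
  | a, b, none => A.1 a b
  | a, b, some i => A.2 i a b

/-- The identification of `Mat_{m,n}(ℚ_S)` with the product of its components. -/
def adeleMatrixEquiv (p : Fin s → ℕ) [∀ i, Fact (p i).Prime] (m n : ℕ) :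
    ((Fin m → Fin n → ℝ) × (∀ i, Fin m → Fin n → ℚ_[p i])) ≃ₜ+ (Fin m → Fin n → SAdele p) where
  toFun := adeleMatrix
  invFun A := (fun a b => A a b none, fun i a b => A a b (some i))
  left_inv _ := rfl
  right_inv A := by
    funext a b v
    cases v <;> rfl
  map_add' A B := by
    funext a b v
    cases v <;> rfl
  continuous_toFun := by
    refine continuous_pi fun a => continuous_pi fun b => continuous_pi fun v => ?_
    cases v with
    | none => exact (continuous_apply_apply a b).comp continuous_fst
    | some i =>
      exact (continuous_apply_apply a b).comp ((continuous_apply i).comp continuous_snd)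
  continuous_invFun := by
    have h : ∀ a b v, Continuous fun A : Fin m → Fin n → SAdele p => A a b v := fun a b v =>
      (continuous_apply v).comp (continuous_apply_apply a b)
    exact (continuous_pi fun a => continuous_pi fun b => h a b none).prodMk
      (continuous_pi fun i => continuous_pi fun a => continuous_pi fun b => h a b (some i))

variable [∀ i, MeasurableSpace ℚ_[p i]] [∀ i, BorelSpace ℚ_[p i]]

theorem ae_adeleMatrix (ν : ∀ i, Measure (Fin m → Fin n → ℚ_[p i]))
    [∀ i, (ν i).IsAddHaarMeasure] {P : (Fin m → Fin n → SAdele p) → Prop} (h : ∀ᵐ A, P A) :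
    ∀ᵐ A ∂((volume : Measure (Fin m → Fin n → ℝ)).prod (Measure.pi ν)), P (adeleMatrix A) := by
  have (i : Fin s) : SecondCountableTopology (Fin m → Fin n → ℚ_[p i]) := inferInstance
  have (i : Fin s) : BorelSpace (Fin m → Fin n → ℚ_[p i]) := inferInstance
  have (i : Fin s) : SigmaFinite (ν i) := inferInstance
  have : BorelSpace (∀ i, Fin m → Fin n → ℚ_[p i]) := inferInstance
  have : (Measure.pi ν).IsAddHaarMeasure := inferInstance
  have : ((volume : Measure (Fin m → Fin n → ℝ)).prod (Measure.pi ν)).IsAddHaarMeasure :=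
    Measure.prod.instIsAddHaarMeasure _ _
  have hmeas : Measurable (adeleMatrixEquiv p m n) :=
    (adeleMatrixEquiv p m n).continuous.measurable
  have h1 : (Measure.map (adeleMatrixEquiv p m n)
      ((volume : Measure (Fin m → Fin n → ℝ)).prod (Measure.pi ν))).IsAddHaarMeasure :=
    (adeleMatrixEquiv p m n).isAddHaarMeasure_map _
  exact ae_of_ae_map hmeas.aemeasurable
    ((Measure.absolutelyContinuous_isAddHaarMeasure _ _).ae_le h)

theorem abs_div_sub_one_lt {x E K ε : ℝ} (hε : 0 < ε) (hE : 0 < E) (hK : K ≤ ε / 4 * E)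
    (h1 : x ≤ (1 + ε / 4) * E + K) (h2 : E ≤ (1 + ε / 4) * x) : |x / E - 1| < ε := by
  have hx : 0 < x := by
    by_contra hx
    nlinarith
  rw [div_sub_one hE.ne', abs_div, abs_of_pos hE, div_lt_iff₀ hE, abs_lt]
  constructor <;> nlinarith [mul_pos hε hE, mul_pos hε hx]

variable (ψ : ApproxFamily m n s p) (hm : 0 < m) (hn : 0 < n)

namespace ApproxFamily

theorem cut_g_le (T : Option (Fin s) → ℝ) (v : Option (Fin s)) (t : ℝ) :
    (ψ.cut hm hn T).g v t ≤ (ψ.profile hm hn).g v t :=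
  indicator_le_self' (fun _ _ => (ψ.profile hm hn).nonneg v _) t

theorem cut_V_ne_top (T : Option (Fin s) → ℝ) : (ψ.cut hm hn T).V ≠ ∞ :=
  ENNReal.prod_ne_top fun v _ => by
    rw [cut, Profile.trunc_W, LowerSet.coe_Iic]
    exact Profile.normMeasure_Iic_ne_top _ v _

theorem toReal_kgDensity_mul_V (μ : ∀ i, Measure (Fin n → ℚ_[p i])) [∀ i, (μ i).IsAddHaarMeasure]
    (hμ : ∀ i, μ i {y | ∀ j, ‖y j‖ ≤ 1} = 1) (N : ℕ) {TR : ℝ} {TP : Fin s → ℝ} (hTR : 0 ≤ TR)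
    (hTP : ∀ i, 0 ≤ TP i) :
    (kgDensity m n N * (ψ.cut hm hn fun v => v.elim TR TP).V).toReal =
      KGvol m n p ψ μ TR TP / (N : ℝ) ^ (m + n) := by
  rw [ψ.KGvol_eq hm hn μ hμ hTR hTP, ENNReal.toReal_mul, kgDensity, ENNReal.toReal_div,
    ENNReal.toReal_pow, ENNReal.toReal_pow, ENNReal.toReal_natCast, ENNReal.toReal_ofNat]
  ring

theorem KGcount_bounds (hp : Function.Injective p) {N : ℕ} (hN : 0 < N)
    (hNS : Nat.Coprime N (∏ i, p i)) (μ : ∀ i, Measure (Fin n → ℚ_[p i]))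
    [∀ i, (μ i).IsAddHaarMeasure] (hμ : ∀ i, μ i {y | ∀ j, ‖y j‖ ≤ 1} = 1)
    {vm : Fin m → ℚ} (hvm : ∀ a, vm a ∈ ZS p) {vn : Fin n → ℚ}
    (A : (Fin m → Fin n → ℝ) × (∀ i, Fin m → Fin n → ℚ_[p i])) {δ : ℝ} (hδ : 0 < δ)
    {TR : ℝ} {TP : Fin s → ℝ} (hTR : 0 ≤ TR) (hTP : ∀ i, 0 ≤ TP i)
    (h1 : (ψ.cut hm hn fun v => v.elim TR TP).count N vm (cosetVecs p N vn) (adeleMatrix A) ≤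
      ENNReal.ofReal (1 + δ) * (kgDensity m n N * (ψ.cut hm hn fun v => v.elim TR TP).V))
    (h2 : kgDensity m n N * (ψ.cut hm hn fun v => v.elim TR TP).V ≤ ENNReal.ofReal (1 + δ) *
      (ψ.cut hm hn fun v => v.elim TR TP).count N vm (cosetVecs p N vn) (adeleMatrix A)) :
    (KGcount m n p ψ N vm vn A.1 A.2 TR TP : ℝ) ≤
        (1 + δ) * (KGvol m n p ψ μ TR TP / (N : ℝ) ^ (m + n)) +
          ((ψ.profile hm hn).hits N vm 0 (adeleMatrix A)).toReal ∧
      KGvol m n p ψ μ TR TP / (N : ℝ) ^ (m + n) ≤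
        (1 + δ) * KGcount m n p ψ N vm vn A.1 A.2 TR TP := by
  rw [← ψ.toReal_kgDensity_mul_V hm hn μ hμ N hTR hTP]
  set χ := ψ.cut hm hn fun v => v.elim TR TP
  set E := kgDensity m n N * χ.V
  have hE : E ≠ ∞ := ENNReal.mul_ne_top (kgDensity_ne_top m n hN) (ψ.cut_V_ne_top hm hn _)
  clear_value E
  have hK := Profile.hits_zero_ne_top hp hN hNS (ψ.profile hm hn) hm vm (adeleMatrix A)
  have hc := χ.count_residueVecs_le N vm vn (adeleMatrix A)
  have henc : ((solutionSet ψ N vm vn A.1 A.2 TR TP).encard : ℝ≥0∞) =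
      χ.count N vm (residueVecs p N vn) (adeleMatrix A) :=
    encard_solutionSet ψ hm hn hN hvm vn (adeleMatrix A) hTR hTP
  rw [← henc] at hc
  have hup : ((solutionSet ψ N vm vn A.1 A.2 TR TP).encard : ℝ≥0∞) ≤
      ENNReal.ofReal (1 + δ) * E + (ψ.profile hm hn).hits N vm 0 (adeleMatrix A) :=
    hc.2.trans (add_le_add h1 (Profile.hits_mono (ψ.cut_g_le hm hn _) N vm 0 _))
  have hup' : ENNReal.ofReal (1 + δ) * E ≠ ∞ := ENNReal.mul_ne_top ENNReal.ofReal_ne_top hE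
  have hfin : (solutionSet ψ N vm vn A.1 A.2 TR TP).Finite := by
    rw [← Set.encard_ne_top_iff]
    intro htop
    rw [htop] at hup
    exact ENNReal.add_ne_top.2 ⟨hup', hK⟩ (top_le_iff.1 hup)
  have hcard : ((solutionSet ψ N vm vn A.1 A.2 TR TP).encard : ℝ≥0∞).toReal =
      KGcount m n p ψ N vm vn A.1 A.2 TR TP := by
    rw [← hfin.cast_ncard_eq, ENat.toENNReal_coe, ENNReal.toReal_natCast]
    rfl
  have hcfin : ((solutionSet ψ N vm vn A.1 A.2 TR TP).encard : ℝ≥0∞) ≠ ∞ :=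
    ne_top_of_le_ne_top (ENNReal.add_ne_top.2 ⟨hup', hK⟩) hup
  rw [← hcard]
  constructor
  · have := ENNReal.toReal_mono (ENNReal.add_ne_top.2 ⟨hup', hK⟩) hup
    rwa [ENNReal.toReal_add hup' hK, ENNReal.toReal_mul, ENNReal.toReal_ofReal (by linarith)]
      at this
  · have := ENNReal.toReal_mono (ENNReal.mul_ne_top ENNReal.ofReal_ne_top hcfin)
      (h2.trans (mul_le_mul' le_rfl hc.1))
    rwa [ENNReal.toReal_mul, ENNReal.toReal_ofReal (by linarith)] at this

end ApproxFamily

end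

/-- **Quantitative S-arithmetic Khintchine–Groshev theorem.**
Assume `V_ψ(T) → ∞` as `T → ∞`.  For almost every `A ∈ Mat_{m,n}(ℚ_S)`,
`N_{ψ,A}(T) / (V_ψ(T)/N^d) → 1` as `T → ∞`. -/
theorem s_arithmetic_quantitative_khintchine_groshev
    (m n : ℕ) (hm : 0 < m) (hn : 0 < n) (hd : 2 ≤ m + n)
    (s : ℕ) (p : Fin s → ℕ) [∀ i, Fact (p i).Prime] (hpinj : Function.Injective p)
    [∀ i, MeasurableSpace ℚ_[p i]] [∀ i, BorelSpace ℚ_[p i]]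
    (ψ : ApproxFamily m n s p)
    (N : ℕ) (hN : 0 < N) (hNS : Nat.Coprime N (∏ i, p i))
    (vm : Fin m → ℚ) (hvm : ∀ a, IsZS (∏ i, p i) (vm a))
    (vn : Fin n → ℚ) (hvn : ∀ b, IsZS (∏ i, p i) (vn b))
    -- Haar measure on `ℚ_S^n`, normalized so that `ℤ_p^n` has measure one at each
    -- finite place:
    (μ : ∀ i, Measure (Fin n → ℚ_[p i])) [∀ i, (μ i).IsAddHaarMeasure]
    (hμ : ∀ i, μ i {y | ∀ j, ‖y j‖ ≤ 1} = 1)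
    -- Haar measure on `Mat_{m,n}(ℚ_S)`, normalized likewise:
    (ν : ∀ i, Measure (Fin m → Fin n → ℚ_[p i])) [∀ i, (ν i).IsAddHaarMeasure]
    (hν : ∀ i, ν i {A | ∀ a b, ‖A a b‖ ≤ 1} = 1)
    -- `V_ψ(T) → ∞` as `T → ∞`:
    (hV : ∀ M : ℝ, ∃ (T0R : ℝ) (T0P : Fin s → ℝ),
      ∀ (TR : ℝ) (TP : Fin s → ℝ), 0 ≤ TR → (∀ i, ∃ k : ℤ, TP i = (p i : ℝ) ^ k) →
        T0R ≤ TR → (∀ i, T0P i ≤ TP i) → M ≤ KGvol m n p ψ μ TR TP) :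
    ∀ᵐ A ∂((volume : Measure (Fin m → Fin n → ℝ)).prod (Measure.pi ν)),
      ∀ ε : ℝ, 0 < ε → ∃ (T0R : ℝ) (T0P : Fin s → ℝ),
        ∀ (TR : ℝ) (TP : Fin s → ℝ), 0 ≤ TR → (∀ i, ∃ k : ℤ, TP i = (p i : ℝ) ^ k) →
          T0R ≤ TR → (∀ i, T0P i ≤ TP i) →
          |(KGcount m n p ψ N vm vn A.1 A.2 TR TP : ℝ)
              / (KGvol m n p ψ μ TR TP / (N : ℝ) ^ (m + n)) - 1| < ε := by

  have hae := ae_adeleMatrix ν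
    ((ψ.profile hm hn).ae_count (ψ.profile_g_eq_one hm hn) hpinj hN hNS hm hn hvm hvn)
  filter_upwards [hae] with A hA ε hε
  obtain ⟨M, hM, H⟩ := hA (ε / 4) (by linarith)
  set K := ((ψ.profile hm hn).hits N vm 0 (adeleMatrix A)).toReal with hK
  have hND : (0 : ℝ) < (N : ℝ) ^ (m + n) := pow_pos (Nat.cast_pos.2 hN) _
  obtain ⟨T0R, T0P, hT0⟩ :=
    hV (max (2 ^ m * M.toReal) (max 1 (K / (ε / 4) * (N : ℝ) ^ (m + n))))
  refine ⟨max T0R 1, fun i => max (T0P i) 1, fun TR TP hTR hTP hR hP => ?_⟩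
  have hR1 : 1 ≤ TR := (le_max_right _ _).trans hR
  have hP1 : ∀ i, 1 ≤ TP i := fun i => (le_max_right _ _).trans (hP i)
  have hTP0 : ∀ i, 0 ≤ TP i := fun i => zero_le_one.trans (hP1 i)
  have hvol := hT0 TR TP hTR hTP ((le_max_left _ _).trans hR)
    fun i => (le_max_left _ _).trans (hP i)
  rw [max_le_iff, max_le_iff] at hvol
  obtain ⟨hvM, hv1, hvK⟩ := hvol
  have hT1 : ∀ v : Option (Fin s), 1 ≤ v.elim TR TP
    | none => hR1
    | some i => hP1 i
  have hMV : M ≤ (ψ.cut hm hn fun v => v.elim TR TP).V := by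
    rw [ψ.KGvol_eq hm hn μ hμ hTR hTP0] at hvM
    exact (ENNReal.toReal_le_toReal hM (ψ.cut_V_ne_top hm hn _)).1
      (le_of_mul_le_mul_left hvM (by positivity))
  obtain ⟨h1, h2⟩ := H (fun v => v.elim TR TP ^ (n⁻¹ : ℝ))
    (fun v => Real.one_le_rpow (hT1 v) (by positivity)) hMV
  obtain ⟨hb1, hb2⟩ := ψ.KGcount_bounds hm hn hpinj hN hNS μ hμ hvm A (by linarith) hTR hTP0 h1 h2
  refine abs_div_sub_one_lt hε (div_pos (one_pos.trans_le hv1) hND) ?_ hb1 hb2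
  rw [← hK, ← div_le_iff₀' (by linarith), le_div_iff₀ hND]
  exact hvK

end
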